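/- arXiv:1206.6642 — 2 statements merged into one kernel-verified Lean document; each statement's English description precedes it below -/
import Mathlib

section
/- For every positive integer n coprime to 13 such that 24 divides 5²·13^{199}·n + 3, one has p_3((5²·13^{199}·n + 3)/24) ≡ 0 (mod 5²). -/
/-- `multipartition r n` is the number of `r`-component multipartitions of `n`,
i.e. the number of `r`-tuples of integer partitions whose sizes sum to `n`. -/
def multipartition (r n : ℕ) : ℕ :=
  ∑ c ∈ Finset.Nat.antidiagonalTuple r n, ∏ i, Fintype.card (Nat.Partition (c i))

section parta
open PowerSeries

namespace MP

/-- Euler product -/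
noncomputable def E : ℤ⟦X⟧ := pentagonalSeries ℤ

/-- Truncated Euler product -/
noncomputable def P (N : ℕ) : ℤ⟦X⟧ := ∏ j ∈ Finset.range N, (1 - X ^ (j + 1))

lemma P_succ (N : ℕ) : P (N + 1) = P N * (1 - X ^ (N + 1)) := by
  simp [P, Finset.prod_range_succ]

lemma coeff_P_stab (n N : ℕ) (h : n ≤ N) : coeff n (P N) = coeff n (P n) := by
  induction N, h using Nat.le_induction with
  | base => rfl
  | succ k hk ih =>
    rw [P_succ, mul_sub, mul_one, map_sub, coeff_mul_X_pow', ih]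
    rw [if_neg (by omega), sub_zero]

lemma coeff_E (n N : ℕ) (h : n ≤ N) : coeff n E = coeff n (P N) := by
  obtain ⟨s, hs⟩ := Filter.eventually_atTop.1 (coeff_prod_one_sub_X_pow_eventually_eq ℤ n)
  obtain ⟨M, hM⟩ := s.exists_nat_subset_range
  have h1 := hs (Finset.range (M + n)) (hM.trans (by simp))
  rw [E, ← h1, coeff_P_stab n N h]
  exact coeff_P_stab n (M + n) (by omega)

lemma E_trunc (N : ℕ) : X ^ (N + 1) ∣ E - P N := by
  rw [X_pow_dvd_iff]
  intro m hm
  rw [map_sub, coeff_E m N (by omega), sub_self]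

/-- partition generating function -/
noncomputable def pf : ℤ⟦X⟧ := PowerSeries.mk fun n => (Fintype.card (Nat.Partition n) : ℤ)

open scoped PowerSeries.WithPiTopology in
lemma pf_mul_E : pf * E = 1 := by
  have h1 := Nat.Partition.hasProd_powerSeriesMk_card_restricted ℤ (fun _ => True)
  have h2 := WithPiTopology.hasProd_one_sub_X_pow ℤ
  have h3 := h1.mul h2
  have h4 : (PowerSeries.mk fun n => ((Nat.Partition.restricted n (fun _ => True)).card : ℤ)) = pf := by
    ext n
    simp [pf, Nat.Partition.restricted]
  rw [h4] at h3
  have h5 : (fun i : ℕ => (if (fun _ => True) (i + 1) then ∑' j : ℕ, (X : ℤ⟦X⟧) ^ ((i + 1) * j) else 1) * (1 - X ^ (i + 1))) = fun _ => 1 := by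
    funext i
    simp only [if_true]
    simp_rw [pow_mul]
    apply WithPiTopology.tsum_pow_mul_one_sub_of_constantCoeff_eq_zero
    simp
  rw [h5] at h3
  exact h3.unique hasProd_one

lemma multi_eq (n : ℕ) : ((∑ c ∈ Finset.Nat.antidiagonalTuple 3 n, ∏ i, Fintype.card (Nat.Partition (c i)) : ℕ) : ℤ)
    = coeff n (pf ^ 3) := by
  push_cast
  have key : ∀ (k n : ℕ), coeff n (pf ^ k) = ∑ c ∈ Finset.Nat.antidiagonalTuple k n, ∏ i, (Fintype.card (Nat.Partition (c i)) : ℤ) := by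
    intro k
    induction k with
    | zero =>
      intro n
      cases n with
      | zero => simp
      | succ n => simp [coeff_one]
    | succ k ih =>
      intro n
      rw [pow_succ', coeff_mul]
      have : Finset.Nat.antidiagonalTuple (k+1) n = (Finset.HasAntidiagonal.antidiagonal n).biUnion (fun ni => (Finset.Nat.antidiagonalTuple k ni.2).image (fun x => (Fin.cons ni.1 x : Fin (k+1) → ℕ))) := by
        ext c
        simp only [Finset.mem_biUnion, Finset.mem_image, Finset.Nat.mem_antidiagonalTuple, Finset.HasAntidiagonal.mem_antidiagonal]
        constructor
        · intro h
          refine ⟨(c 0, ∑ i, Fin.tail c i), ?_, Fin.tail c, rfl, by simp⟩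
          rw [← h, Fin.sum_univ_succ]; rfl
        · rintro ⟨⟨a, b⟩, h, x, hx, rfl⟩
          rw [Fin.sum_univ_succ]
          simp only [Fin.cons_zero, Fin.cons_succ]
          simp at h hx
          omega
      rw [this, Finset.sum_biUnion]
      · apply Finset.sum_congr rfl
        intro p hp
        rw [Finset.sum_image]
        · rw [ih, Finset.mul_sum]
          apply Finset.sum_congr rfl
          intro x hx
          rw [Fin.prod_univ_succ]
          simp [pf]
        · intro x _ y _ h
          exact (Fin.cons_inj.1 h).2
      · intro p hp q hq hpq
        simp only [Function.onFun]
        rw [Finset.disjoint_left]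
        intro c hc hc'
        simp only [Finset.mem_image] at hc hc'
        obtain ⟨x, hx, rfl⟩ := hc
        obtain ⟨y, hy, h⟩ := hc'
        apply hpq
        have := (Fin.cons_inj.1 h).1
        simp only [Finset.mem_coe, Finset.HasAntidiagonal.mem_antidiagonal] at hp hq
        ext
        · exact this.symm
        · omega
  rw [key]

end MP
end parta

section partb
open PowerSeries

namespace MP

/-- Gaussian binomials -/
noncomputable def G : ℕ → ℕ → ℤ⟦X⟧
  | _, 0 => 1
  | 0, _ + 1 => 0
  | M + 1, i + 1 => G M i + X ^ (i + 1) * G M (i + 1)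

lemma G_zero (M : ℕ) : G M 0 = 1 := by cases M <;> simp [G]

lemma G_gt (M : ℕ) : ∀ i, M < i → G M i = 0 := by
  induction M with
  | zero => intro i hi; cases i with
    | zero => omega
    | succ i => simp [G]
  | succ M ih =>
    intro i hi
    cases i with
    | zero => omega
    | succ i => simp [G, ih i (by omega), ih (i+1) (by omega)]

lemma G_self (M : ℕ) : G M M = 1 := by
  induction M with
  | zero => simp [G]
  | succ M ih => simp [G, ih, G_gt M (M+1) (by omega)]

lemma G_mul (M : ℕ) : ∀ a b, a + b = M → G M a * P a * P b = P M := by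
  induction M with
  | zero =>
    intro a b h
    obtain ⟨rfl, rfl⟩ : a = 0 ∧ b = 0 := by omega
    simp [G, P]
  | succ M ih =>
    intro a b h
    cases a with
    | zero =>
      obtain rfl : b = M + 1 := by omega
      simp [G_zero, P]
    | succ a =>
      cases b with
      | zero =>
        obtain rfl : a = M := by omega
        rw [G_self]; simp [P]
      | succ b =>
        have h1 := ih a (b + 1) (by omega)
        have h2 := ih (a + 1) b (by omega)
        simp only [G]
        have h3 : (X : ℤ⟦X⟧) ^ (M + 1) = X ^ (a + 1) * X ^ (b + 1) := by
          rw [← pow_add]; congr 1; omega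
        rw [P_succ M, h3]
        calc _ = (G M a * P a * P (b+1)) * (1 - X ^ (a + 1)) + X ^ (a+1) * (G M (a+1) * P (a+1) * P b) * (1 - X ^ (b+1)) := by
                rw [P_succ a, P_succ b]; ring
          _ = _ := by rw [h1, h2]; ring

lemma P_ne_zero (N : ℕ) : P N ≠ 0 := by
  intro h
  have : constantCoeff (P N) = 1 := by
    simp [P, map_prod]
  rw [h] at this
  simp at this

lemma G_symm (a b : ℕ) : G (a + b) a = G (a + b) b := by
  have h1 := G_mul (a + b) a b rfl
  have h2 := G_mul (a + b) b a (by omega)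
  have : G (a+b) a * (P a * P b) = G (a+b) b * (P a * P b) := by
    rw [← mul_assoc, h1, ← h2]; ring
  exact mul_right_cancel₀ (mul_ne_zero (P_ne_zero a) (P_ne_zero b)) this

lemma q_binom {R : Type*} [CommRing R] (f : ℤ⟦X⟧ →+* R) (M : ℕ) : ∀ a b : R,
    ∏ j ∈ Finset.range M, (a + b * f X ^ j) =
      ∑ i ∈ Finset.range (M + 1), f X ^ (i.choose 2) * f (G M i) * b ^ i * a ^ (M - i) := by
  induction M with
  | zero => intro a b; simp [G]
  | succ M ih =>
    intro a b
    rw [Finset.prod_range_succ']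
    have h1 : ∏ k ∈ Finset.range M, (a + b * f X ^ (k + 1)) = ∏ k ∈ Finset.range M, (a + (b * f X) * f X ^ k) := by
      apply Finset.prod_congr rfl; intro k _; ring
    rw [h1, ih, Finset.sum_range_succ' _ (M + 1)]
    simp only [G, map_add, map_mul, map_pow]
    have h2 : ∀ i ∈ Finset.range (M+1), f X ^ ((i+1).choose 2) * (f (G M i) + f X ^ (i+1) * f (G M (i+1))) * b ^ (i+1) * a ^ (M + 1 - (i+1))
      = b * (f X ^ (i.choose 2) * f (G M i) * (b * f X) ^ i * a ^ (M - i)) +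
        a * (f X ^ ((i+1).choose 2) * f (G M (i+1)) * (b * f X) ^ (i+1) * a ^ (M - (i+1))) := by
      intro i hi
      rw [Finset.mem_range] at hi
      have : (i+1).choose 2 = i.choose 2 + i := by
        rw [Nat.choose_succ_succ' i 1]; simp; ring
      rcases Nat.lt_or_ge i M with h | h
      · have e : M - i = M - (i+1) + 1 := by omega
        rw [Nat.add_sub_add_right, e, this]; ring
      · obtain rfl : i = M := by omega
        rw [G_gt i (i+1) (by omega), this]; simp; ring
    rw [Finset.sum_congr rfl h2, Finset.sum_add_distrib, ← Finset.mul_sum, ← Finset.mul_sum]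
    have h3 := Finset.sum_range_succ' (fun i => f X ^ (i.choose 2) * f (G M i) * (b * f X) ^ i * a ^ (M - i)) (M)
    have h4 := Finset.sum_range_succ (fun i => f X ^ ((i+1).choose 2) * f (G M (i+1)) * (b * f X) ^ (i+1) * a ^ (M - (i+1))) M
    rw [h4, G_gt M (M+1) (by omega)]
    have h5 : ∑ i ∈ Finset.range M, f X ^ ((i+1).choose 2) * f (G M (i+1)) * (b * f X) ^ (i+1) * a ^ (M - (i+1)) = ∑ i ∈ Finset.range (M+1), f X ^ (i.choose 2) * f (G M i) * (b * f X) ^ i * a ^ (M - i) - a ^ M := by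
      rw [h3]; simp [G_zero]
    rw [h5]
    simp [G_zero]
    ring

lemma two_choose (m : ℕ) : 2 * m.choose 2 + m = m * m := by
  induction m with
  | zero => simp
  | succ m ih =>
    have : (m+1).choose 2 = m.choose 2 + m := by
      rw [Nat.choose_succ_succ' m 1]; simp; ring
    rw [this]; nlinarith

lemma prod_fin (N : ℕ) : ∏ j ∈ Finset.range N, ((X : ℤ⟦X⟧) ^ N - X ^ j) = (-1) ^ N * X ^ (N.choose 2) * P N := by
  have h1 : ∏ j ∈ Finset.range N, ((X : ℤ⟦X⟧) ^ N - X ^ j) = ∏ j ∈ Finset.range N, ((-1) * X ^ j * (1 - X ^ (N - j))) := by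
    apply Finset.prod_congr rfl
    intro j hj
    rw [Finset.mem_range] at hj
    have : (X : ℤ⟦X⟧) ^ N = X ^ j * X ^ (N - j) := by rw [← pow_add]; congr 1; omega
    rw [this]; ring
  rw [h1, Finset.prod_mul_distrib, Finset.prod_mul_distrib, Finset.prod_const, Finset.prod_pow_eq_pow_sum, Finset.card_range, Finset.sum_range_id, Nat.choose_two_right]
  congr 1
  rw [P, ← Finset.prod_range_reflect]
  apply Finset.prod_congr rfl
  intro j hj
  rw [Finset.mem_range] at hj
  congr 2; omega

lemma finite_jacobi (N : ℕ) : P N ^ 2 =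
    ∑ k ∈ Finset.range (N + 1), (-1) ^ k * (2 * (k : ℤ⟦X⟧) + 1) * X ^ ((k+1).choose 2) * G (2 * N + 1) (N - k) := by
  have hq := q_binom (Polynomial.C : ℤ⟦X⟧ →+* _) (2 * N + 1) (Polynomial.X * Polynomial.C (X ^ N)) (-1)
  have hL : ∏ j ∈ Finset.range (2 * N + 1), ((Polynomial.X : Polynomial ℤ⟦X⟧) * Polynomial.C (X ^ N) + -1 * Polynomial.C X ^ j)
     = (Polynomial.X - 1) * (Polynomial.C (X ^ N) * ((∏ j ∈ Finset.range N, (Polynomial.X * Polynomial.C (X ^ N) + -1 * Polynomial.C X ^ j)) *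
        ∏ j ∈ Finset.range N, (Polynomial.X * Polynomial.C (X ^ N) + -1 * Polynomial.C X ^ (N + 1 + j)))) := by
    have : 2 * N + 1 = (N + 1) + N := by ring
    rw [this, Finset.prod_range_add, Finset.prod_range_succ]
    simp only [map_pow]
    ring
  rw [hL] at hq
  have hd := congrArg (fun p => Polynomial.eval 1 (Polynomial.derivative p)) hq
  simp only [Polynomial.derivative_mul, Polynomial.eval_add, Polynomial.eval_mul, Polynomial.derivative_sub, Polynomial.derivative_X, Polynomial.derivative_one, Polynomial.eval_sub, Polynomial.eval_X, Polynomial.eval_one, sub_self, zero_mul, add_zero, sub_zero, one_mul, Polynomial.eval_C, Polynomial.eval_prod, Polynomial.eval_neg, Polynomial.eval_pow] at hd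
  have hr : Polynomial.eval 1 (Polynomial.derivative (∑ i ∈ Finset.range (2 * N + 1 + 1), Polynomial.C (X : ℤ⟦X⟧) ^ (i.choose 2) * Polynomial.C (G (2 * N + 1) i) * (-1) ^ i * (Polynomial.X * Polynomial.C (X ^ N)) ^ (2 * N + 1 - i)))
     = ∑ i ∈ Finset.range (2 * N + 1 + 1), X ^ (i.choose 2) * (G (2 * N + 1) i) * (-1) ^ i * (((2 * N + 1 - i : ℕ) : ℤ⟦X⟧) * X ^ (N * (2 * N + 1 - i))) := by
    rw [Polynomial.derivative_sum, Polynomial.eval_finsetSum]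
    apply Finset.sum_congr rfl
    intro i hi
    have : Polynomial.C (X : ℤ⟦X⟧) ^ (i.choose 2) * Polynomial.C (G (2 * N + 1) i) * (-1) ^ i * (Polynomial.X * Polynomial.C (X ^ N)) ^ (2 * N + 1 - i)
      = Polynomial.C (X ^ (i.choose 2) * (G (2 * N + 1) i) * (-1) ^ i * X ^ (N * (2 * N + 1 - i))) * Polynomial.X ^ (2 * N + 1 - i) := by
      simp only [map_mul, map_pow, map_neg, map_one, mul_pow, pow_mul]; ring
    rw [this, Polynomial.derivative_C_mul, Polynomial.derivative_X_pow]
    simp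
    ring
  rw [hr] at hd
  have hA : ∏ j ∈ Finset.range N, ((X : ℤ⟦X⟧) ^ N + -1 * X ^ j) = (-1) ^ N * X ^ (N.choose 2) * P N := by
    rw [← prod_fin]; apply Finset.prod_congr rfl; intro j _; ring
  have hB : ∏ j ∈ Finset.range N, ((X : ℤ⟦X⟧) ^ N + -1 * X ^ (N + 1 + j)) = X ^ (N * N) * P N := by
    have hc : (X : ℤ⟦X⟧) ^ (N * N) = ∏ j ∈ Finset.range N, X ^ N := by
      rw [Finset.prod_const, Finset.card_range, pow_mul]
    rw [P, hc, ← Finset.prod_mul_distrib]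
    apply Finset.prod_congr rfl; intro j _; ring
  rw [hA, hB] at hd
  have hs : 2 * N + 1 + 1 = (N + 1) + (N + 1) := by ring
  rw [hs, Finset.sum_range_add, ← Finset.sum_range_reflect, ← Finset.sum_add_distrib] at hd
  have hc : ((-1) ^ N * X ^ (N + N.choose 2 + N * N) : ℤ⟦X⟧) ≠ 0 := by
    apply mul_ne_zero
    · exact pow_ne_zero _ (by norm_num)
    · exact pow_ne_zero _ X_ne_zero
  apply mul_left_cancel₀ hc
  rw [Finset.mul_sum]
  calc _ = X ^ N * ((-1) ^ N * X ^ (N.choose 2) * P N * (X ^ (N * N) * P N)) := by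
          rw [pow_add, pow_add]; ring
    _ = _ := by
      rw [hd]
      apply Finset.sum_congr rfl
      intro k hk
      rw [Finset.mem_range] at hk
      obtain ⟨m, rfl⟩ : ∃ m, N = k + m := ⟨N - k, by omega⟩
      have e1 : k + m + 1 - 1 - k = m := by omega
      have e2 : k + m - k = m := by omega
      have e3 : 2 * (k + m) + 1 - m = 2 * k + m + 1 := by omega
      have e4 : 2 * (k + m) + 1 - (k + m + 1 + k) = m := by omega
      rw [e1, e2, e3, e4]
      have hG : G (2 * (k + m) + 1) (k + m + 1 + k) = G (2 * (k + m) + 1) m := by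
        have := G_symm (k + m + 1 + k) m
        have e : k + m + 1 + k + m = 2 * (k + m) + 1 := by ring
        rwa [e] at this
      rw [hG]
      have x1 : (X : ℤ⟦X⟧) ^ (m.choose 2) * X ^ ((k+m) * (2 * k + m + 1)) = X ^ (k + m + (k+m).choose 2 + (k+m)*(k+m)) * X ^ ((k+1).choose 2) := by
        rw [← pow_add, ← pow_add]; congr 1
        have := two_choose m; have := two_choose (k+m); have := two_choose (k+1)
        nlinarith
      have x2 : (X : ℤ⟦X⟧) ^ ((k+m+1+k).choose 2) * X ^ ((k+m) * m) = X ^ (k + m + (k+m).choose 2 + (k+m)*(k+m)) * X ^ ((k+1).choose 2) := by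
        rw [← pow_add, ← pow_add]; congr 1
        have := two_choose (k+m+1+k); have := two_choose (k+m); have := two_choose (k+1)
        nlinarith
      have s1 : ((-1) : ℤ⟦X⟧) ^ m = (-1) ^ (k+m) * (-1) ^ k := by
        rw [← pow_add]
        have : k + m + k = m + 2 * k := by ring
        rw [this, pow_add, pow_mul]; simp
      have s2 : ((-1) : ℤ⟦X⟧) ^ (k+m+1+k) = -((-1) ^ (k+m) * (-1) ^ k) := by
        rw [pow_add, pow_add]; ring
      rw [s1, s2]
      push_cast
      linear_combination (G (2 * (k + m) + 1) m * (-1) ^ (k+m) * (-1) ^ k * (2 * k + m + 1)) * x1 - (G (2 * (k + m) + 1) m * (-1) ^ (k+m) * (-1) ^ k * m) * x2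

/-- Jacobi's theorem, truncated. -/
lemma jacobi_trunc (L : ℕ) : X ^ L ∣ E ^ 3 - ∑ k ∈ Finset.range (2 * L + 1), (-1) ^ k * (2 * (k : ℤ⟦X⟧) + 1) * X ^ ((k+1).choose 2) := by
  have hE : ∀ N, L ≤ N → X ^ L ∣ E - P N := fun N h => (pow_dvd_pow X (by omega)).trans (E_trunc N)
  have hfin := finite_jacobi (2 * L)
  have hk : ∀ k ∈ Finset.range (2 * L + 1), (X : ℤ⟦X⟧) ^ L ∣ ((-1) ^ k * (2 * (k : ℤ⟦X⟧) + 1) * X ^ ((k+1).choose 2)) * (E * G (2 * (2 * L) + 1) (2 * L - k) - 1) := by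
    intro k hk
    rw [Finset.mem_range] at hk
    by_cases h : L ≤ (k+1).choose 2
    · exact Dvd.dvd.mul_right (Dvd.dvd.mul_left (pow_dvd_pow X h) _) _
    · have hkL : k < L + 1 := by
        by_contra hc
        apply h
        have := two_choose (k+1)
        nlinarith
      apply Dvd.dvd.mul_left
      have g := G_mul (2 * (2 * L) + 1) (2 * L - k) (2 * L + 1 + k) (by omega)
      have h1 := hE (2 * L - k) (by
        rcases Nat.lt_or_ge k L with h' | h'
        · omega
        · obtain rfl : k = L := by omega
          omega)
      have h2 := hE (2 * L + 1 + k) (by omega)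
      have h3 := hE (2 * (2 * L) + 1) (by omega)
      have hu : pf * E = 1 := pf_mul_E
      obtain ⟨u1, h1⟩ := h1
      obtain ⟨u2, h2⟩ := h2
      obtain ⟨u3, h3⟩ := h3
      set g0 := G (2 * (2 * L) + 1) (2 * L - k)
      have e1 : P (2 * L - k) = E - X ^ L * u1 := by rw [← h1]; ring
      have e2 : P (2 * L + 1 + k) = E - X ^ L * u2 := by rw [← h2]; ring
      have e3 : P (2 * (2 * L) + 1) = E - X ^ L * u3 := by rw [← h3]; ring
      rw [e1, e2, e3] at g
      refine ⟨pf * (g0 * u1 * E + g0 * u2 * E - X ^ L * g0 * u1 * u2 - u3), ?_⟩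
      linear_combination pf * g - (g0 * E - 1) * hu
  have h0 := hE (2 * L) (by omega)
  have hsum := Finset.dvd_sum hk
  have : E ^ 3 - ∑ k ∈ Finset.range (2 * L + 1), (-1) ^ k * (2 * (k : ℤ⟦X⟧) + 1) * X ^ ((k+1).choose 2) =
    (E - P (2 * L)) * (E * (E + P (2 * L))) + ∑ k ∈ Finset.range (2 * L + 1), ((-1) ^ k * (2 * (k : ℤ⟦X⟧) + 1) * X ^ ((k+1).choose 2)) * (E * G (2 * (2 * L) + 1) (2 * L - k) - 1) := by
    have e : ∑ k ∈ Finset.range (2 * L + 1), ((-1) ^ k * (2 * (k : ℤ⟦X⟧) + 1) * X ^ ((k+1).choose 2)) * (E * G (2 * (2 * L) + 1) (2 * L - k) - 1) = E * P (2 * L) ^ 2 - ∑ k ∈ Finset.range (2 * L + 1), (-1) ^ k * (2 * (k : ℤ⟦X⟧) + 1) * X ^ ((k+1).choose 2) := by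
      rw [hfin, Finset.mul_sum, ← Finset.sum_sub_distrib]
      apply Finset.sum_congr rfl
      intro k _; ring
    rw [e]; ring
  rw [this]
  exact dvd_add (Dvd.dvd.mul_right h0 _) hsum

end MP
end partb

section partc
open PowerSeries

namespace MP

/-- Jacobi theta -/
noncomputable def J : ℤ⟦X⟧ := E ^ 3

lemma coeff_J (n L : ℕ) (h : n < L) : coeff n J = ∑ k ∈ Finset.range (2 * L + 1), if n = (k+1).choose 2 then (-1) ^ k * (2 * (k : ℤ) + 1) else 0 := by
  have h1 := (X_pow_dvd_iff.1 (jacobi_trunc L)) n h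
  rw [map_sub, sub_eq_zero, map_sum] at h1
  rw [J, h1]
  apply Finset.sum_congr rfl
  intro k _
  have : ((-1) ^ k * (2 * (k : ℤ⟦X⟧) + 1) * X ^ ((k+1).choose 2)) = C ((-1) ^ k * (2 * (k : ℤ) + 1)) * X ^ ((k+1).choose 2) := by
    simp
  rw [this, coeff_C_mul_X_pow]

lemma tri_two (k : ℕ) : 2 * (k+1).choose 2 = k * (k + 1) := by
  have := two_choose (k+1)
  nlinarith

lemma tri_inj {k l : ℕ} (h : (k+1).choose 2 = (l+1).choose 2) : k = l := by
  have h1 := tri_two k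
  have h2 := tri_two l
  rw [h, h2] at h1
  rcases lt_trichotomy k l with h3 | h3 | h3
  · nlinarith
  · exact h3
  · nlinarith

lemma coeff_J_tri (k : ℕ) : coeff ((k+1).choose 2) J = (-1) ^ k * (2 * (k : ℤ) + 1) := by
  rw [coeff_J _ ((k+1).choose 2 + k + 1) (by omega), Finset.sum_eq_single k]
  · simp
  · intro b _ hb
    rw [if_neg]
    intro h
    exact hb (tri_inj h).symm
  · intro h
    simp at h
    omega

lemma coeff_J_not (n : ℕ) (h : ∀ k : ℕ, (k+1).choose 2 ≠ n) : coeff n J = 0 := by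
  rw [coeff_J n (n+1) (by omega)]
  apply Finset.sum_eq_zero
  intro k _
  rw [if_neg (fun h' => h k h'.symm)]

lemma tri_mod5 (k t : ℕ) (h : (k+1).choose 2 = t) :
    (k % 5 = 0 ∧ t % 5 = 0) ∨ (k % 5 = 1 ∧ t % 5 = 1) ∨ (k % 5 = 2 ∧ t % 5 = 3) ∨ (k % 5 = 3 ∧ t % 5 = 1) ∨ (k % 5 = 4 ∧ t % 5 = 0) := by
  have h1 := tri_two k
  rw [h] at h1
  have h2 : (k * (k + 1)) % 5 = ((k % 5) * (k % 5 + 1)) % 5 := by simp [Nat.mul_mod, Nat.add_mod]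
  have h5 : k % 5 < 5 := Nat.mod_lt _ (by norm_num)
  rw [← h1] at h2
  interval_cases h : k % 5 <;> omega

lemma J_2 (n : ℕ) : coeff (5 * n + 2) J = 0 := by
  apply coeff_J_not
  intro k hk
  have := tri_mod5 k _ hk
  omega

lemma J_4 (n : ℕ) : coeff (5 * n + 4) J = 0 := by
  apply coeff_J_not
  intro k hk
  have := tri_mod5 k _ hk
  omega

lemma tri5 (l : ℕ) : (5 * l + 2 + 1).choose 2 = 25 * (l+1).choose 2 + 3 := by
  have := tri_two l
  have := tri_two (5 * l + 2)
  nlinarith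

/-- expand by five -/
noncomputable abbrev phi {R : Type*} [CommRing R] : R⟦X⟧ →ₐ[R] R⟦X⟧ := PowerSeries.expand 5 (by norm_num)

lemma J_3 (n : ℕ) : coeff (5 * n + 3) J = 5 * coeff n (phi J) := by
  by_cases h : ∃ l : ℕ, n = 5 * (l+1).choose 2
  · obtain ⟨l, rfl⟩ := h
    rw [coeff_expand_mul, coeff_J_tri]
    have : 5 * (5 * (l+1).choose 2) + 3 = (5 * l + 2 + 1).choose 2 := by rw [tri5]; ring
    rw [this, coeff_J_tri, pow_add, pow_mul]
    push_cast
    norm_num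
    ring
  · push Not at h
    have h1 : coeff n (phi J) = 0 := by
      by_cases hd : 5 ∣ n
      · obtain ⟨m, rfl⟩ := hd
        rw [coeff_expand_mul]
        apply coeff_J_not
        intro k hk
        exact h k (by rw [hk])
      · exact coeff_expand_of_not_dvd _ _ _ hd
    rw [h1, mul_zero]
    apply coeff_J_not
    intro k hk
    have h6 := tri_mod5 k _ hk
    obtain ⟨l, rfl⟩ : ∃ l, k = 5 * l + 2 := ⟨k / 5, by omega⟩
    rw [tri5] at hk
    exact h l (by omega)

/-- representation by weighted counting -/
def Rep {ι : Type} (f : ℤ⟦X⟧) (d : ι → ℕ) (w : ι → ℤ) : Prop :=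
  ∀ n, ∃ s : Finset ι, (∀ x, x ∈ s ↔ d x = n) ∧ coeff n f = ∑ x ∈ s, w x

open Classical in
lemma Rep.mul {ι κ : Type} {f g : ℤ⟦X⟧} {d : ι → ℕ} {w : ι → ℤ} {d' : κ → ℕ} {w' : κ → ℤ}
    (hf : Rep f d w) (hg : Rep g d' w') :
    Rep (f * g) (fun p : ι × κ => d p.1 + d' p.2) (fun p => w p.1 * w' p.2) := by
  choose s hs hs' using hf
  choose t ht ht' using hg
  intro n
  refine ⟨(Finset.HasAntidiagonal.antidiagonal n).biUnion (fun p => s p.1 ×ˢ t p.2), ?_, ?_⟩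
  · intro x
    simp only [Finset.mem_biUnion, Finset.mem_product, hs, ht, Finset.HasAntidiagonal.mem_antidiagonal]
    constructor
    · rintro ⟨a, h1, h2, h3⟩; omega
    · intro h; exact ⟨(d x.1, d' x.2), h, rfl, rfl⟩
  · rw [coeff_mul, Finset.sum_biUnion]
    · apply Finset.sum_congr rfl
      intro p _
      rw [hs', ht', Finset.sum_mul_sum, Finset.sum_product]
    · intro p _ q _ hpq
      simp only [Function.onFun]
      rw [Finset.disjoint_left]
      intro c hc hc'
      simp only [Finset.mem_product, hs, ht] at hc hc'
      apply hpq
      ext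
      · omega
      · omega

lemma Rep.expand5 {ι : Type} {f : ℤ⟦X⟧} {d : ι → ℕ} {w : ι → ℤ} (hf : Rep f d w) :
    Rep (phi f) (fun x => 5 * d x) w := by
  intro n
  by_cases h : 5 ∣ n
  · obtain ⟨m, rfl⟩ := h
    obtain ⟨s, hs, hs'⟩ := hf m
    refine ⟨s, ?_, ?_⟩
    · intro x; rw [hs]; show d x = m ↔ 5 * d x = 5 * m; omega
    · rw [coeff_expand_mul, hs']
  · refine ⟨∅, ?_, ?_⟩
    · intro x
      simp only [Finset.notMem_empty, false_iff]
      rintro rfl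
      exact h ⟨_, rfl⟩
    · rw [coeff_expand_of_not_dvd _ _ _ h]; simp

/-- the weight of an integer -/
def wt (x : ℤ) : ℤ := ZMod.χ₄ (x : ZMod 4) * x

/-- expand by eight -/
noncomputable abbrev phi8 : ℤ⟦X⟧ →ₐ[ℤ] ℤ⟦X⟧ := PowerSeries.expand 8 (by norm_num)

/-- two-sided theta -/
noncomputable def Th : ℤ⟦X⟧ := 2 * X * phi8 J

lemma coeff_Th (m : ℕ) : coeff (8 * m + 1) Th = 2 * coeff m J := by
  have : Th = C 2 * (phi8 J * X) := by rw [Th, map_ofNat]; ring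
  rw [this, coeff_C_mul, coeff_succ_mul_X, coeff_expand_mul]

lemma coeff_Th' (n : ℕ) (h : n % 8 ≠ 1) : coeff n Th = 0 := by
  have : Th = C 2 * (phi8 J * X) := by rw [Th, map_ofNat]; ring
  rw [this, coeff_C_mul]
  cases n with
  | zero => simp
  | succ n => rw [coeff_succ_mul_X, coeff_expand_of_not_dvd _ _ _ (by omega), mul_zero]

lemma rep_Th : Rep Th (fun x : ℤ => x.natAbs ^ 2) wt := by
  intro n
  by_cases h : ∃ x : ℕ, x ^ 2 = n
  · obtain ⟨x, rfl⟩ := h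
    refine ⟨{(x : ℤ), -(x : ℤ)}, ?_, ?_⟩
    · intro y
      simp only [Finset.mem_insert, Finset.mem_singleton]
      rw [Nat.pow_left_inj (by norm_num)]
      omega
    · rcases Nat.even_or_odd' x with ⟨k, rfl | rfl⟩
      · rw [coeff_Th']
        · symm
          apply Finset.sum_eq_zero
          intro y hy
          have : (y : ZMod 4) = 0 ∨ (y : ZMod 4) = 2 := by
            simp only [Finset.mem_insert, Finset.mem_singleton] at hy
            have : ((k : ZMod 4)) = 0 ∨ (k : ZMod 4) = 1 ∨ (k : ZMod 4) = 2 ∨ (k : ZMod 4) = 3 := by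
              generalize (k : ZMod 4) = z
              revert z; decide
            rcases hy with rfl | rfl <;> push_cast <;> rcases this with h | h | h | h <;> rw [h] <;> decide
          unfold wt
          rcases this with h | h <;> rw [h]
          · have : ZMod.χ₄ 0 = 0 := by decide
            rw [this, zero_mul]
          · have : ZMod.χ₄ 2 = 0 := by decide
            rw [this, zero_mul]
        · have : (2 * k) ^ 2 = 4 * k ^ 2 := by ring
          omega
      · have h1 : (2 * k + 1) ^ 2 = 8 * (k+1).choose 2 + 1 := by
          have := tri_two k
          nlinarith
        rw [h1, coeff_Th, coeff_J_tri, Finset.sum_pair (by omega)]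
        have h2 := ZMod.χ₄_eq_neg_one_pow (n := 2 * k + 1) (by omega)
        have h3 : (2 * k + 1) / 2 = k := by omega
        rw [h3] at h2
        have h4 : ZMod.χ₄ (-1) = -1 := by decide
        have h5 : ZMod.χ₄ (-((2 * k + 1 : ℕ) : ZMod 4)) = - (-1) ^ k := by
          rw [← h2, neg_eq_neg_one_mul, map_mul, h4]; ring
        unfold wt
        rw [Int.cast_neg, Int.cast_natCast, h5, h2]
        push_cast
        ring
  · push Not at h
    refine ⟨∅, ?_, ?_⟩
    · intro y
      simp only [Finset.notMem_empty, false_iff]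
      exact h _
    · rw [Finset.sum_empty]
      by_cases h8 : n % 8 = 1
      · obtain ⟨m, rfl⟩ : ∃ m, n = 8 * m + 1 := ⟨n / 8, by omega⟩
        rw [coeff_Th, coeff_J_not, mul_zero]
        rintro k rfl
        apply h (2 * k + 1)
        have := tri_two k
        nlinarith
      · exact coeff_Th' _ h8

lemma chi_neg (z : ZMod 4) : ZMod.χ₄ (-z) = - ZMod.χ₄ z := by
  revert z; decide

lemma sq_sum_J (n : ℕ) : (25 : ℤ) ∣ coeff (5 * n + 1) (J ^ 2) + 6 * coeff n (J ^ 2) := by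
  have hR := rep_Th.mul rep_Th
  have hT : ∀ n, coeff (8 * n + 2) (Th * Th) = 4 * coeff n (J ^ 2) := by
    intro n
    have : Th * Th = C 4 * (phi8 (J ^ 2) * X ^ 2) := by
      have : (C 4 : ℤ⟦X⟧) = 4 := map_ofNat _ _
      rw [this, Th, map_pow]; ring
    rw [this, coeff_C_mul, coeff_mul_X_pow, coeff_expand_mul]
  have key : (25 : ℤ) ∣ coeff (8 * (5 * n + 1) + 2) (Th * Th) + 6 * coeff (8 * n + 2) (Th * Th) := by
    obtain ⟨s, hs, hs'⟩ := hR (8 * n + 2)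
    obtain ⟨t, ht, ht'⟩ := hR (8 * (5 * n + 1) + 2)
    have hsz : ∀ p : ℤ × ℤ, p ∈ s ↔ p.1 ^ 2 + p.2 ^ 2 = 8 * n + 2 := by
      intro p
      rw [hs]
      zify
      simp only [sq_abs]
    have htz : ∀ p : ℤ × ℤ, p ∈ t ↔ p.1 ^ 2 + p.2 ^ 2 = 8 * (5 * n + 1) + 2 := by
      intro p
      rw [ht]
      zify
      simp only [sq_abs]
    rw [hs', ht']
    set F : ℤ × ℤ → ℤ := fun p => wt p.1 * wt p.2 with hF
    have hA : ∑ p ∈ t with (5 : ℤ) ∣ 2 * p.1 + p.2, F p = ∑ p ∈ s, F (2 * p.1 - p.2, p.1 + 2 * p.2) := by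
      symm
      refine Finset.sum_bij' (fun p _ => (2 * p.1 - p.2, p.1 + 2 * p.2)) (fun p _ => ((2 * p.1 + p.2) / 5, (2 * p.2 - p.1) / 5)) ?_ ?_ ?_ ?_ ?_
      · intro p hp
        rw [hsz] at hp
        rw [Finset.mem_filter, htz]
        refine ⟨by simp only; nlinarith, ⟨p.1, by ring⟩⟩
      · intro p hp
        rw [Finset.mem_filter, htz] at hp
        obtain ⟨hp, k, hk⟩ := hp
        rw [hsz]
        have h3 : (2 * p.1 + p.2) / 5 = k := by omega
        have h4 : (2 * p.2 - p.1) / 5 = 2 * k - p.1 := by omega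
        simp only [h3, h4]
        have h5 : p.2 = 5 * k - 2 * p.1 := by linarith
        rw [h5] at hp
        nlinarith
      · intro p hp
        ext <;> simp only <;> omega
      · intro p hp
        rw [Finset.mem_filter] at hp
        ext <;> simp only <;> omega
      · intro p hp; rfl
    have hB : ∑ p ∈ t with (5 : ℤ) ∣ 2 * p.1 - p.2, F p = ∑ p ∈ s, F (2 * p.1 + p.2, 2 * p.2 - p.1) := by
      symm
      refine Finset.sum_bij' (fun p _ => (2 * p.1 + p.2, 2 * p.2 - p.1)) (fun p _ => ((2 * p.1 - p.2) / 5, (2 * p.2 + p.1) / 5)) ?_ ?_ ?_ ?_ ?_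
      · intro p hp
        rw [hsz] at hp
        rw [Finset.mem_filter, htz]
        refine ⟨by simp only; nlinarith, ⟨p.1, by ring⟩⟩
      · intro p hp
        rw [Finset.mem_filter, htz] at hp
        obtain ⟨hp, k, hk⟩ := hp
        rw [hsz]
        have h3 : (2 * p.1 - p.2) / 5 = k := by omega
        have h4 : (2 * p.2 + p.1) / 5 = p.1 - 2 * k := by omega
        simp only [h3, h4]
        have h5 : p.2 = 2 * p.1 - 5 * k := by linarith
        rw [h5] at hp
        nlinarith
      · intro p hp
        ext <;> simp only <;> omega
      · intro p hp
        rw [Finset.mem_filter] at hp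
        ext <;> simp only <;> omega
      · intro p hp; rfl
    have h1 : (25 : ℤ) ∣ ∑ p ∈ t, F p - (∑ p ∈ t with (5 : ℤ) ∣ 2 * p.1 + p.2, F p + ∑ p ∈ t with (5 : ℤ) ∣ 2 * p.1 - p.2, F p) := by
      rw [Finset.sum_filter, Finset.sum_filter, ← Finset.sum_add_distrib, ← Finset.sum_sub_distrib]
      apply Finset.dvd_sum
      intro p hp
      rw [htz] at hp
      have h5 : (5 : ℤ) ∣ (2 * p.1 + p.2) * (2 * p.1 - p.2) := ⟨p.1 ^ 2 - (8 * n + 2), by linear_combination -hp⟩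
      by_cases ha : (5 : ℤ) ∣ 2 * p.1 + p.2
      · by_cases hb : (5 : ℤ) ∣ 2 * p.1 - p.2
        · rw [if_pos ha, if_pos hb]
          obtain ⟨a, ha'⟩ : (5 : ℤ) ∣ p.1 := by omega
          obtain ⟨b, hb'⟩ : (5 : ℤ) ∣ p.2 := by omega
          refine ⟨- (ZMod.χ₄ (p.1 : ZMod 4) * ZMod.χ₄ (p.2 : ZMod 4) * a * b), ?_⟩
          have : F p = (ZMod.χ₄ (p.1 : ZMod 4) * ZMod.χ₄ (p.2 : ZMod 4)) * (p.1 * p.2) := by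
            simp only [hF, wt]; ring
          rw [this, ha', hb']
          ring
        · rw [if_pos ha, if_neg hb]; simp
      · have hb : (5 : ℤ) ∣ 2 * p.1 - p.2 := by
          have hp5 : Prime (5 : ℤ) := by norm_num
          exact (hp5.dvd_or_dvd h5).resolve_left ha
        rw [if_neg ha, if_pos hb]; simp
    rw [hA, hB, ← Finset.sum_add_distrib] at h1
    have h2 : ∑ p ∈ s, (F (2 * p.1 - p.2, p.1 + 2 * p.2) + F (2 * p.1 + p.2, 2 * p.2 - p.1)) = -6 * ∑ p ∈ s, F p := by
      rw [Finset.mul_sum]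
      apply Finset.sum_congr rfl
      intro p hp
      rw [hsz] at hp
      have ho : p.1 % 2 = 1 ∧ p.2 % 2 = 1 := by
        have hh := congrArg (· % 8) hp
        simp only [pow_two] at hh
        have hx : p.1 % 8 = 0 ∨ p.1 % 8 = 1 ∨ p.1 % 8 = 2 ∨ p.1 % 8 = 3 ∨ p.1 % 8 = 4 ∨ p.1 % 8 = 5 ∨ p.1 % 8 = 6 ∨ p.1 % 8 = 7 := by omega
        have hy : p.2 % 8 = 0 ∨ p.2 % 8 = 1 ∨ p.2 % 8 = 2 ∨ p.2 % 8 = 3 ∨ p.2 % 8 = 4 ∨ p.2 % 8 = 5 ∨ p.2 % 8 = 6 ∨ p.2 % 8 = 7 := by omega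
        rcases hx with hx | hx | hx | hx | hx | hx | hx | hx <;> rcases hy with hy | hy | hy | hy | hy | hy | hy | hy <;>
          simp [Int.add_emod, Int.mul_emod, hx, hy] at hh <;> omega
      have hz : ∀ x : ℤ, x % 2 = 1 → (x : ZMod 4) = 1 ∨ (x : ZMod 4) = 3 := by
        intro x hx
        have : x % 4 = 1 ∨ x % 4 = 3 := by omega
        rcases this with h | h
        · left; have := (ZMod.intCast_eq_intCast_iff x 1 4).2 h; simpa using this
        · right; have := (ZMod.intCast_eq_intCast_iff x 3 4).2 h; simpa using this
      have c1 : ZMod.χ₄ 1 = 1 := by decide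
      have c3 : ZMod.χ₄ 3 = -1 := by decide
      have d1 : ∀ x y : ZMod 4, (x = 1 ∨ x = 3) → (y = 1 ∨ y = 3) → ZMod.χ₄ (2 * x - y) * ZMod.χ₄ (x + 2 * y) = - (ZMod.χ₄ x * ZMod.χ₄ y) := by decide
      have d2 : ∀ x y : ZMod 4, (x = 1 ∨ x = 3) → (y = 1 ∨ y = 3) → ZMod.χ₄ (2 * x + y) * ZMod.χ₄ (2 * y - x) = - (ZMod.χ₄ x * ZMod.χ₄ y) := by decide
      have e1 := d1 _ _ (hz _ ho.1) (hz _ ho.2)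
      have e2 := d2 _ _ (hz _ ho.1) (hz _ ho.2)
      simp only [hF, wt]
      push_cast
      linear_combination ((2 * p.1 - p.2) * (p.1 + 2 * p.2)) * e1 + ((2 * p.1 + p.2) * (2 * p.2 - p.1)) * e2
    rw [h2] at h1
    have : ∑ p ∈ t, F p - -6 * ∑ p ∈ s, F p = ∑ p ∈ t, F p + 6 * ∑ p ∈ s, F p := by ring
    rwa [this] at h1
  rw [hT, hT] at key
  have : (25 : ℤ) ∣ 4 * (coeff (5 * n + 1) (J ^ 2) + 6 * coeff n (J ^ 2)) := by
    convert key using 1; ring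
  exact IsCoprime.dvd_of_dvd_mul_left (by norm_num : IsCoprime (25 : ℤ) 4) this

end MP
end partc

section partd
open PowerSeries

namespace MP

/-- sections -/
noncomputable def S {R : Type*} [CommRing R] (r : ℕ) (g : R⟦X⟧) : R⟦X⟧ := PowerSeries.mk fun n => coeff (5 * n + r) g

/-- twisted embedding -/
noncomputable def tw (z : ℂ) (i : ℕ) : ℤ⟦X⟧ →+* ℂ⟦X⟧ := (rescale (z ^ i)).comp (PowerSeries.map (Int.castRingHom ℂ))

lemma tw_X (z : ℂ) (i : ℕ) : tw z i X = C (z ^ i) * X := by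
  simp [tw, rescale_X]

lemma tw_phi (z : ℂ) (hz : z ^ 5 = 1) (i : ℕ) (h : ℤ⟦X⟧) : tw z i (phi h) = PowerSeries.map (Int.castRingHom ℂ) (phi h) := by
  ext n
  simp only [tw, RingHom.comp_apply, coeff_rescale, coeff_map]
  by_cases hd : 5 ∣ n
  · obtain ⟨m, rfl⟩ := hd
    rw [← pow_mul, mul_comm i, mul_assoc, pow_mul, hz, one_pow, one_mul]
  · rw [coeff_expand_of_not_dvd _ _ _ hd]; simp

lemma root_prod (z : ℂ) (hz : 1 + z + z ^ 2 + z ^ 3 + z ^ 4 = 0) (x : ℂ⟦X⟧) :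
    (1 - x) * (1 - C z * x) * (1 - C z ^ 2 * x) * (1 - C z ^ 3 * x) * (1 - C z ^ 4 * x) = 1 - x ^ 5 := by
  have h : (1 + C z + C z ^ 2 + C z ^ 3 + C z ^ 4 : ℂ⟦X⟧) = 0 := by
    have := congrArg (C (R := ℂ)) hz
    simpa using this
  have h5 : (C z : ℂ⟦X⟧) ^ 5 = 1 := by linear_combination (C z - 1) * h
  generalize (C z : ℂ⟦X⟧) = w at *
  have h6 : w ^ 4 = - (1 + w + w ^ 2 + w ^ 3) := by linear_combination h
  linear_combination (exp := 1) (-x + (w + w^3) * x^2 - (w^3 + w^5) * x ^ 3 + w^6 * x ^ 4) * h + (- x ^ 5 * (w ^ 5 + 1)) * h5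

lemma root_pow (z : ℂ) (hz : 1 + z + z ^ 2 + z ^ 3 + z ^ 4 = 0) (j : ℕ) (hj : j % 5 ≠ 0) :
    1 + z ^ j + (z ^ j) ^ 2 + (z ^ j) ^ 3 + (z ^ j) ^ 4 = 0 := by
  have h5 : z ^ 5 = 1 := by linear_combination (z - 1) * hz
  have h : z ^ j = z ^ (j % 5) := by
    conv_lhs => rw [← Nat.div_add_mod j 5, pow_add, pow_mul, h5, one_pow, one_mul]
  rw [h]
  have : j % 5 < 5 := Nat.mod_lt _ (by norm_num)
  interval_cases j % 5
  · exact absurd rfl hj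
  · linear_combination hz
  · linear_combination hz + (z + z ^ 3) * h5
  · linear_combination hz + (z + z^4 + z^2 * (z^5 + 1)) * h5
  · linear_combination hz + (z ^ 3 + z^2 * (z^5+1) + z * (z^10 + z^5 + 1)) * h5

/-- norm -/
noncomputable def nm (z : ℂ) (f : ℤ⟦X⟧) : ℂ⟦X⟧ := tw z 0 f * tw z 1 f * tw z 2 f * tw z 3 f * tw z 4 f

lemma nm_mul (z : ℂ) (f g : ℤ⟦X⟧) : nm z (f * g) = nm z f * nm z g := by
  simp only [nm, map_mul]; ring

lemma nm_factor (z : ℂ) (hz : 1 + z + z ^ 2 + z ^ 3 + z ^ 4 = 0) (j : ℕ) (hj : j % 5 ≠ 0) :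
    nm z (1 - X ^ j) = 1 - X ^ (5 * j) := by
  have h := root_prod (z ^ j) (root_pow z hz j hj) (X ^ j)
  rw [← pow_mul, mul_comm j 5] at h
  rw [← h]
  have ht : ∀ i, tw z i (1 - X ^ j) = 1 - C (z ^ j) ^ i * X ^ j := by
    intro i
    rw [map_sub, map_one, map_pow, tw_X, mul_pow, ← map_pow, ← map_pow, ← pow_mul, ← pow_mul, mul_comm i j]
  simp only [nm, ht]
  ring

lemma nm_factor5 (z : ℂ) (hz : 1 + z + z ^ 2 + z ^ 3 + z ^ 4 = 0) (j : ℕ) :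
    nm z (1 - X ^ (5 * j)) = (1 - X ^ (5 * j)) ^ 5 := by
  have h5 : z ^ 5 = 1 := by linear_combination (z - 1) * hz
  have ht : ∀ i, tw z i (1 - X ^ (5 * j)) = 1 - X ^ (5 * j) := by
    intro i
    rw [map_sub, map_one, map_pow, tw_X, mul_pow, ← map_pow, ← pow_mul, mul_comm i, mul_assoc, pow_mul, h5, one_pow]
    simp
  simp only [nm, ht]
  ring

/-- complex embedding -/
noncomputable abbrev K : ℤ⟦X⟧ →+* ℂ⟦X⟧ := PowerSeries.map (Int.castRingHom ℂ)

lemma K_factor (j : ℕ) : K (1 - X ^ j) = 1 - X ^ j := by simp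

lemma phi_factor (j : ℕ) : phi (1 - X ^ j : ℤ⟦X⟧) = 1 - X ^ (5 * j) := by
  rw [map_sub, map_one, map_pow, expand_X, ← pow_mul]

lemma nm_P (z : ℂ) (hz : 1 + z + z ^ 2 + z ^ 3 + z ^ 4 = 0) (M : ℕ) :
    nm z (P (5 * M)) * K (phi (phi (P M))) = K (phi (P (5 * M))) * K (phi (P M)) ^ 5 := by
  induction M with
  | zero => simp [P, nm]
  | succ M ih =>
    have e : 5 * (M + 1) = 5 * M + 1 + 1 + 1 + 1 + 1 := by ring
    have e5 : 5 * M + 1 + 1 + 1 + 1 + 1 = 5 * (M + 1) := by ring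
    rw [e, P_succ, P_succ, P_succ, P_succ, P_succ, P_succ, e5]
    simp only [nm_mul, map_mul, phi_factor, K_factor, nm_factor5 z hz]
    rw [nm_factor z hz _ (by omega), nm_factor z hz _ (by omega), nm_factor z hz _ (by omega), nm_factor z hz _ (by omega)]
    linear_combination (1 - X ^ (5 * (5 * M + 1))) * (1 - X ^ (5 * (5 * M + 1 + 1))) * (1 - X ^ (5 * (5 * M + 1 + 1 + 1))) * (1 - X ^ (5 * (5 * M + 1 + 1 + 1 + 1))) * (1 - X ^ (5 * (5 * (M + 1)))) * (1 - X ^ (5 * (M + 1))) ^ 5 * ih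

lemma nm_E (z : ℂ) (hz : 1 + z + z ^ 2 + z ^ 3 + z ^ 4 = 0) :
    nm z E * K (phi (phi E)) = K (phi E) ^ 6 := by
  have key : ∀ M : ℕ, (X : ℂ⟦X⟧) ^ (M + 1) ∣ nm z E * K (phi (phi E)) - K (phi E) ^ 6 := by
    intro M
    set π := Ideal.Quotient.mk (Ideal.span {(X : ℂ⟦X⟧) ^ (M + 1)}) with hπ
    have hpi : ∀ a b : ℂ⟦X⟧, π a = π b ↔ X ^ (M + 1) ∣ a - b := by
      intro a b
      rw [hπ, Ideal.Quotient.mk_eq_mk_iff_sub_mem, Ideal.mem_span_singleton]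
    have hE : ∀ N, M ≤ N → X ^ (M + 1) ∣ E - P N := fun N h =>
      (pow_dvd_pow X (by omega)).trans (E_trunc N)
    have htw : ∀ i, π (tw z i E) = π (tw z i (P (5 * M))) := by
      intro i
      rw [hpi, ← map_sub]
      have := map_dvd (tw z i) (hE (5 * M) (by omega))
      rw [map_pow, tw_X, mul_pow] at this
      exact (Dvd.intro_left _ rfl).trans this
    have hphi : ∀ N, M ≤ N → π (K (phi E)) = π (K (phi (P N))) := by
      intro N hN
      rw [hpi, ← map_sub, ← map_sub]
      have := map_dvd K (map_dvd phi (hE N hN))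
      rw [map_pow, expand_X, map_pow, map_pow, map_X, ← pow_mul] at this
      exact (pow_dvd_pow X (by omega)).trans this
    have hphi2 : π (K (phi (phi E))) = π (K (phi (phi (P M)))) := by
      rw [hpi, ← map_sub, ← map_sub, ← map_sub]
      have := map_dvd K (map_dvd phi (map_dvd phi (hE M le_rfl)))
      simp only [map_pow, expand_X, map_X, ← pow_mul] at this
      exact (pow_dvd_pow X (by omega)).trans this
    rw [← hpi]
    have h := congrArg π (nm_P z hz M)
    simp only [nm, map_mul, map_pow, htw, hphi2] at h ⊢
    rw [h, ← hphi _ le_rfl, ← hphi (5 * M) (by omega)]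
    ring
  rw [← sub_eq_zero]
  ext n
  exact (X_pow_dvd_iff.1 (key n)) n (by omega)

lemma five_factor {R : Type*} [CommRing R] (z A B C : R) (hz : 1 + z + z ^ 2 + z ^ 3 + z ^ 4 = 0) :
    (A + B + C) * (A + z * B + z ^ 3 * C) * (A + z ^ 2 * B + z ^ 6 * C) * (A + z ^ 3 * B + z ^ 9 * C) * (A + z ^ 4 * B + z ^ 12 * C)
    = A ^ 5 + B ^ 5 + C ^ 5 + 5 * A ^ 2 * B ^ 2 * C - 5 * A * B * C ^ 3 := by
  have h5 : z ^ 5 = 1 := by linear_combination (z - 1) * hz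
  have h6 : z ^ 6 = z := by linear_combination z * h5
  have h9 : z ^ 9 = z ^ 4 := by linear_combination z ^ 4 * h5
  have h12 : z ^ 12 = z ^ 2 := by linear_combination (z ^ 2 + z ^ 7) * h5
  rw [h6, h9, h12]
  linear_combination (A^4*B+A^4*C+(z+z^3)*A^3*B^2+(2*z+z^2+z^4)*A^3*B*C+(z+z^3)*A^3*C^2+(z^3+z^5)*A^2*B^3+(-5+5*z+z^2+z^3+z^4+2*z^6)*A^2*B^2*C+(z^2+z^3+2*z^4+2*z^5-z^6+z^7)*A^2*B*C^2+(z^3+z^5)*A^2*C^3+z^6*A*B^4+(2*z^5+z^6+z^8)*A*B^3*C+(z^4+z^5+2*z^6+2*z^7-z^8+z^9)*A*B^2*C^2+(5-5*z+z^4+4*z^5-2*z^6+z^7+z^8)*A*B*C^3+z^6*A*C^4+(-1+z-z^5+z^6)*B^5+z^8*B^4*C+(z^7+z^9)*B^3*C^2+(z^7+z^9)*B^2*C^3+z^8*B*C^4+(-1+z-z^5+z^6)*C^5) * hz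

lemma coeff_phi_shift {R : Type*} [CommRing R] (h : R⟦X⟧) (r i n : ℕ) (hr : r < 5) (hi : i < 5) :
    coeff (5 * n + r) (phi h * X ^ i) = if r = i then coeff n h else 0 := by
  rw [coeff_mul_X_pow']
  by_cases hir : i ≤ 5 * n + r
  · rw [if_pos hir]
    split_ifs with h1
    · subst h1
      rw [Nat.add_sub_cancel, coeff_expand_mul]
    · rw [coeff_expand_of_not_dvd]
      omega
  · rw [if_neg hir, if_neg (by omega)]

lemma ext5 {R : Type*} [CommRing R] {f g : R⟦X⟧} (h : ∀ r < 5, ∀ n, coeff (5 * n + r) f = coeff (5 * n + r) g) : f = g := by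
  ext n
  have := h (n % 5) (Nat.mod_lt _ (by norm_num)) (n / 5)
  rwa [Nat.div_add_mod] at this

lemma J_split : J = phi (S 0 J) + phi (S 1 J) * X ^ 1 + 5 * (phi (phi J) * X ^ 3) := by
  have e : (5 : ℤ⟦X⟧) = C 5 := (map_ofNat _ _).symm
  rw [e]
  apply ext5
  intro r hr n
  have e0 : phi (S 0 J) = phi (S 0 J) * X ^ 0 := by simp
  rw [e0, map_add, map_add, coeff_C_mul, coeff_phi_shift _ _ _ _ hr (by norm_num), coeff_phi_shift _ _ _ _ hr (by norm_num), coeff_phi_shift _ _ _ _ hr (by norm_num)]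
  interval_cases r
  · simp [S]
  · simp [S]
  · simp [J_2]
  · simp [J_3]
  · simp [J_4]

lemma norm_J : ((phi (S 0 J)) ^ 5 + (phi (S 1 J) * X) ^ 5 + (5 * (phi (phi J) * X ^ 3)) ^ 5
    + 5 * (phi (S 0 J)) ^ 2 * (phi (S 1 J) * X) ^ 2 * (5 * (phi (phi J) * X ^ 3))
    - 5 * (phi (S 0 J)) * (phi (S 1 J) * X) * (5 * (phi (phi J) * X ^ 3)) ^ 3) * phi (phi J) = phi J ^ 6 := by
  obtain ⟨z, hz⟩ : ∃ z : ℂ, 1 + z + z ^ 2 + z ^ 3 + z ^ 4 = 0 := by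
    have hp := Complex.isPrimitiveRoot_exp 5 (by norm_num)
    have := hp.geom_sum_eq_zero (by norm_num)
    simp only [Finset.sum_range_succ, Finset.sum_range_zero, pow_zero, pow_one, zero_add] at this
    exact ⟨_, this⟩
  have h5 : z ^ 5 = 1 := by linear_combination (z - 1) * hz
  have hE := nm_E z hz
  have hJ : nm z J * K (phi (phi J)) = K (phi J) ^ 6 := by
    have : nm z J = nm z E ^ 3 := by simp only [J, nm, map_pow]; ring
    rw [this, J, map_pow, map_pow, map_pow, map_pow, ← mul_pow, hE]; ring
  have hinj : Function.Injective K := PowerSeries.map_injective _ (RingHom.injective_int _)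
  apply hinj
  rw [map_mul, map_pow, ← hJ]
  congr 1
  have ht : ∀ i, tw z i J = K (phi (S 0 J)) + C z ^ i * K (phi (S 1 J) * X) + C z ^ (3 * i) * K (5 * (phi (phi J) * X ^ 3)) := by
    intro i
    conv_lhs => rw [J_split]
    simp only [map_add, map_mul, map_pow, tw_phi z h5, tw_X, map_ofNat, map_X]
    ring
  have hz' : (1 + C z + C z ^ 2 + C z ^ 3 + C z ^ 4 : ℂ⟦X⟧) = 0 := by
    have := congrArg (C (R := ℂ)) hz
    simpa using this
  have h := five_factor (C z) (K (phi (S 0 J))) (K (phi (S 1 J) * X)) (K (5 * (phi (phi J) * X ^ 3))) hz'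
  simp only [nm, ht]
  norm_num
  norm_num at h
  have k5 : K 5 = 5 := map_ofNat _ _
  rw [h, k5]

end MP
end partd

section parte
open PowerSeries

namespace MP

section sec
variable {R : Type*} [CommRing R]

lemma coeff_S (r n : ℕ) (g : R⟦X⟧) : coeff n (S r g) = coeff (5 * n + r) g := by simp [S]

lemma S_class (h0 h1 h2 h3 h4 : R⟦X⟧) (r : ℕ) (hr : r < 5) :
    S r (phi h0 * X ^ 0 + phi h1 * X ^ 1 + phi h2 * X ^ 2 + phi h3 * X ^ 3 + phi h4 * X ^ 4) =
      (if r = 0 then h0 else 0) + (if r = 1 then h1 else 0) + (if r = 2 then h2 else 0) + (if r = 3 then h3 else 0) + (if r = 4 then h4 else 0) := by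
  ext n
  rw [coeff_S]
  simp only [map_add]
  rw [coeff_phi_shift _ _ _ _ hr (by norm_num), coeff_phi_shift _ _ _ _ hr (by norm_num), coeff_phi_shift _ _ _ _ hr (by norm_num), coeff_phi_shift _ _ _ _ hr (by norm_num), coeff_phi_shift _ _ _ _ hr (by norm_num)]
  interval_cases r <;> simp

lemma split5 (g : R⟦X⟧) : g = phi (S 0 g) * X ^ 0 + phi (S 1 g) * X ^ 1 + phi (S 2 g) * X ^ 2 + phi (S 3 g) * X ^ 3 + phi (S 4 g) * X ^ 4 := by
  apply ext5
  intro r hr n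
  rw [← coeff_S r n, ← coeff_S r n, S_class _ _ _ _ _ _ hr]
  interval_cases r <;> simp

lemma S_phi_mul (h g : R⟦X⟧) (r : ℕ) (hr : r < 5) : S r (phi h * g) = h * S r g := by
  have : phi h * g = phi (h * S 0 g) * X ^ 0 + phi (h * S 1 g) * X ^ 1 + phi (h * S 2 g) * X ^ 2 + phi (h * S 3 g) * X ^ 3 + phi (h * S 4 g) * X ^ 4 := by
    conv_lhs => rw [split5 g]
    simp only [map_mul]; ring
  rw [this, S_class _ _ _ _ _ _ hr]
  interval_cases r <;> simp

lemma phi_inj {f g : R⟦X⟧} (h : phi f = phi g) : f = g := by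
  ext n
  have := congrArg (coeff (5 * n)) h
  rwa [coeff_expand_mul, coeff_expand_mul] at this

end sec

/-- reduction mod 25 -/
noncomputable abbrev r25 : ℤ⟦X⟧ →+* (ZMod 25)⟦X⟧ := PowerSeries.map (Int.castRingHom (ZMod 25))

lemma h25 : (25 : (ZMod 25)⟦X⟧) = 0 := by
  have : (25 : (ZMod 25)⟦X⟧) = C 25 := (map_ofNat _ _).symm
  rw [this]
  have : (25 : ZMod 25) = 0 := by decide
  rw [this, map_zero]

/-- J mod 25 -/
noncomputable def ee : (ZMod 25)⟦X⟧ := r25 J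
/-- inverse -/
noncomputable def ff : (ZMod 25)⟦X⟧ := r25 (pf ^ 3)
/-- first section -/
noncomputable def aa : (ZMod 25)⟦X⟧ := r25 (S 0 J)
/-- second section -/
noncomputable def bb : (ZMod 25)⟦X⟧ := r25 (S 1 J)
/-- norm -/
noncomputable def nn : (ZMod 25)⟦X⟧ := aa ^ 5 + X * bb ^ 5

lemma ee_ff : ee * ff = 1 := by
  rw [ee, ff, ← map_mul, J, ← mul_pow, mul_comm, pf_mul_E, one_pow, map_one]

lemma ee_split : ee = phi aa + phi bb * X + 5 * (phi (phi ee) * X ^ 3) := by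
  have := congrArg r25 J_split
  simp only [map_add, map_mul, map_pow, map_expand, map_X, map_ofNat, pow_one] at this
  exact this

lemma nn_ee : nn * phi ee = ee ^ 6 := by
  apply phi_inj
  have := congrArg r25 norm_J
  simp only [map_add, map_sub, map_mul, map_pow, map_expand, map_X, map_ofNat] at this
  simp only [nn, map_mul, map_add, map_pow, expand_X]
  change ((phi aa) ^ 5 + (phi bb * X) ^ 5 + (5 * (phi (phi ee) * X ^ 3)) ^ 5 + 5 * (phi aa) ^ 2 * (phi bb * X) ^ 2 * (5 * (phi (phi ee) * X ^ 3)) - 5 * phi aa * (phi bb * X) * (5 * (phi (phi ee) * X ^ 3)) ^ 3) * phi (phi ee) = phi ee ^ 6 at this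
  rw [← this]
  generalize phi (phi ee) = d
  generalize phi aa = A
  generalize phi bb = B
  linear_combination (-(125 * (d * X ^ 3) ^ 5 + A ^ 2 * (B * X) ^ 2 * d * X ^ 3 - 25 * A * (B * X) * (d * X ^ 3) ^ 3) * d) * h25

lemma aa_bb : aa * bb = - 3 * ee ^ 2 := by
  have h1 : S 1 (ee ^ 2) = 2 * (aa * bb) := by
    have : ee ^ 2 = phi (aa ^ 2) * X ^ 0 + phi (2 * (aa * bb)) * X ^ 1 + phi (bb ^ 2) * X ^ 2 + phi (10 * (aa * phi ee)) * X ^ 3 + phi (10 * (bb * phi ee)) * X ^ 4 := by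
      have he := ee_split
      simp only [map_mul, map_pow, map_ofNat]
      generalize phi (phi ee) = d at he ⊢
      generalize phi aa = A at he ⊢
      generalize phi bb = B at he ⊢
      rw [he]
      linear_combination (d * X ^ 3) ^ 2 * h25
    rw [this, S_class _ _ _ _ _ _ (by norm_num)]
    simp
  have h2 : S 1 (ee ^ 2) = - 6 * ee ^ 2 := by
    ext n
    have e : (-6 : (ZMod 25)⟦X⟧) = C (-6) := by
      rw [map_neg, map_ofNat]
    rw [coeff_S, e, coeff_C_mul, ee, ← map_pow, coeff_map, coeff_map]
    have := (ZMod.intCast_zmod_eq_zero_iff_dvd _ 25).2 (sq_sum_J n)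
    push_cast at this
    simp only [eq_intCast]
    linear_combination this
  rw [h1] at h2
  linear_combination 13 * h2 + (- aa * bb - 3 * ee ^ 2) * h25

lemma ff_sec : nn * S 2 ff = 9 * ee ^ 4 := by
  have h1 : phi (nn ^ 2) * ff =
      phi (nn * aa ^ 4 - 5 * phi ee * (3 * X * aa ^ 6 * bb ^ 2 - 2 * X ^ 2 * aa * bb ^ 7)) * X ^ 0
      + phi (- nn * aa ^ 3 * bb - 5 * phi ee * (-4 * X * aa ^ 5 * bb ^ 3 + X ^ 2 * bb ^ 8)) * X ^ 1
      + phi (nn * aa ^ 2 * bb ^ 2) * X ^ 2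
      + phi (- nn * aa * bb ^ 3 - 5 * phi ee * (aa ^ 8 - 4 * X * aa ^ 3 * bb ^ 5)) * X ^ 3
      + phi (nn * bb ^ 4 - 5 * phi ee * (-2 * aa ^ 7 * bb + 3 * X * aa ^ 2 * bb ^ 6)) * X ^ 4 := by
    have h2 : ee * (phi nn * (phi aa ^ 4 - phi aa ^ 3 * (phi bb * X) + phi aa ^ 2 * (phi bb * X) ^ 2 - phi aa * (phi bb * X) ^ 3 + (phi bb * X) ^ 4) - 5 * (phi (phi ee) * X ^ 3) * (phi aa ^ 4 - phi aa ^ 3 * (phi bb * X) + phi aa ^ 2 * (phi bb * X) ^ 2 - phi aa * (phi bb * X) ^ 3 + (phi bb * X) ^ 4) ^ 2) = phi nn ^ 2 := by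
      have hn : phi nn = phi aa ^ 5 + X ^ 5 * phi bb ^ 5 := by simp only [nn, map_add, map_mul, map_pow, expand_X]
      have he := ee_split
      simp only [hn]
      generalize phi (phi ee) = d at he ⊢
      generalize phi aa = A at he ⊢
      generalize phi bb = B at he ⊢
      rw [he]
      linear_combination (- (d * X ^ 3) ^ 2 * (A ^ 4 - A ^ 3 * (B * X) + A ^ 2 * (B * X) ^ 2 - A * (B * X) ^ 3 + (B * X) ^ 4) ^ 2) * h25
    rw [map_pow, ← h2, mul_assoc, mul_comm, mul_assoc, mul_comm ff ee, ee_ff, mul_one]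
    simp only [map_add, map_sub, map_mul, map_pow, map_neg, map_ofNat, expand_X]
    generalize phi (phi ee) = d
    generalize phi aa = A
    generalize phi bb = B
    generalize phi nn = N
    linear_combination (- d * X ^ 7 * A ^ 4 * B ^ 4) * h25
  have h3 := congrArg (S 2) h1
  rw [S_class _ _ _ _ _ _ (by norm_num), S_phi_mul _ _ _ (by norm_num)] at h3
  simp only [OfNat.ofNat_ne_zero, OfNat.ofNat_ne_one, if_false, if_true, zero_add, add_zero, Nat.reduceEqDiff] at h3
  have hu : nn * (phi ee * ff ^ 6) = 1 := by
    rw [← mul_assoc, nn_ee, ← mul_pow, ee_ff, one_pow]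
  have h4 : nn * S 2 ff = aa ^ 2 * bb ^ 2 := by
    linear_combination (phi ee * ff ^ 6) * h3 - (nn * S 2 ff - aa ^ 2 * bb ^ 2) * hu
  rw [h4]
  linear_combination (aa * bb - 3 * ee ^ 2) * aa_bb

lemma S2ff : S 2 ff = 9 * phi ee * ff ^ 2 := by
  have hu : nn * (phi ee * ff ^ 6) = 1 := by
    rw [← mul_assoc, nn_ee, ← mul_pow, ee_ff, one_pow]
  have h4 : ee ^ 4 * ff ^ 4 = 1 := by rw [← mul_pow, ee_ff, one_pow]
  linear_combination (phi ee * ff ^ 6) * ff_sec - (S 2 ff) * hu + 9 * phi ee * ff ^ 2 * h4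

lemma ff2_sec : nn ^ 2 * S 4 (ff ^ 2) = 15 * ee ^ 8 := by
  have h1 : phi (nn ^ 3) * ff ^ 2 =
      phi (nn * (aa ^ 8 - 4 * X * aa ^ 3 * bb ^ 5) - 10 * phi ee * (6 * X * aa ^ 10 * bb ^ 2 - 18 * X ^ 2 * aa ^ 5 * bb ^ 7 + X ^ 3 * bb ^ 12)) * X ^ 0
      + phi (nn * (- 2 * aa ^ 7 * bb + 3 * X * aa ^ 2 * bb ^ 6) - 10 * phi ee * (-10 * X * aa ^ 9 * bb ^ 3 + 15 * X ^ 2 * aa ^ 4 * bb ^ 8)) * X ^ 1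
      + phi (nn * (3 * aa ^ 6 * bb ^ 2 - 2 * X * aa * bb ^ 7) - 10 * phi ee * (15 * X * aa ^ 8 * bb ^ 4 - 10 * X ^ 2 * aa ^ 3 * bb ^ 9)) * X ^ 2
      + phi (nn * (-4 * aa ^ 5 * bb ^ 3 + X * bb ^ 8) - 10 * phi ee * (aa ^ 12 - 18 * X * aa ^ 7 * bb ^ 5 + 6 * X ^ 2 * aa ^ 2 * bb ^ 10)) * X ^ 3
      + phi (nn * (5 * aa ^ 4 * bb ^ 4) - 10 * phi ee * (-3 * aa ^ 11 * bb + 19 * X * aa ^ 6 * bb ^ 6 - 3 * X ^ 2 * aa * bb ^ 11)) * X ^ 4 := by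
    have h2 : ee ^ 2 * (phi nn * (phi aa ^ 4 - phi aa ^ 3 * (phi bb * X) + phi aa ^ 2 * (phi bb * X) ^ 2 - phi aa * (phi bb * X) ^ 3 + (phi bb * X) ^ 4) ^ 2 - 10 * (phi (phi ee) * X ^ 3) * (phi aa ^ 4 - phi aa ^ 3 * (phi bb * X) + phi aa ^ 2 * (phi bb * X) ^ 2 - phi aa * (phi bb * X) ^ 3 + (phi bb * X) ^ 4) ^ 3) = phi nn ^ 3 := by
      have hn : phi nn = phi aa ^ 5 + X ^ 5 * phi bb ^ 5 := by simp only [nn, map_add, map_mul, map_pow, expand_X]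
      have he := ee_split
      simp only [hn]
      generalize phi (phi ee) = d at he ⊢
      generalize phi aa = A at he ⊢
      generalize phi bb = B at he ⊢
      rw [he]
      have hs : (A + B * X) * (A ^ 4 - A ^ 3 * (B * X) + A ^ 2 * (B * X) ^ 2 - A * (B * X) ^ 3 + (B * X) ^ 4) = A ^ 5 + X ^ 5 * B ^ 5 := by ring
      rw [← hs]
      generalize A ^ 4 - A ^ 3 * (B * X) + A ^ 2 * (B * X) ^ 2 - A * (B * X) ^ 3 + (B * X) ^ 4 = c
      generalize A + B * X = s
      generalize d * X ^ 3 = D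
      linear_combination (-3 * s * D ^ 2 * c ^ 3 - 10 * D ^ 3 * c ^ 3) * h25
    have h4 : ee ^ 2 * ff ^ 2 = 1 := by rw [← mul_pow, ee_ff, one_pow]
    rw [map_pow, ← h2]
    generalize hT : (phi nn * (phi aa ^ 4 - phi aa ^ 3 * (phi bb * X) + phi aa ^ 2 * (phi bb * X) ^ 2 - phi aa * (phi bb * X) ^ 3 + (phi bb * X) ^ 4) ^ 2 - 10 * (phi (phi ee) * X ^ 3) * (phi aa ^ 4 - phi aa ^ 3 * (phi bb * X) + phi aa ^ 2 * (phi bb * X) ^ 2 - phi aa * (phi bb * X) ^ 3 + (phi bb * X) ^ 4) ^ 3) = T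
    have h5 : ee ^ 2 * T * ff ^ 2 = T := by linear_combination T * h4
    rw [h5, ← hT]
    simp only [map_add, map_sub, map_mul, map_pow, map_neg, map_ofNat, expand_X]
    generalize phi (phi ee) = d
    generalize phi aa = A
    generalize phi bb = B
    generalize phi nn = N
    ring
  have h3 := congrArg (S 4) h1
  rw [S_class _ _ _ _ _ _ (by norm_num), S_phi_mul _ _ _ (by norm_num)] at h3
  simp only [OfNat.ofNat_ne_zero, OfNat.ofNat_ne_one, if_false, if_true, zero_add, add_zero, Nat.reduceEqDiff] at h3
  have hu : nn * (phi ee * ff ^ 6) = 1 := by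
    rw [← mul_assoc, nn_ee, ← mul_pow, ee_ff, one_pow]
  have h6 : nn ^ 3 * S 4 (ff ^ 2) = nn * (5 * (aa * bb) ^ 4 - 20 * (aa * bb) * (nn * phi ee)) := by
    rw [h3]
    have : nn ^ 2 = aa ^ 10 + 2 * X * aa ^ 5 * bb ^ 5 + X ^ 2 * bb ^ 10 := by rw [nn]; ring
    linear_combination (20 * aa * bb * phi ee) * this + (2 * phi ee * (aa ^ 11 * bb) - 6 * phi ee * X * aa ^ 6 * bb ^ 6 + 2 * phi ee * X ^ 2 * aa * bb ^ 11) * h25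
  rw [nn_ee, aa_bb] at h6
  linear_combination (phi ee * ff ^ 6) * h6 - (nn ^ 2 * S 4 (ff ^ 2) - 465 * ee ^ 8) * hu + 18 * ee ^ 8 * h25

lemma S4ff : S 4 (ff ^ 2) = 15 * phi ee ^ 2 * ff ^ 4 := by
  have hu : nn ^ 2 * (phi ee * ff ^ 6) ^ 2 = 1 := by
    rw [← mul_pow, ← mul_assoc, nn_ee, ← mul_pow, ee_ff, one_pow]; simp
  have h4 : ee ^ 8 * ff ^ 8 = 1 := by rw [← mul_pow, ee_ff, one_pow]
  linear_combination (phi ee * ff ^ 6) ^ 2 * ff2_sec - (S 4 (ff ^ 2)) * hu + 15 * phi ee ^ 2 * ff ^ 4 * h4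

lemma frob5 (g : (ZMod 5)⟦X⟧) : phi g = g ^ 5 := by
  have : Fact (Nat.Prime 5) := ⟨by norm_num⟩
  have h := MvPowerSeries.map_frobenius_expand (σ := Unit) (R := ZMod 5) 5 (by norm_num) (f := g)
  rw [ZMod.frobenius_zmod, MvPowerSeries.map_id] at h
  exact h

lemma phi_J_mod5 : ∃ g : ℤ⟦X⟧, phi J - J ^ 5 = 5 * g := by
  have h : ∀ n, (5 : ℤ) ∣ coeff n (phi J - J ^ 5) := by
    intro n
    have h1 := frob5 (PowerSeries.map (Int.castRingHom (ZMod 5)) J)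
    rw [← map_pow, ← map_expand, ← sub_eq_zero, ← map_sub] at h1
    have h2 := congrArg (coeff n) h1
    rw [coeff_map, map_zero, eq_intCast] at h2
    exact (ZMod.intCast_zmod_eq_zero_iff_dvd _ 5).1 h2
  choose g hg using h
  refine ⟨PowerSeries.mk g, ?_⟩
  ext n
  have e : (5 : ℤ⟦X⟧) = C 5 := (map_ofNat _ _).symm
  rw [hg, e, coeff_C_mul, coeff_mk]

lemma main25 : S 4 (S 2 ff) = 10 * (ee ^ 2 * phi ee) := by
  have h1 : S 4 (S 2 ff) = 9 * ee * S 4 (ff ^ 2) := by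
    have : S 2 ff = phi (9 * ee) * ff ^ 2 := by rw [S2ff, map_mul, map_ofNat]
    rw [this, S_phi_mul _ _ _ (by norm_num)]
  rw [h1, S4ff]
  obtain ⟨g, hg⟩ := phi_J_mod5
  have h2 := congrArg r25 hg
  simp only [map_sub, map_mul, map_pow, map_expand, map_ofNat] at h2
  change phi ee - ee ^ 5 = 5 * r25 g at h2
  have h3 : ee ^ 3 * ff ^ 3 = 1 := by rw [← mul_pow, ee_ff, one_pow]
  linear_combination (135 * phi ee ^ 2 * ff ^ 3) * ee_ff + (5 * phi ee ^ 2 * ff ^ 3) * h25 + 10 * phi ee * ff ^ 3 * h2 + (2 * phi ee * ff ^ 3 * r25 g) * h25 + 10 * phi ee * ee ^ 2 * h3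

lemma main25' (k : ℕ) : (25 : ℤ) ∣ coeff (25 * k + 22) (pf ^ 3) - 10 * coeff k (J ^ 2 * phi J) := by
  have h := congrArg (coeff k) main25
  have e : (10 : (ZMod 25)⟦X⟧) = C 10 := (map_ofNat _ _).symm
  have e2 : ee ^ 2 * phi ee = r25 (J ^ 2 * phi J) := by
    simp only [map_mul, map_pow, map_expand]; rfl
  rw [coeff_S, coeff_S, e, coeff_C_mul, e2, coeff_map, ff, coeff_map] at h
  have e3 : 5 * (5 * k + 4) + 2 = 25 * k + 22 := by ring
  rw [e3] at h
  apply (ZMod.intCast_zmod_eq_zero_iff_dvd _ 25).1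
  simp only [eq_intCast] at h
  push_cast
  rw [h, sub_self]

end MP
end parte

section partf
open PowerSeries

namespace MP

/-- x coordinates -/
def ux : Fin 14 → ℤ := ![0,0,1,1,1,1,1,1,1,1,1,1,1,1]
/-- y coordinates -/
def uy : Fin 14 → ℤ := ![2,2,2,2,-2,-2,5,5,-5,-5,10,10,-10,-10]
/-- z coordinates -/
def uz : Fin 14 → ℤ := ![3,-3,2,-2,2,-2,10,-10,10,-10,5,-5,5,-5]
/-- x coefficients -/
def tx : Fin 14 → ℤ := ![0,0,10,10,10,10,1,1,1,1,1,1,1,1]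
/-- y coefficients -/
def ty : Fin 14 → ℤ := ![4,4,4,4,-4,-4,1,1,-1,-1,2,2,-2,-2]
/-- z coefficients -/
def tz : Fin 14 → ℤ := ![6,-6,4,-4,4,-4,2,-2,2,-2,1,-1,1,-1]
/-- scaling -/
def kap : Fin 14 → ℤ := ![1,1,1,1,1,1,10,10,10,10,10,10,10,10]
/-- signs -/
def eps : Fin 14 → ℤ := ![-1,-1,-1,-1,-1,-1,1,1,1,1,1,1,1,1]

lemma u_norm (i : Fin 14) : 5 * ux i ^ 2 + uy i ^ 2 + uz i ^ 2 = 13 * kap i := by revert i; decide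
lemma kap_x (i : Fin 14) : kap i * tx i = 10 * ux i := by revert i; decide
lemma kap_y (i : Fin 14) : kap i * ty i = 2 * uy i := by revert i; decide
lemma kap_z (i : Fin 14) : kap i * tz i = 2 * uz i := by revert i; decide
lemma t_u (i : Fin 14) : tx i * ux i + ty i * uy i + tz i * uz i = 26 := by revert i; decide
lemma kap_cases (i : Fin 14) : kap i = 1 ∨ kap i = 10 := by revert i; decide
lemma u_unit (i : Fin 14) : ux i = 1 ∨ uy i = 2 := by revert i; decide

set_option synthInstance.maxHeartbeats 400000 in
set_option synthInstance.maxSize 4000 in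
lemma iso13 : ∀ x y z : ZMod 13, 5 * x ^ 2 + y ^ 2 + z ^ 2 = 0 → ¬ (x = 0 ∧ y = 0 ∧ z = 0) →
    ∃ i : Fin 14, (tx i : ZMod 13) * x + ty i * y + tz i * z = 0 ∧ ∃ c : ZMod 13, x = c * ux i ∧ y = c * uy i ∧ z = c * uz i := by
  decide +kernel

set_option synthInstance.maxHeartbeats 400000 in
set_option synthInstance.maxSize 4000 in
lemma iso13_unique : ∀ x y z : ZMod 13, 5 * x ^ 2 + y ^ 2 + z ^ 2 = 0 → ¬ (x = 0 ∧ y = 0 ∧ z = 0) →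
    ∀ i : Fin 14, (tx i : ZMod 13) * x + ty i * y + tz i * z = 0 → ∀ j : Fin 14, (tx j : ZMod 13) * x + ty j * y + tz j * z = 0 → j = i := by
  decide +kernel

lemma chi_lem : ∀ i : Fin 14, ∀ x y z : ZMod 4, (x = 1 ∨ x = 3) → (y = 1 ∨ y = 3) → (z = 1 ∨ z = 3) →
    ZMod.χ₄ (13 * x - (tx i * x + ty i * y + tz i * z) * ux i) * ZMod.χ₄ (13 * y - (tx i * x + ty i * y + tz i * z) * uy i) * ZMod.χ₄ (13 * z - (tx i * x + ty i * y + tz i * z) * uz i) = eps i * (ZMod.χ₄ x * ZMod.χ₄ y * ZMod.χ₄ z) := by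
  decide +kernel

lemma five_lem : ∀ x y z : ZMod 5, 
    ∑ i : Fin 14, (eps i : ZMod 5) * ((13 * x - (tx i * x + ty i * y + tz i * z) * ux i) * (13 * y - (tx i * x + ty i * y + tz i * z) * uy i) * (13 * z - (tx i * x + ty i * y + tz i * z) * uz i)) = 2 * (x * y * z) := by
  decide +kernel

end MP
end partf

section partg
open PowerSeries

namespace MP

/-- linear form -/
def tt (i : Fin 14) (v : ℤ × ℤ × ℤ) : ℤ := tx i * v.1 + ty i * v.2.1 + tz i * v.2.2
/-- Hecke map -/
def M (i : Fin 14) (v : ℤ × ℤ × ℤ) : ℤ × ℤ × ℤ := (13 * v.1 - tt i v * ux i, 13 * v.2.1 - tt i v * uy i, 13 * v.2.2 - tt i v * uz i)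
/-- quadratic form -/
def Q (v : ℤ × ℤ × ℤ) : ℤ := 5 * v.1 ^ 2 + v.2.1 ^ 2 + v.2.2 ^ 2
/-- weight -/
def F (v : ℤ × ℤ × ℤ) : ℤ := wt v.1 * (wt v.2.1 * wt v.2.2)
/-- divisibility -/
def Dv (d : ℤ) (v : ℤ × ℤ × ℤ) : Prop := d ∣ v.1 ∧ d ∣ v.2.1 ∧ d ∣ v.2.2

instance (d : ℤ) (v : ℤ × ℤ × ℤ) : Decidable (Dv d v) := by unfold Dv; infer_instance

lemma kap_tt (i : Fin 14) (v : ℤ × ℤ × ℤ) : kap i * tt i v = 2 * (5 * ux i * v.1 + uy i * v.2.1 + uz i * v.2.2) := by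
  unfold tt
  linear_combination v.1 * kap_x i + v.2.1 * kap_y i + v.2.2 * kap_z i

lemma Q_M (i : Fin 14) (v : ℤ × ℤ × ℤ) : Q (M i v) = 169 * Q v := by
  have h := kap_tt i v
  simp only [Q, M]
  generalize tt i v = t at *
  linear_combination t ^ 2 * u_norm i + 13 * t * h

lemma tt_M (i : Fin 14) (v : ℤ × ℤ × ℤ) : tt i (M i v) = - 13 * tt i v := by
  have h := t_u i
  have : tt i (M i v) = 13 * tt i v - tt i v * (tx i * ux i + ty i * uy i + tz i * uz i) := by
    simp only [M]
    generalize hT : tt i v = t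
    simp only [tt] at *
    linear_combination 13 * hT
  rw [this, h]; ring

lemma M_M (i : Fin 14) (v : ℤ × ℤ × ℤ) : M i (M i v) = (169 * v.1, 169 * v.2.1, 169 * v.2.2) := by
  have h := tt_M i v
  rw [M, h]
  simp only [M]
  refine Prod.ext ?_ (Prod.ext ?_ ?_) <;> simp only <;> ring

lemma M_smul (i : Fin 14) (c : ℤ) (v : ℤ × ℤ × ℤ) : M i (c * v.1, c * v.2.1, c * v.2.2) = (c * (M i v).1, c * (M i v).2.1, c * (M i v).2.2) := by
  simp only [M, tt]
  refine Prod.ext ?_ (Prod.ext ?_ ?_) <;> simp only <;> ring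

lemma uniq13 (v : ℤ × ℤ × ℤ) (h : ¬ Dv 13 v) (hQ : (13 : ℤ) ∣ Q v) :
    ∃ i, (13 : ℤ) ∣ tt i v ∧ (∃ c : ℤ, (13 : ℤ) ∣ v.1 - c * ux i ∧ (13 : ℤ) ∣ v.2.1 - c * uy i ∧ (13 : ℤ) ∣ v.2.2 - c * uz i) ∧
      ∀ j, (13 : ℤ) ∣ tt j v → j = i := by
  have hz : ∀ a : ℤ, ((a : ZMod 13) = 0 ↔ (13 : ℤ) ∣ a) := fun a => ZMod.intCast_zmod_eq_zero_iff_dvd a 13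
  have h1 : (5 * (v.1 : ZMod 13) ^ 2 + (v.2.1 : ZMod 13) ^ 2 + (v.2.2 : ZMod 13) ^ 2) = 0 := by
    have := (hz _).2 hQ
    rw [Q] at this
    push_cast at this
    exact this
  have h2 : ¬ ((v.1 : ZMod 13) = 0 ∧ (v.2.1 : ZMod 13) = 0 ∧ (v.2.2 : ZMod 13) = 0) := by
    rw [hz, hz, hz]; exact h
  have ht : ∀ i, ((tt i v : ℤ) : ZMod 13) = tx i * v.1 + ty i * v.2.1 + tz i * v.2.2 := by
    intro i; rw [tt]; push_cast; rfl
  obtain ⟨i, hi, c, hc1, hc2, hc3⟩ := iso13 _ _ _ h1 h2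
  refine ⟨i, ?_, ?_, ?_⟩
  · rw [← hz, ht]; exact hi
  · obtain ⟨c', rfl⟩ := ZMod.intCast_surjective c
    refine ⟨c', ?_, ?_, ?_⟩
    · rw [← hz]; push_cast; rw [hc1, sub_self]
    · rw [← hz]; push_cast; rw [hc2, sub_self]
    · rw [← hz]; push_cast; rw [hc3, sub_self]
  · intro j hj
    rw [← hz, ht] at hj
    exact iso13_unique _ _ _ h1 h2 i hi j hj

lemma dvd_tt_of_Dv (i : Fin 14) (w : ℤ × ℤ × ℤ) (h : Dv 169 (M i w)) : (13 : ℤ) ∣ tt i w := by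
  obtain ⟨h1, h2, -⟩ := h
  simp only [M] at h1 h2
  rcases u_unit i with hu | hu
  · rw [hu] at h1; omega
  · rw [hu] at h2; omega

lemma Dv_M (i : Fin 14) (w : ℤ × ℤ × ℤ) (hw : ¬ Dv 13 w) (hQ : (169 : ℤ) ∣ Q w) (c : ℤ)
    (h1 : (13 : ℤ) ∣ w.1 - c * ux i) (h2 : (13 : ℤ) ∣ w.2.1 - c * uy i) (h3 : (13 : ℤ) ∣ w.2.2 - c * uz i) : Dv 169 (M i w) := by
  obtain ⟨x, y, z⟩ := w
  simp only at h1 h2 h3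
  obtain ⟨a, ha⟩ := h1
  obtain ⟨b, hb⟩ := h2
  obtain ⟨d, hd⟩ := h3
  obtain rfl : x = c * ux i + 13 * a := by linarith
  obtain rfl : y = c * uy i + 13 * b := by linarith
  obtain rfl : z = c * uz i + 13 * d := by linarith
  have hp : Prime (13 : ℤ) := by
    rw [show (13 : ℤ) = ((13 : ℕ) : ℤ) from rfl, ← Nat.prime_iff_prime_int]; norm_num
  have hc : ¬ (13 : ℤ) ∣ c := by
    intro hc
    apply hw
    refine ⟨?_, ?_, ?_⟩
    · exact dvd_add (hc.mul_right _) (dvd_mul_right _ _)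
    · exact dvd_add (hc.mul_right _) (dvd_mul_right _ _)
    · exact dvd_add (hc.mul_right _) (dvd_mul_right _ _)
  have hg := kap_tt i (a, b, d)
  simp only at hg
  have hQ' : Q (c * ux i + 13 * a, c * uy i + 13 * b, c * uz i + 13 * d) = 13 * (kap i * c * (c + tt i (a, b, d))) + 169 * (5 * a ^ 2 + b ^ 2 + d ^ 2) := by
    simp only [Q]
    linear_combination c ^ 2 * u_norm i - 13 * c * hg
  rw [hQ'] at hQ
  have hk : (13 : ℤ) ∣ kap i * c * (c + tt i (a, b, d)) := by omega
  have hk2 : (13 : ℤ) ∣ c + tt i (a, b, d) := by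
    rcases hp.dvd_or_dvd hk with h | h
    · exfalso
      rcases hp.dvd_or_dvd h with h | h
      · rcases kap_cases i with h' | h' <;> rw [h'] at h <;> omega
      · exact hc h
    · exact h
  obtain ⟨q, hq⟩ := hk2
  have htt : tt i (c * ux i + 13 * a, c * uy i + 13 * b, c * uz i + 13 * d) = 13 * (c + 13 * q) := by
    have : tt i (c * ux i + 13 * a, c * uy i + 13 * b, c * uz i + 13 * d) = c * 26 + 13 * tt i (a, b, d) := by
      simp only [tt]
      linear_combination c * t_u i
    rw [this, ← hq]; ring
  refine ⟨?_, ?_, ?_⟩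
  · simp only [M, htt]; exact ⟨a - q * ux i, by ring⟩
  · simp only [M, htt]; exact ⟨b - q * uy i, by ring⟩
  · simp only [M, htt]; exact ⟨d - q * uz i, by ring⟩

lemma count_M (w : ℤ × ℤ × ℤ) (m : ℤ) (hm : (13 : ℤ) ∣ m) (hQ : Q w = 169 * m) :
    (Finset.univ.filter (fun i => Dv 169 (M i w))).card = if Dv 169 w then 14 else 1 := by
  by_cases h13 : Dv 13 w
  · obtain ⟨x, y, z⟩ := w
    obtain ⟨⟨a, ha⟩, ⟨b, hb⟩, ⟨d, hd⟩⟩ := h13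
    simp only at ha hb hd
    subst ha hb hd
    have hsm := fun i => M_smul i 13 (a, b, d)
    simp only at hsm
    have hiff : ∀ i, Dv 169 (M i (13 * a, 13 * b, 13 * d)) ↔ (13 : ℤ) ∣ tt i (a, b, d) := by
      intro i
      rw [hsm]
      constructor
      · rintro ⟨h1, h2, -⟩
        simp only [M] at h1 h2
        rcases u_unit i with hu | hu
        · rw [hu] at h1; omega
        · rw [hu] at h2; omega
      · rintro ⟨q, hq⟩
        refine ⟨?_, ?_, ?_⟩
        · simp only [M, hq]; exact ⟨a - q * ux i, by ring⟩
        · simp only [M, hq]; exact ⟨b - q * uy i, by ring⟩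
        · simp only [M, hq]; exact ⟨d - q * uz i, by ring⟩
    simp only [hiff]
    have hQ2 : Q (a, b, d) = m := by
      have : Q (13 * a, 13 * b, 13 * d) = 169 * Q (a, b, d) := by simp only [Q]; ring
      rw [this] at hQ; omega
    by_cases h169 : Dv 13 (a, b, d)
    · rw [if_pos]
      · rw [Finset.filter_true_of_mem]
        · simp
        · intro i _
          obtain ⟨h1, h2, h3⟩ := h169
          exact dvd_add (dvd_add (h1.mul_left _) (h2.mul_left _)) (h3.mul_left _)
      · obtain ⟨h1, h2, h3⟩ := h169
        simp only at h1 h2 h3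
        refine ⟨?_, ?_, ?_⟩ <;> simp only <;> omega
    · rw [if_neg]
      · obtain ⟨i, h1, -, h2⟩ := uniq13 (a, b, d) h169 (by rw [hQ2]; exact hm)
        rw [Finset.card_eq_one]
        refine ⟨i, ?_⟩
        ext j
        simp only [Finset.mem_filter, Finset.mem_univ, true_and, Finset.mem_singleton]
        exact ⟨h2 j, fun h => h ▸ h1⟩
      · rintro ⟨h1, h2, h3⟩
        simp only at h1 h2 h3
        apply h169
        refine ⟨?_, ?_, ?_⟩ <;> simp only <;> omega
  · rw [if_neg]
    · obtain ⟨i, -, ⟨c, c1, c2, c3⟩, h2⟩ := uniq13 w h13 (by rw [hQ]; omega)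
      rw [Finset.card_eq_one]
      refine ⟨i, ?_⟩
      ext j
      simp only [Finset.mem_filter, Finset.mem_univ, true_and, Finset.mem_singleton]
      constructor
      · intro h
        exact h2 j (dvd_tt_of_Dv j w h)
      · rintro rfl
        exact Dv_M j w h13 ⟨m, hQ⟩ c c1 c2 c3
    · rintro ⟨h1, h2, h3⟩
      apply h13
      refine ⟨?_, ?_, ?_⟩ <;> omega

lemma odd_of_Q (v : ℤ × ℤ × ℤ) (h : Q v % 8 = 7) : v.1 % 2 = 1 ∧ v.2.1 % 2 = 1 ∧ v.2.2 % 2 = 1 := by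
  have hs : ∀ a : ℤ, (a ^ 2 % 8 = 1 ∧ a % 2 = 1) ∨ (a ^ 2 % 8 = 0 ∧ a % 2 = 0) ∨ (a ^ 2 % 8 = 4 ∧ a % 2 = 0) := by
    intro a
    have ha : a % 8 = 0 ∨ a % 8 = 1 ∨ a % 8 = 2 ∨ a % 8 = 3 ∨ a % 8 = 4 ∨ a % 8 = 5 ∨ a % 8 = 6 ∨ a % 8 = 7 := by omega
    have h2 : a ^ 2 % 8 = ((a % 8) * (a % 8)) % 8 := by rw [pow_two, Int.mul_emod]
    rcases ha with ha | ha | ha | ha | ha | ha | ha | ha <;> rw [ha] at h2 <;> omega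
  unfold Q at h
  have h1 := hs v.1
  have h2 := hs v.2.1
  have h3 := hs v.2.2
  omega

lemma F_sum (v : ℤ × ℤ × ℤ) (h : Q v % 8 = 7) : ∑ i, (F (M i v) : ZMod 5) = 2 * (F v : ZMod 5) := by
  obtain ⟨h1, h2, h3⟩ := odd_of_Q v h
  have hz : ∀ x : ℤ, x % 2 = 1 → (x : ZMod 4) = 1 ∨ (x : ZMod 4) = 3 := by
    intro x hx
    have : x % 4 = 1 ∨ x % 4 = 3 := by omega
    rcases this with h | h
    · left; have := (ZMod.intCast_eq_intCast_iff x 1 4).2 h; simpa using this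
    · right; have := (ZMod.intCast_eq_intCast_iff x 3 4).2 h; simpa using this
  set X := ZMod.χ₄ (v.1 : ZMod 4) * ZMod.χ₄ (v.2.1 : ZMod 4) * ZMod.χ₄ (v.2.2 : ZMod 4) with hX
  have e : ∀ i, F (M i v) = X * (eps i * ((M i v).1 * (M i v).2.1 * (M i v).2.2)) := by
    intro i
    have hc := chi_lem i _ _ _ (hz _ h1) (hz _ h2) (hz _ h3)
    have hc' : ZMod.χ₄ ((M i v).1 : ZMod 4) * ZMod.χ₄ ((M i v).2.1 : ZMod 4) * ZMod.χ₄ ((M i v).2.2 : ZMod 4) = eps i * X := by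
      rw [hX, ← hc]
      simp only [M, tt]
      push_cast
      rfl
    simp only [F, wt]
    linear_combination ((M i v).1 * (M i v).2.1 * (M i v).2.2) * hc'
  have e0 : F v = X * (v.1 * v.2.1 * v.2.2) := by
    simp only [F, wt, hX]; ring
  have h5 := five_lem (v.1 : ZMod 5) (v.2.1 : ZMod 5) (v.2.2 : ZMod 5)
  simp only [e, e0]
  push_cast
  rw [← Finset.mul_sum]
  have : ∑ i, (eps i : ZMod 5) * (((M i v).1 : ZMod 5) * ((M i v).2.1 : ZMod 5) * ((M i v).2.2 : ZMod 5)) = 2 * (v.1 * v.2.1 * v.2.2) := by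
    rw [← h5]
    apply Finset.sum_congr rfl
    intro i _
    simp only [M, tt]
    push_cast
    rfl
  rw [this]; ring

end MP
end partg

section parth
open PowerSeries

namespace MP

/-- ternary theta -/
noncomputable def GG : ℤ⟦X⟧ := phi Th * (Th * Th)

lemma rep_G (m : ℕ) : ∃ s : Finset (ℤ × ℤ × ℤ), (∀ v, v ∈ s ↔ Q v = m) ∧ coeff m GG = ∑ v ∈ s, F v := by
  obtain ⟨s, h1, h2⟩ := (rep_Th.expand5.mul (rep_Th.mul rep_Th)) m
  refine ⟨s, ?_, h2⟩
  intro v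
  rw [h1]
  zify
  simp only [sq_abs, Q, add_assoc]

/-- reduced coefficients -/
noncomputable def T (m : ℕ) : ZMod 5 := ((coeff m GG : ℤ) : ZMod 5)

lemma wt_169 (x : ℤ) : wt (169 * x) = 169 * wt x := by
  unfold wt
  have : ((169 * x : ℤ) : ZMod 4) = (x : ZMod 4) := by
    push_cast
    have : (169 : ZMod 4) = 1 := by decide
    rw [this, one_mul]
  rw [this]; ring

lemma hecke (m : ℕ) (h7 : m % 8 = 7) (h13 : 13 ∣ m) :
    T (169 * m) + 2 * (if 169 ∣ m then T (m / 169) else 0) = 2 * T m := by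
  choose V hV hV' using rep_G
  have hT : ∀ m, T m = ∑ v ∈ V m, (F v : ZMod 5) := by
    intro m; rw [T, hV']; push_cast; rfl
  have h13' : (13 : ℤ) ∣ m := by exact_mod_cast h13
  have h1 : ∑ v ∈ V m, ∑ i, (F (M i v) : ZMod 5) = 2 * T m := by
    rw [hT, Finset.mul_sum]
    apply Finset.sum_congr rfl
    intro v hv
    rw [hV] at hv
    apply F_sum
    rw [hv]; omega
  rw [Finset.sum_comm] at h1
  have h2 : ∀ i, ∑ v ∈ V m, (F (M i v) : ZMod 5) = ∑ w ∈ V (169 * m) with Dv 169 (M i w), (F w : ZMod 5) := by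
    intro i
    refine Finset.sum_bij' (fun v _ => M i v) (fun w _ => ((M i w).1 / 169, (M i w).2.1 / 169, (M i w).2.2 / 169)) ?_ ?_ ?_ ?_ ?_
    · intro v hv
      rw [hV] at hv
      rw [Finset.mem_filter, hV, Q_M, hv, M_M]
      exact ⟨by push_cast; rfl, Dvd.intro _ rfl, Dvd.intro _ rfl, Dvd.intro _ rfl⟩
    · intro w hw
      rw [Finset.mem_filter, hV] at hw
      obtain ⟨hw, ⟨a, ha⟩, ⟨b, hb⟩, ⟨d, hd⟩⟩ := hw
      rw [hV]
      have hq := Q_M i w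
      rw [hw] at hq
      simp only [Q, ha, hb, hd] at hq ⊢
      simp only [Int.mul_ediv_cancel_left _ (by norm_num : (169 : ℤ) ≠ 0)]
      push_cast at hq
      nlinarith
    · intro v hv
      simp only [M_M, Int.mul_ediv_cancel_left _ (by norm_num : (169 : ℤ) ≠ 0)]
    · intro w hw
      rw [Finset.mem_filter, hV] at hw
      obtain ⟨hw, ⟨a, ha⟩, ⟨b, hb⟩, ⟨d, hd⟩⟩ := hw
      simp only [ha, hb, hd, Int.mul_ediv_cancel_left _ (by norm_num : (169 : ℤ) ≠ 0)]
      have hMM := M_M i w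
      have hs := M_smul i 169 (a, b, d)
      simp only at hs
      have hw' : M i w = (169 * a, 169 * b, 169 * d) := by
        rw [← ha, ← hb, ← hd]
      rw [hw', hs] at hMM
      simp only [Prod.mk.injEq] at hMM
      obtain ⟨e1, e2, e3⟩ := hMM
      refine Prod.ext ?_ (Prod.ext ?_ ?_) <;> omega
    · intro v hv; rfl
  simp only [h2, Finset.sum_filter] at h1
  rw [Finset.sum_comm] at h1
  have h3 : ∀ w ∈ V (169 * m), ∑ i, (if Dv 169 (M i w) then (F w : ZMod 5) else 0) = (F w : ZMod 5) + 13 * (if Dv 169 w then (F w : ZMod 5) else 0) := by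
    intro w hw
    rw [hV] at hw
    rw [← Finset.sum_filter, Finset.sum_const, count_M w m h13' (by rw [hw]; push_cast; rfl)]
    split_ifs
    · rw [nsmul_eq_mul]; push_cast; ring
    · simp
  rw [Finset.sum_congr rfl h3, Finset.sum_add_distrib, ← Finset.mul_sum, ← Finset.sum_filter, ← hT] at h1
  rw [← h1]
  congr 1
  have h4 : ∑ w ∈ V (169 * m) with Dv 169 w, (F w : ZMod 5) = - (if 169 ∣ m then T (m / 169) else 0) := by
    split_ifs with hd
    · obtain ⟨q, rfl⟩ := hd
      rw [Nat.mul_div_cancel_left _ (by norm_num), hT, ← Finset.sum_neg_distrib]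
      symm
      refine Finset.sum_bij' (fun v _ => (169 * v.1, 169 * v.2.1, 169 * v.2.2)) (fun w _ => (w.1 / 169, w.2.1 / 169, w.2.2 / 169)) ?_ ?_ ?_ ?_ ?_
      · intro v hv
        rw [hV] at hv
        rw [Finset.mem_filter, hV]
        refine ⟨?_, Dvd.intro _ rfl, Dvd.intro _ rfl, Dvd.intro _ rfl⟩
        simp only [Q] at hv ⊢
        push_cast
        rw [← hv]; ring
      · intro w hw
        rw [Finset.mem_filter, hV] at hw
        obtain ⟨hw, ⟨a, ha⟩, ⟨b, hb⟩, ⟨d, hd⟩⟩ := hw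
        rw [hV]
        simp only [Q, ha, hb, hd, Int.mul_ediv_cancel_left _ (by norm_num : (169 : ℤ) ≠ 0)] at hw ⊢
        push_cast at hw
        nlinarith
      · intro v hv
        simp only [Int.mul_ediv_cancel_left _ (by norm_num : (169 : ℤ) ≠ 0)]
      · intro w hw
        rw [Finset.mem_filter, hV] at hw
        obtain ⟨hw, ⟨a, ha⟩, ⟨b, hb⟩, ⟨d, hd⟩⟩ := hw
        simp only [ha, hb, hd, Int.mul_ediv_cancel_left _ (by norm_num : (169 : ℤ) ≠ 0)]
        rw [← ha, ← hb, ← hd]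
      · intro v hv
        simp only [F, wt_169]
        push_cast
        have : (169 : ZMod 5) = -1 := by decide
        rw [this]; ring
    · rw [neg_zero]
      apply Finset.sum_eq_zero
      intro w hw
      exfalso
      rw [Finset.mem_filter, hV] at hw
      obtain ⟨hw, ⟨a, ha⟩, ⟨b, hb⟩, ⟨d, hd'⟩⟩ := hw
      apply hd
      simp only [Q, ha, hb, hd'] at hw
      push_cast at hw
      have : (169 : ℤ) ∣ m := ⟨5 * a ^ 2 + b ^ 2 + d ^ 2, by nlinarith⟩
      exact_mod_cast this
  rw [h4]
  have : (13 : ZMod 5) = -2 := by decide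
  rw [this]; ring

lemma rec_vanish (s : ℕ → ZMod 5) (h0 : s 1 = 2 * s 0) (hs : ∀ k, s (k + 2) = 2 * s (k + 1) - 2 * s k) (j : ℕ) :
    s (4 * j + 3) = 0 := by
  induction j with
  | zero =>
    have a := hs 0
    have b := hs 1
    simp only [zero_add, Nat.reduceAdd, mul_zero] at a b ⊢
    rw [b, a, h0]; ring
  | succ j ih =>
    have a := hs (4 * j + 3)
    have b := hs (4 * j + 4)
    have c := hs (4 * j + 5)
    have e : 4 * (j + 1) + 3 = 4 * j + 5 + 2 := by ring
    rw [e, c]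
    simp only [add_assoc, Nat.reduceAdd] at a b ih ⊢
    rw [b, a, ih]; ring

lemma T_vanish (m : ℕ) (h7 : (13 * m) % 8 = 7) (h13 : ¬ 13 ∣ m) (j : ℕ) :
    T (13 ^ (2 * (4 * j + 3) + 1) * m) = 0 := by
  have hmod : ∀ k, (13 ^ (2 * k + 1) * m) % 8 = 7 := by
    intro k
    rw [pow_succ, pow_mul, mul_assoc, Nat.mul_mod, h7, Nat.pow_mod]; norm_num
  have e2 : ∀ k, 13 ^ (2 * (k + 1) + 1) * m = 169 * (13 ^ (2 * k + 1) * m) := by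
    intro k
    have : 2 * (k + 1) + 1 = (2 * k + 1) + 2 := by ring
    rw [this, pow_add]; ring
  obtain ⟨s, hs⟩ : ∃ s : ℕ → ZMod 5, ∀ k, T (13 ^ (2 * k + 1) * m) = s k := ⟨_, fun _ => rfl⟩
  rw [hs]
  apply rec_vanish
  · have h := hecke (13 ^ (2 * 0 + 1) * m) (hmod 0) (Dvd.dvd.mul_right (dvd_pow_self _ (by omega)) _)
    have h1 : ¬ 169 ∣ 13 ^ (2 * 0 + 1) * m := by simp only [mul_zero, zero_add, pow_one]; omega
    rw [if_neg h1, ← e2, hs, hs, mul_zero, add_zero] at h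
    exact h
  · intro k
    have h := hecke (13 ^ (2 * (k + 1) + 1) * m) (hmod (k + 1)) (Dvd.dvd.mul_right (dvd_pow_self _ (by omega)) _)
    have e3 : 13 ^ (2 * (k + 1) + 1) * m / 169 = 13 ^ (2 * k + 1) * m := by
      rw [e2, Nat.mul_div_cancel_left _ (by norm_num)]
    rw [if_pos ⟨_, e2 k⟩, e3, ← e2, hs, hs, hs] at h
    exact eq_sub_of_add_eq h

lemma coeff_G (k : ℕ) : coeff (8 * k + 7) GG = 8 * coeff k (J ^ 2 * phi J) := by
  have hcomm : phi (phi8 J) = phi8 (phi J) := by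
    rw [phi, phi8, ← expand_mul, ← expand_mul]
  have : GG = C 8 * (phi8 (J ^ 2 * phi J) * X ^ 7) := by
    have e : (C 8 : ℤ⟦X⟧) = 8 := map_ofNat _ _
    rw [e, GG, Th]
    simp only [map_mul, map_pow, map_ofNat, expand_X, hcomm]
    ring
  rw [this, coeff_C_mul, coeff_mul_X_pow, coeff_expand_mul]

end MP

theorem multipartition_aux (p n : ℕ) (hp8 : p % 8 = 5) (hp3 : p % 3 = 1) (hv : ∀ m, (13 * m) % 8 = 7 → ¬ 13 ∣ m → MP.T (p * m) = 0) (hcop : n.Coprime 13) (hdvd : 24 ∣ 5 ^ 2 * p * n + 3) : (25 : ℤ) ∣ coeff ((5 ^ 2 * p * n + 3) / 24) (MP.pf ^ 3) := by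
  obtain ⟨N, hN⟩ := hdvd
  rw [hN, Nat.mul_div_cancel_left _ (by norm_num)]
  have h3 : 3 ∣ n := by
    have h : 3 ∣ (5 ^ 2 * p) * n := by
      have h1 : 3 ∣ 24 * N := Dvd.dvd.mul_right (by norm_num) _
      rw [← hN] at h1
      exact (Nat.dvd_add_left (by norm_num)).1 h1
    refine Nat.Coprime.dvd_of_dvd_mul_left ?_ h
    rw [Nat.Prime.coprime_iff_not_dvd (by norm_num)]
    omega
  obtain ⟨m, rfl⟩ := h3
  have hm : ¬ 13 ∣ m := by
    intro h
    have h1 : 13 ∣ Nat.gcd (3 * m) 13 := Nat.dvd_gcd (h.mul_left 3) dvd_rfl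
    rw [hcop] at h1
    omega
  have e : 25 * (p * m) + 1 = 8 * N := by
    have : 5 ^ 2 * p * (3 * m) = 3 * (25 * (p * m)) := by ring
    rw [this] at hN
    omega
  have e7 : (p * m) % 8 = 7 := by omega
  have e8 : (13 * m) % 8 = 7 := by
    have : (p * m) % 8 = (13 * m) % 8 := by
      rw [Nat.mul_mod, Nat.mul_mod 13 m, hp8]
    omega
  obtain ⟨k, hk⟩ : ∃ k, p * m = 8 * k + 7 := ⟨p * m / 8, by omega⟩
  obtain rfl : N = 25 * k + 22 := by omega
  have hv := hv m e8 hm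
  rw [hk, MP.T, MP.coeff_G] at hv
  have h5 := (ZMod.intCast_zmod_eq_zero_iff_dvd _ 5).1 hv
  have hmain := MP.main25' k
  have h5' : (5 : ℤ) ∣ 8 * coeff k (MP.J ^ 2 * MP.phi MP.J) := h5
  omega

theorem multipartition_aux2 (n : ℕ) (hcop : n.Coprime 13) (hdvd : 24 ∣ 5 ^ 2 * 13 ^ 199 * n + 3) : (25 : ℤ) ∣ coeff ((5 ^ 2 * 13 ^ 199 * n + 3) / 24) (MP.pf ^ 3) := by
  refine multipartition_aux (13 ^ 199) n (by norm_num) (by norm_num) ?_ hcop hdvd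
  intro m h1 h2
  exact MP.T_vanish m h1 h2 24
end parth

theorem multipartition_of_coeff (N : ℕ) (h : (25 : ℤ) ∣ PowerSeries.coeff N (MP.pf ^ 3)) :
    5 ^ 2 ∣ multipartition 3 N := by
  rw [← MP.multi_eq] at h
  unfold multipartition
  exact_mod_cast h

theorem multipartition_three_25_13 (n : ℕ) (hn : 0 < n) (hcop : n.Coprime 13)
    (hdvd : 24 ∣ 5 ^ 2 * 13 ^ 199 * n + 3) :
    5 ^ 2 ∣ multipartition 3 ((5 ^ 2 * 13 ^ 199 * n + 3) / 24) :=
  multipartition_of_coeff _ (multipartition_aux2 n hcop hdvd)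
end

section
/- For every positive integer n coprime to 17 such that 24 divides 7²·17^{195}·n + 5, one has p_5((7²·17^{195}·n + 5)/24) ≡ 0 (mod 7²). -/
section
open Filter Topology PowerSeries in
theorem hasSum_pent {x : ℂ} (hx : ‖x‖ < 1) :
    HasSum (fun m ↦ (coeff m (pentagonalSeries ℂ)) * x ^ m) (∏' n : ℕ, (1 - x ^ (n + 1))) := by
  have hx0 := norm_nonneg x
  have hgeo := summable_geometric_of_lt_one hx0 hx
  have hS : Summable (fun m ↦ (coeff m (pentagonalSeries ℂ)) * x ^ m) := by
    refine Summable.of_norm_bounded hgeo fun m ↦ ?_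
    rw [norm_mul, norm_pow]
    refine mul_le_of_le_one_left (by positivity) ?_
    by_cases h : m ∈ Set.range pentagonal
    · obtain ⟨k, rfl⟩ := h
      rw [coeff_pentagonalSeries_pentagonal]
      rcases Int.even_or_odd k with h | h
      · simp [Int.negOnePow_even _ h]
      · simp [Int.negOnePow_odd _ h]
    · rw [coeff_pentagonalSeries_eq_zero ℂ h]; simp
  have hS' := hS.hasSum
  rw [← pentagonal_injective.hasSum_iff fun n hn ↦ by simp [coeff_pentagonalSeries_eq_zero ℂ hn],
    ← neg_injective.hasSum_iff (fun x hx ↦ by absurd hx; use -x; simp)] at hS'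
  have h2 := hS'.nat_add_neg_add_one
  have h3 : HasSum (fun k : ℕ ↦ (-1) ^ k * (x ^ pentagonal (-k) - x ^ pentagonal (k + 1)))
      (∑' m, (coeff m (pentagonalSeries ℂ)) * x ^ m) := by
    convert h2 using 2 with k
    simp_rw [Function.comp_apply, neg_neg, coeff_pentagonalSeries_pentagonal, Int.negOnePow_add]
    simp
    ring
  set B := Real.exp (∑' n : ℕ, ‖x‖ ^ n) with hB
  have hprod : ∀ k n, ‖∏ i ∈ Finset.range n, (1 - x ^ (k + i + 1))‖ ≤ B := by
    intro k n
    calc ‖∏ i ∈ Finset.range n, (1 - x ^ (k + i + 1))‖ 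
        = ∏ i ∈ Finset.range n, ‖(1 - x ^ (k + i + 1))‖ := norm_prod _ _
      _ ≤ ∏ i ∈ Finset.range n, Real.exp (‖x‖ ^ i) := by
          refine Finset.prod_le_prod (fun _ _ ↦ norm_nonneg _) fun i _ ↦ ?_
          calc ‖(1 - x ^ (k + i + 1))‖ ≤ 1 + ‖x‖ ^ (k + i + 1) := by
                refine (norm_sub_le _ _).trans ?_; simp
            _ ≤ ‖x‖ ^ i + 1 := by
                have := pow_le_pow_of_le_one hx0 hx.le (show i ≤ k + i + 1 by omega); linarith
            _ ≤ _ := Real.add_one_le_exp _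
      _ = Real.exp (∑ i ∈ Finset.range n, ‖x‖ ^ i) := (Real.exp_sum _ _).symm
      _ ≤ B := Real.exp_le_exp.mpr (hgeo.sum_le_tsum _ fun _ _ ↦ by positivity)
  have hterm : ∀ k n : ℕ, ‖x ^ ((k + 1) * n) * ∏ i ∈ Finset.range (n + 1), (1 - x ^ (k + i + 1))‖
      ≤ ‖x‖ ^ n * B := by
    intro k n
    rw [norm_mul, norm_pow]
    refine mul_le_mul (pow_le_pow_of_le_one hx0 hx.le (by nlinarith)) (hprod _ _) (norm_nonneg _)
      (by positivity)
  have := Pentagonal.tprod_one_sub_pow (x := x) ?_ ?_ ?_ h3.summable ?_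
  · rw [this, h3.tsum_eq]; exact hS.hasSum
  · exact tendsto_pow_atTop_nhds_zero_of_norm_lt_one hx
  · exact fun k ↦ Summable.of_norm_bounded (hgeo.mul_right B) (hterm k)
  · intro k
    have : Summable fun n : ℕ ↦ ‖-x ^ (n + k + 1)‖ := by
      simp only [norm_neg, norm_pow, add_assoc]
      exact (summable_nat_add_iff (k + 1)).mpr hgeo
    simpa [sub_eq_add_neg] using multipliable_one_add_of_summable this
  · refine squeeze_zero_norm (a := fun k ↦ ‖x‖ ^ k * ∑' n : ℕ, ‖x‖ ^ n * B) (fun k ↦ ?_) ?_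
    · rw [norm_mul, norm_mul, norm_pow, norm_pow, norm_neg, norm_one, one_pow, one_mul]
      refine mul_le_mul (pow_le_pow_of_le_one hx0 hx.le ?_)
        (tsum_of_norm_bounded (hgeo.mul_right B).hasSum (hterm k)) (norm_nonneg _) (by positivity)
      rw [Nat.le_div_iff_mul_le (by simp)]; nlinarith
    · simpa using (tendsto_pow_atTop_nhds_zero_of_lt_one hx0 hx).mul_const (∑' n : ℕ, ‖x‖ ^ n * B)

end

section
open Complex Real in
/-- e(z) -/
noncomputable def ee (z : ℂ) : ℂ := Complex.exp (2 * π * I * z)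

noncomputable def zt : ℂ := ee (1 / 24)

lemma ee_add (a b : ℂ) : ee (a + b) = ee a * ee b := by
  simp only [ee, mul_add, Complex.exp_add]

lemma ee_ne (a : ℂ) : ee a ≠ 0 := Complex.exp_ne_zero _

lemma ee_nat_mul (n : ℕ) (a : ℂ) : ee (n * a) = ee a ^ n := by
  rw [ee, ee, ← Complex.exp_nat_mul]; congr 1; ring

lemma ee_int_mul (n : ℤ) (a : ℂ) : ee (n * a) = ee a ^ n := by
  rw [ee, ee, ← Complex.exp_int_mul]; congr 1; ring

lemma ee_one : ee 1 = 1 := by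
  rw [ee, mul_one, Complex.exp_two_pi_mul_I]

lemma ee_int (n : ℤ) : ee n = 1 := by
  have := ee_int_mul n 1
  rw [mul_one, ee_one, one_zpow] at this; exact this

lemma ee_nat (n : ℕ) : ee n = 1 := by exact_mod_cast ee_int n

lemma norm_ee_lt {z : ℂ} (hz : 0 < z.im) : ‖ee z‖ < 1 := by
  have := Function.Periodic.norm_qParam_lt_one (h := 1) one_pos hz
  simpa [Function.Periodic.qParam, ee] using this

lemma qParam_eq_ee (z : ℂ) : Function.Periodic.qParam 1 z = ee z := by
  simp [Function.Periodic.qParam, ee]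

noncomputable def Eu (x : ℂ) : ℂ := ∏' n : ℕ, (1 - x ^ (n + 1))

open ModularForm

lemma eta_eq (z : ℂ) : eta z = ee (z / 24) * Eu (ee z) := by
  unfold eta Eu ee
  congr 1
  · simp only [Function.Periodic.qParam]; congr 1; push_cast; ring
  · simp [eta_q, Function.Periodic.qParam]

lemma eta_add_int (z : ℂ) (n : ℤ) : eta (z + n) = zt ^ n * eta z := by
  rw [eta_eq, eta_eq, ee_add, ee_int, mul_one, add_div, ee_add, zt, ← ee_int_mul,
    show (n : ℂ) * (1 / 24) = n / 24 by ring]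
  ring

lemma csqrt_sq (w : ℂ) : w.sqrt ^ 2 = w := by
  rw [Complex.sqrt, ← Complex.cpow_nat_mul]; simp

lemma csqrt_im {w : ℂ} (h : 0 < w.im) : 0 < w.sqrt.im := by
  rw [Complex.sqrt_eq_real_add_ite, if_pos h.le]
  have h1 : |w.re| < ‖w‖ := Complex.abs_re_lt_norm.mpr h.ne'
  have := abs_lt.mp h1
  simp; linarith

lemma csqrt_re {w : ℂ} (h : 0 < w.im) : 0 < w.sqrt.re := by
  rw [Complex.sqrt_eq_real_add_ite, if_pos h.le]
  have h1 : |w.re| < ‖w‖ := Complex.abs_re_lt_norm.mpr h.ne'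
  have := abs_lt.mp h1
  simp; linarith

lemma csqrt_ne {w : ℂ} (h : 0 < w.im) : w.sqrt ≠ 0 := by
  intro h0; have := csqrt_im h; rw [h0] at this; simp at this

lemma csqrt_unique {w p : ℂ} (h : 0 < w.im) (hp : p ^ 2 = w) (hp' : 0 < p.im) : p = w.sqrt := by
  have h1 := csqrt_sq w
  rw [← hp] at h1
  rcases sq_eq_sq_iff_eq_or_eq_neg.mp h1 with h2 | h2
  · rw [← hp]; exact h2.symm
  · have := csqrt_im h
    rw [← hp, h2] at this; simp at this; linarith

open Complex in
lemma csqrt_I : (I : ℂ).sqrt = zt ^ 3 := by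
  rw [Complex.sqrt, Complex.cpow_def_of_ne_zero (by simp), zt, ee, ← Complex.exp_nat_mul, Complex.log_I]
  congr 1; push_cast; ring

/-- The multiplier predicate -/
def EM (a b c d k : ℤ) : Prop := ∀ z : ℂ, 0 < z.im →
  eta ((a * z + b) / (c * z + d)) = zt ^ k * (Complex.I.sqrt)⁻¹ * (c * z + d : ℂ).sqrt * eta z

lemma eta_S {z : ℂ} (hz : 0 < z.im) :
    eta (-1 / z) = (Complex.I.sqrt)⁻¹ * z.sqrt * eta z := by
  have := ModularForm.eta_comp_eq_csqrt_I_inv (x := z) hz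
  simp at this
  rw [this]; ring

lemma zt_ne : zt ≠ 0 := ee_ne _

lemma lin_im {c d : ℤ} {z : ℂ} (hz : 0 < z.im) (hc : 0 < c) : 0 < (c * z + d : ℂ).im := by
  simp; positivity

lemma ne_of_im {z : ℂ} (hz : 0 < z.im) : z ≠ 0 := by rintro rfl; simp at hz

lemma EM_base {a b d : ℤ} (h : a * d - b = 1) : EM a b 1 d (a + d) := by
  intro z hz
  have h1 : 0 < (z + d).im := by simpa using hz
  have h2 := ne_of_im h1
  have hb : (b : ℂ) = a * d - 1 := by rw [show b = a * d - 1 by linarith]; push_cast; ring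
  have : (a * z + b) / ((1 : ℤ) * z + d) = -1 / (z + d) + a := by
    push_cast; rw [one_mul]; field_simp; rw [hb]; ring
  rw [this, eta_add_int, eta_S h1, eta_add_int, zpow_add₀ zt_ne]; push_cast; rw [one_mul]; ring

lemma EM_T {a b c d k : ℤ} (hc : 0 < c) (h : EM a b c d k) (n : ℤ) :
    EM (a + n * c) (b + n * d) c d (k + n) := by
  intro z hz
  have h2 := ne_of_im (lin_im (d := d) hz hc)
  have : (((a + n * c : ℤ) : ℂ) * z + ((b + n * d : ℤ) : ℂ)) / (c * z + d) =
      (a * z + b) / (c * z + d) + n := by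
    rw [div_add' _ _ _ h2]; congr 1; push_cast; ring
  rw [this, eta_add_int, h z hz, zpow_add₀ zt_ne]; ring

lemma EM_S {a b c d k : ℤ} (ha : 0 < a) (hc : 0 < c) (hdet : a * d - b * c = 1)
    (h : EM (-c) (-d) a b k) : EM a b c d (k + 3) := by
  intro z hz
  have hq := lin_im (d := d) hz hc
  have hp := lin_im (d := b) hz ha
  have hq0 := ne_of_im hq
  have hp0 := ne_of_im hp
  set w : ℂ := ((-c : ℤ) * z + (-d : ℤ)) / (a * z + b) with hw
  have hw' : w = -(c * z + d) / (a * z + b) := by rw [hw]; push_cast; ring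
  have hmul : w * (a * z + b) = -(c * z + d) := by rw [hw', div_mul_cancel₀ _ hp0]
  have hdet' : (a : ℝ) * d - b * c = 1 := by exact_mod_cast hdet
  have hwim : 0 < w.im := by
    have hn : 0 < Complex.normSq (a * z + b) := Complex.normSq_pos.mpr hp0
    have : w.im = z.im / Complex.normSq (a * z + b) := by
      rw [hw', Complex.div_im]
      rw [← sub_div]
      congr 1
      simp
      linear_combination z.im * hdet'
    rw [this]; positivity
  have e1 : (a * z + b) / (c * z + d) = -1 / w := by
    rw [hw']; field_simp
  rw [e1, eta_S hwim, hw, h z hz, ← hw]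
  have e2 : w.sqrt * (a * z + b : ℂ).sqrt = Complex.I * (c * z + d : ℂ).sqrt := by
    have i1 := csqrt_im hwim
    have i2 := csqrt_re hwim
    have i3 := csqrt_im hp
    have i4 := csqrt_re hp
    have : (w.sqrt * (a * z + b : ℂ).sqrt) ^ 2 = (Complex.I * (c * z + d : ℂ).sqrt) ^ 2 := by
      rw [mul_pow, mul_pow, csqrt_sq, csqrt_sq, csqrt_sq, hmul]; simp
    rcases sq_eq_sq_iff_eq_or_eq_neg.mp this with h2 | h2
    · exact h2
    · exfalso
      have i5 := csqrt_re hq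
      have := congrArg Complex.im h2
      simp at this
      nlinarith [mul_pos i1 i4, mul_pos i2 i3]
  have e3 : (Complex.I.sqrt)⁻¹ * Complex.I = zt ^ 3 := by
    have h0 : Complex.I.sqrt ≠ 0 := csqrt_ne (by simp)
    rw [← csqrt_I, inv_mul_eq_iff_eq_mul₀ h0, ← pow_two, csqrt_sq]
  rw [zpow_add₀ zt_ne, show (zt ^ (3 : ℤ)) = zt ^ 3 from by norm_cast, ← e3]
  linear_combination (Complex.I.sqrt)⁻¹ * (Complex.I.sqrt)⁻¹ * zt ^ k * eta z * e2

/-- computing multipliers, with fuel -/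
def kf : ℕ → ℤ → ℤ → ℤ → ℤ → Option ℤ
  | 0, _, _, _, _ => none
  | f + 1, A, B, C, D =>
    if C = 1 then some (A + D) else
    let n := A / C
    let a := A - n * C
    let b := B - n * D
    if 0 < a then (kf f (-C) (-D) a b).map (fun k => k + 3 + n) else none

lemma EM_of_kf (f : ℕ) : ∀ {A B C D k : ℤ}, 0 < C → A * D - B * C = 1 → kf f A B C D = some k →
    EM A B C D k := by
  induction f with
  | zero => intro A B C D k _ _ h; simp [kf] at h
  | succ f ih =>
    intro A B C D k hC hdet h
    rw [kf] at h
    split_ifs at h with h1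
    · subst h1; simp at h; rw [← h]; exact EM_base (by linarith)
    · simp only at h
      split_ifs at h with h2
      rw [Option.map_eq_some_iff] at h
      obtain ⟨k', hk', rfl⟩ := h
      have hd : (A - A / C * C) * D - (B - A / C * D) * C = 1 := by linear_combination hdet
      have := ih h2 (by linear_combination hd) hk'
      have h3 := EM_T hC (EM_S h2 hC hd this) (A / C)
      simpa using h3

end

section

/-- inverse: 576 b b' ≡ -1 mod L -/
def iv (L e b : ℕ) : ℕ := (L - 576 * b % L) ^ e % L

def xx (L : ℕ) (b b' : ℕ) : ℤ := -((576 * b * b' + 1) / L : ℕ)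

def okA (l L e b : ℕ) : Prop := iv L e b < L ∧ iv L e b % l ≠ 0 ∧ iv L e (iv L e b) = b ∧
  (576 * b * iv L e b + 1) % L = 0 ∧
  (kf 300 (24 * b) (xx L b (iv L e b)) L (-24 * iv L e b)).any (fun k => k % 24 = 0) = true

instance (l L e b : ℕ) : Decidable (okA l L e b) := by unfold okA; infer_instance

/-- multiplier exponent for the middle terms -/
def kk (l e b : ℕ) : ℤ := (kf 300 (24 * b) (xx l b (iv l e b)) l (-24 * iv l e b)).getD 0

/-- middle sign -/
def ks (l e r b : ℕ) : ℤ := if (kk l e b * r) % 24 = 0 then 1 else -1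

def okM (l e r b : ℕ) : Prop := 0 < iv l e b ∧ iv l e b < l ∧ iv l e (iv l e b) = b ∧
  (576 * b * iv l e b + 1) % l = 0 ∧
  (kf 300 (24 * b) (xx l b (iv l e b)) l (-24 * iv l e b)) = some (kk l e b) ∧
  (kk l e b * r) % 12 = 0 ∧ ks l e r (iv l e b) = ks l e r b

instance (l e r b : ℕ) : Decidable (okM l e r b) := by unfold okM; infer_instance

lemma okA17 : ∀ b < 289, b % 17 ≠ 0 → okA 17 289 271 b := by decide +kernel
lemma okA7 : ∀ b < 49, b % 7 ≠ 0 → okA 7 49 41 b := by decide +kernel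
lemma okM17 : ∀ b < 17, b ≠ 0 → okM 17 15 19 b := by decide +kernel
lemma okM7 : ∀ b < 7, b ≠ 0 → okM 7 5 338 b := by decide +kernel
lemma ks7 : ∀ b < 7, b ≠ 0 → ks 7 5 338 b = -1 := by decide +kernel

end

section
open ModularForm

lemma zt_12 : zt ^ (12 : ℤ) = -1 := by
  rw [zt, ← ee_int_mul, ee, ← Complex.exp_pi_mul_I]; congr 1; push_cast; ring

lemma zt_24 : zt ^ (24 : ℤ) = 1 := by
  rw [show (24 : ℤ) = 12 + 12 by norm_num, zpow_add₀ zt_ne, zt_12]; norm_num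

lemma zt_of_mod {k : ℤ} (h : k % 24 = 0) : zt ^ k = 1 := by
  obtain ⟨m, rfl⟩ := Int.dvd_of_emod_eq_zero h
  rw [zpow_mul, zt_24, one_zpow]

lemma zt_ks {l e r b : ℕ} (h : (kk l e b * r) % 12 = 0) :
    zt ^ (kk l e b * r) = (ks l e r b : ℂ) := by
  unfold ks
  split_ifs with h1
  · rw [zt_of_mod h1]; simp
  · have : (kk l e b * r - 12) % 24 = 0 := by omega
    have h2 := zt_of_mod this
    rw [zpow_sub₀ zt_ne, zt_12] at h2
    push_cast
    rw [div_eq_one_iff_eq (by norm_num)] at h2; exact h2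

lemma ks_sq (l e r b : ℕ) : (ks l e r b : ℂ) * ks l e r b = 1 := by
  unfold ks; split_ifs <;> norm_num

noncomputable def sl (l : ℕ) : ℂ := ((Real.sqrt l : ℝ) : ℂ)

lemma sl_sq (l : ℕ) : sl l ^ 2 = l := by
  unfold sl; rw [← Complex.ofReal_pow, Real.sq_sqrt (by positivity)]; simp

lemma csqrt_mul (x : ℝ) (hx : 0 < x) {w : ℂ} (hw : 0 < w.im) :
    ((x ^ 2 : ℝ) * w : ℂ).sqrt = x * w.sqrt := by
  symm
  apply csqrt_unique
  · rw [Complex.im_ofReal_mul]; positivity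
  · rw [mul_pow, csqrt_sq]; push_cast; ring
  · rw [Complex.im_ofReal_mul]; exact mul_pos hx (csqrt_im hw)

/-- automorphy factor -/
noncomputable def jj (z : ℂ) : ℂ := (Complex.I.sqrt)⁻¹ * z.sqrt

noncomputable def HA (l L r : ℕ) (z : ℂ) : ℂ :=
  ∑ b ∈ (Finset.range L).filter (fun b => b % l ≠ 0), eta ((z + 24 * b) / L) ^ r
noncomputable def HB (l L r : ℕ) (z : ℂ) : ℂ :=
  ∑ b ∈ (Finset.range l).filter (fun b => b ≠ 0), eta ((z + 24 * (l * b)) / L) ^ r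
noncomputable def HC (l e r : ℕ) (z : ℂ) : ℂ :=
  ∑ b ∈ (Finset.range l).filter (fun b => b ≠ 0), (ks l e r b : ℂ) * eta (z + 24 * b / l) ^ r
noncomputable def Hf (l L e r : ℕ) (z : ℂ) : ℂ :=
  HA l L r z + HB l L r z + sl l ^ r * HC l e r z + eta (z / L) ^ r + l ^ r * eta (L * z) ^ r

lemma HA_S {l L e r : ℕ} (hl : 0 < l) (hL : L = l * l)
    (hA : ∀ b < L, b % l ≠ 0 → okA l L e b) {z : ℂ} (hz : 0 < z.im) :
    HA l L r (-1 / z) = jj z ^ r * HA l L r z := by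
  unfold HA
  rw [Finset.mul_sum]
  refine Finset.sum_nbij' (iv L e) (iv L e) ?_ ?_ ?_ ?_ ?_
  · intro b hb
    simp only [Finset.mem_filter, Finset.mem_range] at hb ⊢
    exact ⟨(hA b hb.1 hb.2).1, (hA b hb.1 hb.2).2.1⟩
  · intro b hb
    simp only [Finset.mem_filter, Finset.mem_range] at hb ⊢
    exact ⟨(hA b hb.1 hb.2).1, (hA b hb.1 hb.2).2.1⟩
  · intro b hb
    simp only [Finset.mem_filter, Finset.mem_range] at hb
    exact (hA b hb.1 hb.2).2.2.1
  · intro b hb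
    simp only [Finset.mem_filter, Finset.mem_range] at hb
    exact (hA b hb.1 hb.2).2.2.1
  · intro b hb
    simp only [Finset.mem_filter, Finset.mem_range] at hb
    obtain ⟨-, -, -, hdv, hk⟩ := hA b hb.1 hb.2
    have hL0 : 0 < L := by rw [hL]; positivity
    set b' := iv L e b
    obtain ⟨q, hq⟩ := Nat.dvd_of_mod_eq_zero hdv
    have hxx : xx L b b' = -q := by
      unfold xx; rw [hq, Nat.mul_div_cancel_left _ hL0]
    rw [Option.any_eq_true] at hk
    obtain ⟨k, hk1, hk2⟩ := hk
    have hqZ : (576 * b * b' + 1 : ℤ) = L * q := by exact_mod_cast hq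
    have hqC : (576 * b * b' + 1 : ℂ) = L * q := by exact_mod_cast hq
    have hem := EM_of_kf 300 (by exact_mod_cast hL0) (by rw [hxx]; linear_combination -hqZ) hk1
    have hLC : (L : ℂ) ≠ 0 := by exact_mod_cast hL0.ne'
    have hz0 := ne_of_im hz
    have hw : 0 < ((z + 24 * b') / L).im := by
      rw [Complex.div_natCast_im]; simp; positivity
    have h1 := hem _ hw
    rw [zt_of_mod (by simpa using hk2), hxx] at h1
    have e1 : ((L : ℤ) : ℂ) * ((z + 24 * b') / L) + ((-24 * b' : ℤ) : ℂ) = z := by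
      push_cast; field_simp; ring
    have e2 : ((24 * b : ℤ) : ℂ) * ((z + 24 * b') / L) + ((-q : ℤ) : ℂ) = (24 * b * z - 1) / L := by
      push_cast
      rw [eq_div_iff hLC]; rw [add_mul, mul_assoc, div_mul_cancel₀ _ hLC]; linear_combination hqC
    rw [e1, e2] at h1
    have e3 : (-1 / z + 24 * b) / L = (24 * b * z - 1) / L / z := by
      field_simp; ring
    rw [e3, h1, one_mul]
    unfold jj; ring

lemma HBC_S {l L e r : ℕ} (hl : 0 < l) (hL : L = l * l)
    (hM : ∀ b < l, b ≠ 0 → okM l e r b) {z : ℂ} (hz : 0 < z.im) :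
    HB l L r (-1 / z) = jj z ^ r * (sl l ^ r * HC l e r z) := by
  unfold HB HC
  rw [Finset.mul_sum, Finset.mul_sum]
  refine Finset.sum_nbij' (iv l e) (iv l e) ?_ ?_ ?_ ?_ ?_
  · intro b hb
    simp only [Finset.mem_filter, Finset.mem_range] at hb ⊢
    exact ⟨(hM b hb.1 hb.2).2.1, (hM b hb.1 hb.2).1.ne'⟩
  · intro b hb
    simp only [Finset.mem_filter, Finset.mem_range] at hb ⊢
    exact ⟨(hM b hb.1 hb.2).2.1, (hM b hb.1 hb.2).1.ne'⟩
  · intro b hb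
    simp only [Finset.mem_filter, Finset.mem_range] at hb
    exact (hM b hb.1 hb.2).2.2.1
  · intro b hb
    simp only [Finset.mem_filter, Finset.mem_range] at hb
    exact (hM b hb.1 hb.2).2.2.1
  · intro b hb
    simp only [Finset.mem_filter, Finset.mem_range] at hb
    obtain ⟨-, -, -, hdv, hk, hk12, hks⟩ := hM b hb.1 hb.2
    rw [hks, ← zt_ks hk12]
    set b' := iv l e b
    obtain ⟨q, hq⟩ := Nat.dvd_of_mod_eq_zero hdv
    have hxx : xx l b b' = -q := by
      unfold xx; rw [hq, Nat.mul_div_cancel_left _ hl]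
    have hqZ : (576 * b * b' + 1 : ℤ) = l * q := by exact_mod_cast hq
    have hqC : (576 * b * b' + 1 : ℂ) = l * q := by exact_mod_cast hq
    have hem := EM_of_kf 300 (by exact_mod_cast hl) (by rw [hxx]; linear_combination -hqZ) hk
    have hlC : (l : ℂ) ≠ 0 := by exact_mod_cast hl.ne'
    have hz0 := ne_of_im hz
    have hw : 0 < (z + 24 * b' / l).im := by
      have : (24 * b' / l : ℂ) = ((24 * b' / l : ℝ) : ℂ) := by push_cast; ring
      rw [Complex.add_im, this, Complex.ofReal_im, add_zero]; exact hz
    have h1 := hem _ hw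
    rw [hxx] at h1
    have e1 : ((l : ℤ) : ℂ) * (z + 24 * b' / l) + ((-24 * b' : ℤ) : ℂ) =
        ((Real.sqrt l ^ 2 : ℝ) : ℂ) * z := by
      rw [Real.sq_sqrt (by positivity)]; push_cast; field_simp; ring
    have e2 : ((24 * b : ℤ) : ℂ) * (z + 24 * b' / l) + ((-q : ℤ) : ℂ) = 24 * b * z - 1 / l := by
      push_cast
      field_simp; linear_combination hqC
    rw [e2, e1, csqrt_mul _ (Real.sqrt_pos.mpr (by exact_mod_cast hl)) hz] at h1
    have e3 : (-1 / z + 24 * (l * b)) / L = (24 * b * z - 1 / l) / (((Real.sqrt l ^ 2 : ℝ) : ℂ) * z) := by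
      rw [Real.sq_sqrt (by positivity), hL]; push_cast
      field_simp; ring
    rw [e3, h1, zpow_mul, zpow_natCast]
    unfold jj sl; ring

lemma HCB_S {l L e r : ℕ} (hl : 0 < l) (hL : L = l * l)
    (hM : ∀ b < l, b ≠ 0 → okM l e r b) {z : ℂ} (hz : 0 < z.im) :
    sl l ^ r * HC l e r (-1 / z) = jj z ^ r * HB l L r z := by
  unfold HB HC
  rw [Finset.mul_sum, Finset.mul_sum]
  refine Finset.sum_nbij' (iv l e) (iv l e) ?_ ?_ ?_ ?_ ?_
  · intro b hb
    simp only [Finset.mem_filter, Finset.mem_range] at hb ⊢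
    exact ⟨(hM b hb.1 hb.2).2.1, (hM b hb.1 hb.2).1.ne'⟩
  · intro b hb
    simp only [Finset.mem_filter, Finset.mem_range] at hb ⊢
    exact ⟨(hM b hb.1 hb.2).2.1, (hM b hb.1 hb.2).1.ne'⟩
  · intro b hb
    simp only [Finset.mem_filter, Finset.mem_range] at hb
    exact (hM b hb.1 hb.2).2.2.1
  · intro b hb
    simp only [Finset.mem_filter, Finset.mem_range] at hb
    exact (hM b hb.1 hb.2).2.2.1
  · intro b hb
    simp only [Finset.mem_filter, Finset.mem_range] at hb
    obtain ⟨-, -, -, hdv, hk, hk12, hks⟩ := hM b hb.1 hb.2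
    have hsq := ks_sq l e r b
    set b' := iv l e b
    obtain ⟨q, hq⟩ := Nat.dvd_of_mod_eq_zero hdv
    have hxx : xx l b b' = -q := by
      unfold xx; rw [hq, Nat.mul_div_cancel_left _ hl]
    have hqZ : (576 * b * b' + 1 : ℤ) = l * q := by exact_mod_cast hq
    have hqC : (576 * b * b' + 1 : ℂ) = l * q := by exact_mod_cast hq
    have hem := EM_of_kf 300 (by exact_mod_cast hl) (by rw [hxx]; linear_combination -hqZ) hk
    have hlC : (l : ℂ) ≠ 0 := by exact_mod_cast hl.ne'
    have hz0 := ne_of_im hz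
    have hw : 0 < ((z + 24 * (l * b')) / L).im := by
      rw [Complex.div_natCast_im]; simp; rw [hL]; positivity
    have h1 := hem _ hw
    rw [hxx] at h1
    have hs2 : (Real.sqrt l)⁻¹ ^ 2 = (l : ℝ)⁻¹ := by
      rw [inv_pow, Real.sq_sqrt (by positivity)]
    have e1 : ((l : ℤ) : ℂ) * ((z + 24 * (l * b')) / L) + ((-24 * b' : ℤ) : ℂ) =
        (((Real.sqrt l)⁻¹ ^ 2 : ℝ) : ℂ) * z := by
      rw [hs2, hL]; push_cast; field_simp; ring
    have e2 : ((24 * b : ℤ) : ℂ) * ((z + 24 * (l * b')) / L) + ((-q : ℤ) : ℂ) =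
        24 * b * z / L - 1 / l := by
      push_cast; rw [hL]; push_cast
      field_simp; linear_combination l * hqC
    have hsp : 0 < Real.sqrt l := Real.sqrt_pos.mpr (by exact_mod_cast hl)
    rw [e2, e1, csqrt_mul _ (inv_pos.mpr hsp) hz] at h1
    have e3 : (-1 / z + 24 * b / l) = (24 * b * z / L - 1 / l) /
        ((((Real.sqrt l)⁻¹ ^ 2 : ℝ) : ℂ) * z) := by
      rw [hs2, hL]; push_cast
      field_simp; ring
    have hsl : sl l ≠ 0 := by unfold sl; exact_mod_cast hsp.ne'
    have e4 : (((Real.sqrt l)⁻¹ : ℝ) : ℂ) = (sl l)⁻¹ := by unfold sl; push_cast; rfl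
    rw [e3, h1, e4]
    simp only [mul_pow]
    rw [← zpow_natCast (zt ^ _), ← zpow_mul, zt_ks hk12]
    unfold jj
    rw [mul_pow, inv_pow (sl l)]
    have hslr : sl l ^ r ≠ 0 := pow_ne_zero _ hsl
    generalize (ks l e r b : ℂ) = κ at *
    generalize sl l ^ r = s at *
    generalize eta ((z + 24 * (l * b')) / L) = E at *
    field_simp
    linear_combination (Complex.sqrt z ^ r) * (Complex.I.sqrt)⁻¹ ^ r *
      E ^ r * hsq

lemma Hf_S {l L e1 e r : ℕ} (hl : 0 < l) (hL : L = l * l)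
    (hA : ∀ b < L, b % l ≠ 0 → okA l L e1 b)
    (hM : ∀ b < l, b ≠ 0 → okM l e r b) {z : ℂ} (hz : 0 < z.im) :
    Hf l L e r (-1 / z) = jj z ^ r * Hf l L e r z := by
  unfold Hf
  rw [HA_S hl hL hA hz, HBC_S hl hL hM hz, HCB_S hl hL hM hz]
  have hlC : (l : ℂ) ≠ 0 := by exact_mod_cast hl.ne'
  have hlR : (0 : ℝ) < l := by exact_mod_cast hl
  have hz0 := ne_of_im hz
  have e1 : -1 / z / L = -1 / (((l : ℝ) ^ 2 : ℝ) * z) := by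
    rw [hL]; push_cast; field_simp
  have e2 : L * (-1 / z) = -1 / ((((l : ℝ)⁻¹) ^ 2 : ℝ) * z) := by
    rw [hL]; push_cast; field_simp
  have e3 : ((((l : ℝ)⁻¹) ^ 2 : ℝ) * z) = z / L := by
    rw [hL]; push_cast; field_simp
  have e4 : (((l : ℝ) ^ 2 : ℝ) * z) = L * z := by
    rw [hL]; push_cast; ring
  rw [e1, e2, eta_S, eta_S, csqrt_mul _ hlR hz, csqrt_mul _ (inv_pos.mpr hlR) hz, e3, e4]
  · unfold jj
    have : (l : ℂ) ^ r * ((l : ℂ)⁻¹) ^ r = 1 := by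
      rw [← mul_pow, mul_inv_cancel₀ hlC, one_pow]
    push_cast
    simp only [mul_pow]
    linear_combination (Complex.I.sqrt)⁻¹ ^ r * (Complex.sqrt z) ^ r * eta (z / L) ^ r * this
  · rw [Complex.im_ofReal_mul]; positivity
  · rw [Complex.im_ofReal_mul]; positivity

end

section
open ModularForm PowerSeries

def PRep (c : PowerSeries ℂ) (f : ℂ → ℂ) : Prop :=
  ∀ x : ℂ, ‖x‖ < 1 → HasSum (fun m ↦ coeff m c * x ^ m) (f x)

lemma hs_congr {f g : ℕ → ℂ} {a : ℂ} (h : HasSum f a) (e : ∀ n, g n = f n) : HasSum g a := by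
  have : g = f := funext e
  rw [this]; exact h

lemma PRep.mul {c d : PowerSeries ℂ} {f g : ℂ → ℂ} (hc : PRep c f) (hd : PRep d g) :
    PRep (c * d) (fun x ↦ f x * g x) := by
  intro x hx
  have h1 := hc x hx
  have h2 := hd x hx
  have n1 := h1.summable.norm
  have n2 := h2.summable.norm
  have h3 := (summable_norm_sum_mul_antidiagonal_of_summable_norm n1 n2).of_norm.hasSum
  rw [← tsum_mul_tsum_eq_tsum_sum_antidiagonal_of_summable_norm n1 n2, h1.tsum_eq, h2.tsum_eq] at h3
  refine hs_congr (h3) fun m ↦ ?_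
  rw [coeff_mul, Finset.sum_mul]
  refine Finset.sum_congr rfl fun p hp ↦ ?_
  rw [← Finset.HasAntidiagonal.mem_antidiagonal.mp hp, pow_add]; ring

lemma PRep.one : PRep 1 (fun _ ↦ 1) := by
  intro x hx
  refine hs_congr (hasSum_ite_eq (0 : ℕ) (1 : ℂ)) fun m ↦ ?_
  rw [coeff_one]
  split_ifs with h
  · simp [h]
  · simp

lemma PRep.pow {c : PowerSeries ℂ} {f : ℂ → ℂ} (hc : PRep c f) (r : ℕ) :
    PRep (c ^ r) (fun x ↦ f x ^ r) := by
  induction r with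
  | zero => simpa using PRep.one
  | succ r ih => simpa [pow_succ] using ih.mul hc

lemma prep_Eu : PRep (pentagonalSeries ℂ) Eu := fun _ hx ↦ hasSum_pent hx

lemma map_pent {R S : Type*} [CommRing R] [CommRing S] (f : R →+* S) :
    PowerSeries.map f (pentagonalSeries R) = pentagonalSeries S := by
  ext n
  rw [coeff_map]
  by_cases h : n ∈ Set.range pentagonal
  · obtain ⟨k, rfl⟩ := h
    rw [coeff_pentagonalSeries_pentagonal, coeff_pentagonalSeries_pentagonal]
    simp
  · rw [coeff_pentagonalSeries_eq_zero R h, coeff_pentagonalSeries_eq_zero S h, map_zero]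

noncomputable def aZ (r n : ℕ) : ℤ := coeff n (pentagonalSeries ℤ ^ r)

lemma coeff_pent_pow (r n : ℕ) : coeff n (pentagonalSeries ℂ ^ r) = (aZ r n : ℂ) := by
  rw [← map_pent (Int.castRingHom ℂ), ← map_pow, coeff_map]; rfl

lemma eta_pow_hasSum (r : ℕ) {z : ℂ} (hz : 0 < z.im) :
    HasSum (fun n : ℕ ↦ (aZ r n : ℂ) * ee ((24 * n + r : ℕ) * (z / 24))) (eta z ^ r) := by
  have h := (prep_Eu.pow r) (ee z) (norm_ee_lt hz)
  have h2 := h.mul_left (ee (z / 24) ^ r)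
  rw [eta_eq, mul_pow]
  refine hs_congr (h2) fun n ↦ ?_
  rw [coeff_pent_pow, ← ee_nat_mul, ← ee_nat_mul, mul_left_comm, ← ee_add]
  congr 2; push_cast; ring

lemma sum_ee {L : ℕ} (hL : 0 < L) (N : ℕ) :
    ∑ b ∈ Finset.range L, ee (N * (b / L)) = if L ∣ N then (L : ℂ) else 0 := by
  have hp : IsPrimitiveRoot (ee (1 / L)) L := by
    have := Complex.isPrimitiveRoot_exp L hL.ne'
    rwa [show ee (1 / L) = Complex.exp (2 * Real.pi * Complex.I / L) by rw [ee]; congr 1; ring]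
  have h1 : ∀ b ∈ Finset.range L, ee (N * (b / L)) = (ee (1 / L) ^ N) ^ b := by
    intro b _
    rw [← ee_nat_mul, ← ee_nat_mul]; congr 1; ring
  rw [Finset.sum_congr rfl h1]
  split_ifs with h
  · rw [(hp.pow_eq_one_iff_dvd N).mpr h]; simp
  · have hne : ee (1 / L) ^ N ≠ 1 := fun h' ↦ h ((hp.pow_eq_one_iff_dvd N).mp h')
    rw [geom_sum_eq hne, ← pow_mul, mul_comm, pow_mul, hp.pow_eq_one]; simp

lemma H_join (l L r : ℕ) (hl : 0 < l) (hL : L = l * l) (z : ℂ) :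
    HA l L r z + HB l L r z + eta (z / L) ^ r =
      ∑ b ∈ Finset.range L, eta ((z + 24 * b) / L) ^ r := by
  rw [← Finset.sum_filter_add_sum_filter_not (Finset.range L) (fun b => b % l ≠ 0)]
  unfold HA HB
  rw [add_assoc]
  congr 1
  have : (Finset.range L).filter (fun b => ¬ b % l ≠ 0) = (Finset.range l).image (fun b => l * b) := by
    ext b
    simp only [Finset.mem_filter, Finset.mem_range, Finset.mem_image, not_not]
    constructor
    · rintro ⟨h1, h2⟩
      obtain ⟨q, rfl⟩ := Nat.dvd_of_mod_eq_zero h2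
      exact ⟨q, by rw [hL] at h1; exact Nat.lt_of_mul_lt_mul_left h1, rfl⟩
    · rintro ⟨q, h1, rfl⟩
      exact ⟨by rw [hL]; exact Nat.mul_lt_mul_of_pos_left h1 hl, by simp⟩
  rw [this, Finset.sum_image (fun a _ b _ h ↦ Nat.eq_of_mul_eq_mul_left hl h),
    ← Finset.sum_filter_add_sum_filter_not (Finset.range l) (fun b => b ≠ 0)]
  congr 1
  · simp
  · have : (Finset.range l).filter (fun b => ¬ b ≠ 0) = {0} := by
      ext b; simp only [Finset.mem_filter, Finset.mem_range, Finset.mem_singleton]; omega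
    rw [this]; simp

noncomputable def gg (l e r n : ℕ) : ℂ :=
  ∑ b ∈ (Finset.range l).filter (fun b => b ≠ 0), (ks l e r b : ℂ) * ee ((24 * n + r : ℕ) * (b / l))

noncomputable def Kc (l L e r t s u m : ℕ) : ℂ :=
  L * aZ r (L * m + s) + sl l ^ r * (if t ≤ m then aZ r (m - t) * gg l e r (m - t) else 0)
    + l ^ r * (if u ≤ m ∧ L ∣ m - u then aZ r ((m - u) / L) else 0 : ℤ)

lemma Hf_hasSum {l L e r r0 t s u : ℕ} (hl : 0 < l) (hL : L = l * l) (hr : r = r0 + 24 * t)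
    (hs : 24 * s + r = L * r0) (hsL : s < L) (hu : L * r = 24 * u + r0) (hco : L.Coprime 24)
    {z : ℂ} (hz : 0 < z.im) :
    HasSum (fun m ↦ Kc l L e r t s u m * ee z ^ m * ee (r0 * (z / 24))) (Hf l L e r z) := by
  have hL0 : 0 < L := by rw [hL]; positivity
  have hlC : (l : ℂ) ≠ 0 := by exact_mod_cast hl.ne'
  have hLC : (L : ℂ) ≠ 0 := by exact_mod_cast hL0.ne'
  have hHf : Hf l L e r z = ∑ b ∈ Finset.range L, eta ((z + 24 * b) / L) ^ r +
      sl l ^ r * HC l e r z + l ^ r * eta (L * z) ^ r := by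
    rw [← H_join l L r hl hL]; unfold Hf; ring
  have p1 : HasSum (fun m ↦ (L : ℂ) * aZ r (L * m + s) * (ee z ^ m * ee (r0 * (z / 24))))
      (∑ b ∈ Finset.range L, eta ((z + 24 * b) / L) ^ r) := by
    have h1 : ∀ b ∈ Finset.range L, HasSum (fun n : ℕ ↦ (aZ r n : ℂ) *
        (ee ((24 * n + r : ℕ) * (z / (24 * L))) * ee ((24 * n + r : ℕ) * (b / L))))
        (eta ((z + 24 * b) / L) ^ r) := by
      intro b _
      have := eta_pow_hasSum r (z := (z + 24 * b) / L) (by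
        rw [Complex.div_natCast_im]; simp; positivity)
      refine hs_congr (this) fun n ↦ ?_
      rw [← ee_add]; congr 2; field_simp
    have h2 := hasSum_sum h1
    simp_rw [← Finset.mul_sum, sum_ee hL0] at h2
    rw [← Function.Injective.hasSum_iff (g := fun m ↦ L * m + s)] at h2
    · refine hs_congr (h2) fun m ↦ ?_
      simp only [Function.comp_apply]
      have hd : 24 * (L * m + s) + r = L * (24 * m + r0) := by rw [mul_add, mul_add, ← hs]; ring
      rw [hd, if_pos (dvd_mul_right _ _), ← ee_nat_mul, ← ee_add]
      have : (m * z + r0 * (z / 24) : ℂ) = (L * (24 * m + r0) : ℕ) * (z / (24 * L)) := by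
        push_cast; field_simp
      rw [this]; ring
    · intro a b h
      simpa [hL0.ne'] using h
    · intro n hn
      rw [if_neg, mul_zero, mul_zero]
      intro hdv
      apply hn
      have h3 : (L : ℤ) ∣ 24 * ((n : ℤ) - s) := by
        have h4 : (L : ℤ) ∣ ((24 * n + r : ℕ) : ℤ) := by exact_mod_cast hdv
        have h5 : (L : ℤ) ∣ ((24 * s + r : ℕ) : ℤ) := by exact_mod_cast Dvd.intro r0 hs.symm
        have := dvd_sub h4 h5
        push_cast at this
        rwa [show (24 * n + r - (24 * s + r) : ℤ) = 24 * (n - s) by ring] at this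
      have h6 : (L : ℤ) ∣ (n : ℤ) - s :=
        IsCoprime.dvd_of_dvd_mul_left (by exact_mod_cast Nat.isCoprime_iff_coprime.mpr hco) h3
      have hmod : s ≡ n [MOD L] := by
        exact (Nat.modEq_iff_dvd).mpr h6
      refine ⟨n / L, ?_⟩
      have : n % L = s := by rw [← hmod, Nat.mod_eq_of_lt hsL]
      simp only
      rw [← this]; exact Nat.div_add_mod n L
  have p2 : HasSum (fun m ↦ (if t ≤ m then aZ r (m - t) * gg l e r (m - t) else 0) *
      (ee z ^ m * ee (r0 * (z / 24)))) (HC l e r z) := by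
    have h1 : ∀ b ∈ (Finset.range l).filter (fun b => b ≠ 0), HasSum (fun n : ℕ ↦
        (ks l e r b : ℂ) * ((aZ r n : ℂ) *
        (ee ((24 * n + r : ℕ) * (z / 24)) * ee ((24 * n + r : ℕ) * (b / l)))))
        ((ks l e r b : ℂ) * eta (z + 24 * b / l) ^ r) := by
      intro b _
      refine HasSum.mul_left _ ?_
      have := eta_pow_hasSum r (z := z + 24 * b / l) (by
        have : (24 * b / l : ℂ) = ((24 * b / l : ℝ) : ℂ) := by push_cast; ring
        rw [Complex.add_im, this, Complex.ofReal_im, add_zero]; exact hz)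
      refine hs_congr (this) fun n ↦ ?_
      rw [← ee_add]; congr 2; field_simp
    have h2 := hasSum_sum h1
    unfold HC
    rw [← Function.Injective.hasSum_iff (g := fun m : ℕ ↦ m + t)]
    · refine hs_congr (h2) fun n ↦ ?_
      simp only [Function.comp_apply]
      rw [if_pos (by omega), Nat.add_sub_cancel, gg, Finset.mul_sum, Finset.sum_mul, ← ee_nat_mul,
        ← ee_add]
      refine Finset.sum_congr rfl fun b _ ↦ ?_
      have : (((n + t : ℕ) : ℂ) * z + r0 * (z / 24) : ℂ) = (24 * n + r : ℕ) * (z / 24) := by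
        rw [hr]; push_cast; ring
      rw [this]; ring
    · intro a b h; simpa using h
    · intro m hm
      rw [if_neg, zero_mul]
      intro h; exact hm ⟨m - t, by simp; omega⟩
  have p3 : HasSum (fun m ↦ (((if u ≤ m ∧ L ∣ m - u then aZ r ((m - u) / L) else 0 : ℤ)) : ℂ) *
      (ee z ^ m * ee (r0 * (z / 24)))) (eta (L * z) ^ r) := by
    rw [← Function.Injective.hasSum_iff (g := fun m : ℕ ↦ L * m + u)]
    · have := eta_pow_hasSum r (z := L * z) (by
        rw [← Complex.ofReal_natCast, Complex.im_ofReal_mul]; positivity)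
      refine hs_congr (this) fun n ↦ ?_
      simp only [Function.comp_apply]
      rw [if_pos ⟨by omega, by simp⟩, Nat.add_sub_cancel, Nat.mul_div_cancel_left _ hL0,
        ← ee_nat_mul, ← ee_add]
      congr 2
      have hu' : (L * r : ℂ) = 24 * u + r0 := by exact_mod_cast hu
      push_cast
      linear_combination -(z / 24) * hu'
    · intro a b h; simpa [hL0.ne'] using h
    · intro m hm
      rw [if_neg, Int.cast_zero, zero_mul]
      rintro ⟨h1, q, hq⟩; exact hm ⟨q, by simp only; omega⟩
  rw [hHf]
  refine hs_congr ((p1.add (p2.mul_left (sl l ^ r))).add (p3.mul_left ((l : ℂ) ^ r))) fun m ↦ ?_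
  unfold Kc; ring

end

section
open ModularForm PowerSeries

open Function Complex SlashInvariantForm MatrixGroups Filter UpperHalfPlane in
lemma mkMF (k : ℕ) (F : ℂ → ℂ) (hd : ∀ z : ℂ, 0 < z.im → DifferentiableAt ℂ F z)
    (hT : ∀ z : ℂ, 0 < z.im → F (z + 1) = F z)
    (hS : ∀ z : ℂ, 0 < z.im → F (-1 / z) = z ^ k * F z)
    (hb : IsBoundedAtImInfty (fun τ : ℍ ↦ F τ)) :
    ∃ f : ModularForm 𝒮ℒ (k : ℤ), ∀ τ : ℍ, f τ = F τ := by
  set G : ℍ → ℂ := fun τ ↦ F τ with hG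
  have h1 : (G ∣[(k : ℤ)] ModularGroup.S) = G := by
    ext z
    suffices F (-(↑z)⁻¹) * ((z : ℂ) ^ k)⁻¹ = F z by
      rw [SL_slash_apply, UpperHalfPlane.modular_S_smul, ModularGroup.denom_S]
      simpa [hG] using this
    have h := hS z z.2
    rw [neg_div, one_div] at h
    rw [h]
    have := pow_ne_zero k z.ne_zero
    field_simp
  have h2 : (G ∣[(k : ℤ)] ModularGroup.T) = G := by
    ext z
    rw [SL_slash_apply, modular_T_smul, ModularGroup.denom_apply]
    have h := hT z z.2
    have a1 : (ModularGroup.T 1 0 : ℤ) = 0 := by simp [ModularGroup.T]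
    have a2 : (ModularGroup.T 1 1 : ℤ) = 1 := by simp [ModularGroup.T]
    rw [a1, a2]
    simp [hG]
    rw [← h, add_comm]
  refine ⟨{ toFun := G
            slash_action_eq' := ?_
            holo' := ?_
            bdd_at_cusps' := ?_ }, fun τ ↦ rfl⟩
  · intro A hA
    obtain ⟨A, rfl⟩ := hA
    exact SlashInvariantForm.slash_action_generators_SL2Z h1 h2 A
  · rw [UpperHalfPlane.mdifferentiable_iff]
    have : DifferentiableOn ℂ F {z | 0 < z.im} := fun z hz ↦ (hd z hz).differentiableWithinAt
    refine this.congr fun z hz ↦ ?_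
    simp [hG, ofComplex_apply_of_im_pos hz]
  · intro c hc
    rw [Subgroup.IsArithmetic.isCusp_iff_isCusp_SL2Z] at hc
    rw [OnePoint.isBoundedAt_iff_forall_SL2Z hc]
    intro γ _
    rw [SlashInvariantForm.slash_action_generators_SL2Z h1 h2 γ]
    exact hb

lemma mul_hs {c d : PowerSeries ℂ} {x A B : ℂ}
    (h1 : HasSum (fun m ↦ coeff m c * x ^ m) A) (h2 : HasSum (fun m ↦ coeff m d * x ^ m) B) :
    HasSum (fun m ↦ coeff m (c * d) * x ^ m) (A * B) := by
  have n1 := h1.summable.norm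
  have n2 := h2.summable.norm
  have h3 := (summable_norm_sum_mul_antidiagonal_of_summable_norm n1 n2).of_norm.hasSum
  rw [← tsum_mul_tsum_eq_tsum_sum_antidiagonal_of_summable_norm n1 n2, h1.tsum_eq, h2.tsum_eq] at h3
  refine hs_congr (h3) fun m ↦ ?_
  rw [coeff_mul, Finset.sum_mul]
  refine Finset.sum_congr rfl fun p hp ↦ ?_
  rw [← Finset.HasAntidiagonal.mem_antidiagonal.mp hp, pow_add]; ring

open MatrixGroups UpperHalfPlane in
lemma hs_unique (c d : ℕ → ℂ) (a : ℂ → ℂ)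
    (h1 : ∀ z : ℂ, 0 < z.im → HasSum (fun m ↦ c m * ee z ^ m) (a z))
    (h2 : ∀ z : ℂ, 0 < z.im → HasSum (fun m ↦ d m * ee z ^ m) (a z)) (m : ℕ) : c m = d m := by
  have h := ModularFormClass.qExpansion_coeff_unique (Γ := 𝒮ℒ) (k := 0) (h := 1)
    (f := (0 : ModularForm 𝒮ℒ 0)) (c := fun m ↦ c m - d m) one_pos one_mem_strictPeriods_SL
    (fun τ ↦ by
      have h3 := (h1 τ τ.2).sub (h2 τ τ.2)
      rw [sub_self] at h3
      refine hs_congr h3 fun n ↦ ?_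
      rw [qParam_eq_ee, smul_eq_mul]; ring) m
  have h0 : qExpansion 1 (⇑(0 : ModularForm 𝒮ℒ 0)) = 0 := qExpansion_zero 1
  rw [h0] at h
  simpa [sub_eq_zero] using h

open Filter Topology in
lemma Eu_tendsto : Tendsto Eu (𝓝 0) (𝓝 1) := by
  have := tendsto_tprod_one_add_of_dominated_convergence (𝓕 := 𝓝 0) (g := 0)
    (f := fun (q : ℂ) (n : ℕ) ↦ -q ^ (n + 1)) (bound := fun n ↦ (1 / 2 : ℝ) ^ (n + 1))
  simp only [Pi.zero_apply, norm_neg, norm_pow, add_zero, tprod_one] at this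
  unfold Eu
  simp_rw [sub_eq_add_neg]
  refine this
    (by simpa only [pow_succ'] using (summable_geometric_of_abs_lt_one (by norm_num)).mul_left _)
    (fun k ↦ by simpa using ((continuous_pow (M := ℂ) (k + 1)).tendsto 0).neg) ?_
  filter_upwards [Metric.ball_mem_nhds (0 : ℂ) (by norm_num : (0 : ℝ) < 1 / 2)] with q hq k
  exact pow_le_pow_left₀ (norm_nonneg _) (mem_ball_zero_iff.mp hq).le _

lemma Eu_ne {z : ℂ} (hz : 0 < z.im) : Eu (ee z) ≠ 0 := by
  have := eta_ne_zero hz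
  rw [eta_eq] at this
  exact right_ne_zero_of_mul this

lemma ee_add_one (z : ℂ) : ee (z + 1) = ee z := by rw [ee_add, ee_one, mul_one]

lemma jj_pow24 {z : ℂ} : jj z ^ 24 = z ^ 12 := by
  unfold jj
  have h1 : (Complex.I.sqrt) ^ 24 = 1 := by
    rw [show (24 : ℕ) = 2 * 12 by norm_num, pow_mul, csqrt_sq, show (12 : ℕ) = 4 * 3 by norm_num,
      pow_mul, Complex.I_pow_four, one_pow]
  rw [mul_pow, inv_pow, h1, show (24 : ℕ) = 2 * 12 by norm_num, pow_mul z.sqrt, csqrt_sq]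
  simp

lemma eta_comp_diff {g : ℂ → ℂ} {z : ℂ} (r : ℕ) (hg : DifferentiableAt ℂ g z)
    (hi : 0 < (g z).im) : DifferentiableAt ℂ (fun z ↦ eta (g z) ^ r) z :=
  (DifferentiableAt.comp (g := eta) z (differentiableAt_eta_of_mem_upperHalfPlaneSet hi) hg).pow r

lemma Hf_diff {l L e r : ℕ} (hL : 0 < L) {z : ℂ} (hz : 0 < z.im) :
    DifferentiableAt ℂ (Hf l L e r) z := by
  have hL' : (0 : ℝ) < L := by exact_mod_cast hL
  unfold Hf HA HB HC
  refine ((((DifferentiableAt.add ?_ ?_).add ?_).add ?_).add ?_)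
  · refine DifferentiableAt.fun_sum fun b _ ↦ eta_comp_diff _ (by fun_prop) ?_
    rw [Complex.div_natCast_im]
    have : (z + 24 * (b : ℂ)).im = z.im := by simp
    rw [this]; positivity
  · refine DifferentiableAt.fun_sum fun b _ ↦ eta_comp_diff _ (by fun_prop) ?_
    rw [Complex.div_natCast_im]
    have : (z + 24 * ((l : ℂ) * (b : ℂ))).im = z.im := by simp
    rw [this]; positivity
  · refine DifferentiableAt.const_mul (DifferentiableAt.fun_sum fun b _ ↦ 
      DifferentiableAt.const_mul (eta_comp_diff _ (by fun_prop) ?_) _) _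
    have : (z + 24 * (b : ℂ) / (l : ℂ)).im = z.im := by
      rw [Complex.add_im, Complex.div_natCast_im]; simp
    rw [this]; exact hz
  · refine eta_comp_diff _ (by fun_prop) ?_
    rw [Complex.div_natCast_im]; positivity
  · refine DifferentiableAt.const_mul (eta_comp_diff _ (by fun_prop) ?_) _
    have : ((L : ℂ) * z).im = L * z.im := by simp
    rw [this]; positivity

open UpperHalfPlane MatrixGroups Filter in
lemma exists_G {l L e e1 r r0 t s u : ℕ} (hl : 0 < l) (hL : L = l * l)
    (hA : ∀ b < L, b % l ≠ 0 → okA l L e1 b) (hM : ∀ b < l, b ≠ 0 → okM l e r b)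
    (hr : r = r0 + 24 * t) (hs : 24 * s + r = L * r0) (hsL : s < L) (hu : L * r = 24 * u + r0)
    (hco : L.Coprime 24) :
    ∃ f : ModularForm 𝒮ℒ ((12 * t : ℕ) : ℤ),
      qExpansion 1 f * pentagonalSeries ℂ ^ r0 = PowerSeries.mk (Kc l L e r t s u) := by
  set F : ℂ → ℂ := fun z ↦ Hf l L e r z / eta z ^ r0 with hF
  have hsum : ∀ z : ℂ, 0 < z.im →
      HasSum (fun m ↦ Kc l L e r t s u m * ee z ^ m) (F z * Eu (ee z) ^ r0) := by
    intro z hz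
    have h := (Hf_hasSum (e := e) hl hL hr hs hsL hu hco hz).mul_right (ee (r0 * (z / 24)))⁻¹
    have e0 : ee (r0 * (z / 24)) ≠ 0 := ee_ne _
    have e1 : Hf l L e r z * (ee (r0 * (z / 24)))⁻¹ = F z * Eu (ee z) ^ r0 := by
      have := Eu_ne hz
      have h2 := ee_ne (z / 24)
      rw [hF, ee_nat_mul]
      simp only [eta_eq, mul_pow]
      field_simp
    rw [e1] at h
    refine hs_congr h fun m ↦ ?_
    rw [mul_assoc _ (ee (r0 * (z / 24))), mul_inv_cancel₀ e0, mul_one]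
  obtain ⟨f, hf⟩ := mkMF (12 * t) F
    (fun z hz ↦ (Hf_diff (by rw [hL]; positivity) hz).div ((differentiableAt_eta_of_mem_upperHalfPlaneSet hz).pow _)
      (pow_ne_zero _ (eta_ne_zero hz)))
    (fun z hz ↦ by
      have hz1 : 0 < (z + 1).im := by simpa using hz
      have a := hsum z hz
      have b := hsum (z + 1) hz1
      rw [ee_add_one] at b
      exact mul_right_cancel₀ (pow_ne_zero _ (Eu_ne hz)) (b.unique a))
    (fun z hz ↦ by
      have h1 := Hf_S (e := e) (r := r) hl hL hA hM hz
      have h2 : eta (-1 / z) = jj z * eta z := eta_S hz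
      have hj : jj z ≠ 0 := by
        intro h0
        have h3 := jj_pow24 (z := z)
        rw [h0] at h3
        exact pow_ne_zero 12 (ne_of_im hz) (by rw [← h3]; simp)
      have he := eta_ne_zero hz
      simp only [hF]
      rw [h1, h2, hr, pow_add, pow_mul, jj_pow24, ← pow_mul, mul_pow]
      field_simp)
    (by
      have hq : Tendsto (fun τ : ℍ ↦ Eu (ee τ) ^ r0) atImInfty (nhds (1 ^ r0)) := by
        refine (Eu_tendsto.comp ?_).pow r0
        have := UpperHalfPlane.qParam_tendsto_atImInfty (h := 1) zero_lt_one
        simpa only [qParam_eq_ee] using this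
      have hq2 := hq.inv₀ (by simp)
      have hb1 : BoundedAtFilter atImInfty (fun τ : ℍ ↦ (Eu (ee τ) ^ r0)⁻¹) := hq2.isBigO_one ℝ
      have hb2 : BoundedAtFilter atImInfty (fun τ : ℍ ↦ F τ * Eu (ee τ) ^ r0) :=
        UpperHalfPlane.isBoundedAtImInfty_of_hasSum_qExpansion (h := 1) one_pos
          (c := Kc l L e r t s u) (fun τ ↦ by
            simpa only [qParam_eq_ee, smul_eq_mul] using hsum τ τ.2)
      have h3 := hb2.mul hb1
      refine h3.congr (fun τ ↦ ?_) fun _ ↦ rfl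
      have := pow_ne_zero r0 (Eu_ne τ.2)
      simp only [Pi.mul_apply]
      exact mul_inv_cancel_right₀ this _)
  refine ⟨f, ?_⟩
  ext m
  rw [coeff_mk]
  refine hs_unique (fun m ↦ coeff m (qExpansion 1 f * pentagonalSeries ℂ ^ r0)) _ _
    (fun z hz ↦ ?_) hsum m
  have h1 := ModularForm.hasSum_qExpansion (h := 1) f one_pos one_mem_strictPeriods_SL ⟨z, hz⟩
  rw [hf] at h1
  simp only [qParam_eq_ee] at h1
  exact mul_hs h1 (prep_Eu.pow r0 _ (norm_ee_lt hz))

end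

section
open ModularForm PowerSeries

lemma gg17_const {m : ℕ} (h : 17 ∣ 24 * m + 19) : gg 17 15 19 m =
    ∑ b ∈ (Finset.range 17).filter (fun b ↦ b ≠ 0), (ks 17 15 19 b : ℂ) := by
  unfold gg
  refine Finset.sum_congr rfl fun b _ ↦ ?_
  obtain ⟨c, hc⟩ := h
  have : (((24 * m + 19 : ℕ) : ℂ) * ((b : ℂ) / (17 : ℕ))) = ((c * b : ℕ) : ℂ) := by
    rw [hc]; push_cast; field_simp
  rw [this, ee_nat, mul_one]

open UpperHalfPlane MatrixGroups in
lemma K17 : ∃ C : ℂ, ∀ m, Kc 17 289 15 19 0 228 228 m = C * (aZ 19 m : ℂ) := by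
  obtain ⟨f, hf⟩ := exists_G (l := 17) (L := 289) (e := 15) (e1 := 271) (r := 19) (r0 := 19)
    (t := 0) (s := 228) (u := 228) (by norm_num) (by norm_num) okA17 okM17 (by norm_num)
    (by norm_num) (by norm_num) (by norm_num) (by norm_num)
  obtain ⟨C, hC⟩ := ModularFormClass.levelOne_weight_zero_const (F := ModularForm 𝒮ℒ 0) f
  refine ⟨C, fun m ↦ ?_⟩
  have h1 : qExpansion 1 f = PowerSeries.C C := by
    ext m
    refine (ModularFormClass.qExpansion_coeff_unique (Γ := 𝒮ℒ) (k := 0) (h := 1)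
      (f := (f : ModularForm 𝒮ℒ 0)) (c := fun m ↦ coeff m (PowerSeries.C C)) one_pos one_mem_strictPeriods_SL (fun τ ↦ ?_) m).symm
    rw [show f τ = C from congrFun hC τ]
    refine hs_congr (hasSum_ite_eq (0 : ℕ) (C : ℂ)) fun m ↦ ?_
    rw [coeff_C]
    split_ifs with h
    · simp [h]
    · simp
  rw [h1] at hf
  have := congrArg (coeff m) hf
  rw [coeff_mk, coeff_C_mul, coeff_pent_pow] at this
  exact this.symm

lemma rec17 {m : ℕ} (h : 17 ∣ 24 * m + 19) :
    aZ 19 7 * (289 * aZ 19 (289 * m + 228) +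
      17 ^ 19 * (if 228 ≤ m ∧ 289 ∣ m - 228 then aZ 19 ((m - 228) / 289) else 0)) =
    289 * aZ 19 2251 * aZ 19 m := by
  obtain ⟨C, hC⟩ := K17
  have h1 := hC m
  have h2 := hC 7
  unfold Kc at h1 h2
  rw [if_pos (Nat.zero_le _), Nat.sub_zero, gg17_const h] at h1
  rw [if_pos (Nat.zero_le _), Nat.sub_zero, gg17_const (by norm_num)] at h2
  rw [if_neg (by norm_num)] at h2
  norm_num at h2
  have : ((aZ 19 7 * (289 * aZ 19 (289 * m + 228) +
      17 ^ 19 * (if 228 ≤ m ∧ 289 ∣ m - 228 then aZ 19 ((m - 228) / 289) else 0)) : ℤ) : ℂ) =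
    ((289 * aZ 19 2251 * aZ 19 m : ℤ) : ℂ) := by
    generalize (if 228 ≤ m ∧ 289 ∣ m - 228 then aZ 19 ((m - 228) / 289) else 0) = X at h1 ⊢
    push_cast
    push_cast at h1
    linear_combination (aZ 19 7 : ℂ) * h1 - (aZ 19 m : ℂ) * h2
  exact_mod_cast this

lemma step17 (h7 : (aZ 19 7 : ZMod 7) = 2) (h2251 : (aZ 19 2251 : ZMod 7) = 0)
    {m : ℕ} (h : 17 ∣ 24 * m + 19)
    (hX : (7 : ℤ) ∣ (if 228 ≤ m ∧ 289 ∣ m - 228 then aZ 19 ((m - 228) / 289) else 0)) :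
    (7 : ℤ) ∣ aZ 19 (289 * m + 228) := by
  have h1 := congrArg (fun x : ℤ ↦ (x : ZMod 7)) (rec17 h)
  have hX' := (ZMod.intCast_zmod_eq_zero_iff_dvd _ 7).mpr hX
  generalize (if 228 ≤ m ∧ 289 ∣ m - 228 then aZ 19 ((m - 228) / 289) else 0) = X at *
  push_cast at h1
  rw [h7, h2251, hX'] at h1
  refine (ZMod.intCast_zmod_eq_zero_iff_dvd _ 7).mp ?_
  generalize ((aZ 19 (289 * m + 228) : ℤ) : ZMod 7) = y at *
  simp only [mul_zero, add_zero, zero_mul] at h1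
  revert h1
  revert y
  decide

lemma main17 (h7 : (aZ 19 7 : ZMod 7) = 2) (h2251 : (aZ 19 2251 : ZMod 7) = 0)
    {n : ℕ} (hn : n.Coprime 17) (i : ℕ) : ∀ k, 24 * k + 19 = 17 ^ (4 * i + 3) * n →
    (7 : ℤ) ∣ aZ 19 k := by
  induction i with
  | zero =>
    intro k hk
    norm_num at hk
    obtain ⟨m, hm⟩ : ∃ m, k = 289 * m + 228 := ⟨(k - 228) / 289, by omega⟩
    have hm2 : 24 * m + 19 = 17 * n := by omega
    rw [hm]
    refine step17 h7 h2251 (by omega) ?_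
    rw [if_neg]
    · simp
    · rintro ⟨h1, c, hc⟩
      have : 17 ∣ n := by omega
      have h3 := Nat.Coprime.eq_one_of_dvd (Nat.coprime_comm.mp hn) this
      norm_num at h3
  | succ i ih =>
    intro k hk
    have e : 17 ^ (4 * (i + 1) + 3) * n = 83521 * (17 ^ (4 * i + 3) * n) := by ring
    rw [e] at hk
    have hd : 17 ∣ 17 ^ (4 * i + 3) * n := Dvd.dvd.mul_right (dvd_pow_self _ (by omega)) _
    generalize 17 ^ (4 * i + 3) * n = N at *
    obtain ⟨m, hm⟩ : ∃ m, k = 289 * m + 228 := ⟨(k - 228) / 289, by omega⟩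
    have hm2 : 24 * m + 19 = 289 * N := by omega
    obtain ⟨m', hm'⟩ : ∃ m', m = 289 * m' + 228 := ⟨(m - 228) / 289, by omega⟩
    rw [hm]
    refine step17 h7 h2251 (by omega) ?_
    rw [if_pos ⟨by omega, by omega⟩]
    apply ih
    have : (m - 228) / 289 = m' := by omega
    rw [this]; omega

end

section
open ModularForm PowerSeries

def DV (M : ℤ) (n : ℕ) (c : PowerSeries ℤ) : Prop := ∀ i ≤ n, M ∣ coeff i c

lemma DV.mul {M : ℤ} {n : ℕ} {c : PowerSeries ℤ} (h : DV M n c) (d : PowerSeries ℤ) :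
    DV M n (c * d) := by
  intro i hi
  rw [coeff_mul]
  refine Finset.dvd_sum fun p hp ↦ Dvd.dvd.mul_right (h _ ?_) _
  have := Finset.HasAntidiagonal.mem_antidiagonal.mp hp
  omega

lemma DV.add {M : ℤ} {n : ℕ} {c d : PowerSeries ℤ} (h : DV M n c) (h' : DV M n d) :
    DV M n (c + d) := fun i hi ↦ by rw [map_add]; exact dvd_add (h i hi) (h' i hi)

lemma DV.sub {M : ℤ} {n : ℕ} {c d : PowerSeries ℤ} (h : DV M n c) (h' : DV M n d) :
    DV M n (c - d) := fun i hi ↦ by rw [map_sub]; exact dvd_sub (h i hi) (h' i hi)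

lemma DV.const {M a : ℤ} (h : M ∣ a) (n : ℕ) : DV M n (PowerSeries.C a) := fun i _ ↦ by
  rw [coeff_C]; split_ifs
  · exact h
  · simp

lemma DV.xshift {M : ℤ} {n : ℕ} {c : PowerSeries ℤ} (h : DV M (n + 1) (X * c)) : DV M n c := by
  intro i hi
  have := h (i + 1) (by omega)
  rwa [coeff_succ_X_mul] at this

lemma pent_const : constantCoeff (pentagonalSeries ℤ) = 1 := by
  have h := coeff_pentagonalSeries_pentagonal ℤ 0
  simpa [pentagonal] using h

lemma exists_Q : ∃ Q : PowerSeries ℤ, pentagonalSeries ℤ * Q = 1 := by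
  have : IsUnit (pentagonalSeries ℤ) := by
    rw [PowerSeries.isUnit_iff_constantCoeff, pent_const]; exact isUnit_one
  obtain ⟨Q, hQ⟩ := this.exists_right_inv
  exact ⟨Q, hQ⟩

noncomputable def mZ : PowerSeries ℤ →+* PowerSeries ℂ := PowerSeries.map (Int.castRingHom ℂ)

lemma mZ_coeff (c : PowerSeries ℤ) (m : ℕ) : coeff m (mZ c) = ((coeff m c : ℤ) : ℂ) := by
  simp [mZ]

lemma mZ_C (a : ℤ) : mZ (PowerSeries.C a) = PowerSeries.C (a : ℂ) := by
  simp [mZ]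

lemma mZ_inj {c d : PowerSeries ℤ} (h : mZ c = mZ d) : c = d := by
  ext m
  have := congrArg (coeff m) h
  rw [mZ_coeff, mZ_coeff] at this
  exact_mod_cast this

lemma mZ_X : mZ X = X := by simp [mZ]

lemma mZ_pent : mZ (pentagonalSeries ℤ) = pentagonalSeries ℂ := map_pent _

noncomputable def e6 : PowerSeries ℤ :=
  PowerSeries.mk fun m ↦ if m = 0 then 1 else -504 * (ArithmeticFunction.sigma 5 m : ℤ)

open UpperHalfPlane MatrixGroups EisensteinSeries in
lemma qexp_E6 : qExpansion 1 E₆ = mZ e6 := by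
  ext m
  rw [E_qExpansion_coeff _ ⟨3, rfl⟩, mZ_coeff, e6, coeff_mk]
  split_ifs with h
  · simp
  · rw [show bernoulli 6 = 1 / 42 by decide +kernel]
    push_cast
    norm_num

lemma e6_zero : coeff 0 e6 = 1 := by simp [e6]

open UpperHalfPlane MatrixGroups in
lemma qexp_disc : qExpansion 1 discriminant = mZ (X * pentagonalSeries ℤ ^ 24) := by
  ext m
  have := ModularFormClass.qExpansion_coeff_unique (Γ := 𝒮ℒ) (k := 12) (h := 1)
      (f := CuspForm.discriminant)
      (c := fun m ↦ coeff m (mZ (X * pentagonalSeries ℤ ^ 24)))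
      one_pos one_mem_strictPeriods_SL (fun τ ↦ by
    have h1 : HasSum (fun m ↦ coeff m (X : PowerSeries ℂ) * ee τ ^ m) (ee τ) := by
      refine hs_congr (hasSum_ite_eq (1 : ℕ) (ee τ)) fun m ↦ ?_
      rw [coeff_X]
      split_ifs with h
      · simp [h]
      · simp
    have h2 := mul_hs h1 (prep_Eu.pow 24 _ (norm_ee_lt τ.2))
    have e : CuspForm.discriminant τ = ee τ * Eu (ee τ) ^ 24 := by
      rw [CuspForm.coe_discriminant]
      change eta τ ^ 24 = _
      rw [eta_eq, mul_pow, ← ee_nat_mul]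
      congr 2
      push_cast; ring
    rw [e, map_mul, map_pow, mZ_X, mZ_pent]
    simp only [qParam_eq_ee, smul_eq_mul]
    exact h2) m
  exact this.symm

open UpperHalfPlane MatrixGroups EisensteinSeries in
lemma exists_E (t : ℕ) (k : ℤ) (hk : k = 12 * t) : ∃ g : ModularForm 𝒮ℒ k,
    qExpansion 1 g = mZ (e6 ^ (2 * t)) := by
  refine ⟨ModularForm.mcast (by rw [hk]; push_cast; ring) (ModularForm.pow E₆ (2 * t)), ?_⟩
  rw [ModularForm.qExpansion_mcast _ rfl, ModularForm.qExpansion_pow one_pos one_mem_strictPeriods_SL, qexp_E6, map_pow]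

open UpperHalfPlane MatrixGroups EisensteinSeries in
lemma sturm (M : ℤ) (t : ℕ) : ∀ (k : ℤ) (_ : k = 12 * t) (f : ModularForm 𝒮ℒ k)
    (c : PowerSeries ℤ), qExpansion 1 f = mZ c → DV M t c → ∀ n, DV M n c := by
  induction t with
  | zero =>
    intro k hk f c hc h n i hi
    obtain rfl : k = 0 := by simpa using hk
    obtain ⟨C, hC⟩ := ModularFormClass.levelOne_weight_zero_const (F := ModularForm 𝒮ℒ 0) f
    by_cases hi0 : i = 0
    · rw [hi0]; exact h 0 le_rfl
    have h1 := (ModularFormClass.qExpansion_coeff_unique (Γ := 𝒮ℒ) (k := 0) (h := 1)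
      (f := (f : ModularForm 𝒮ℒ 0)) (c := fun m ↦ coeff m (PowerSeries.C C))
      one_pos one_mem_strictPeriods_SL (fun τ ↦ by
        rw [show f τ = C from congrFun hC τ]
        refine hs_congr (hasSum_ite_eq (0 : ℕ) (C : ℂ)) fun m ↦ ?_
        rw [coeff_C]
        split_ifs with h
        · simp [h]
        · simp) i)
    rw [hc, mZ_coeff, coeff_C, if_neg hi0] at h1
    have : coeff i c = 0 := by exact_mod_cast h1.symm
    rw [this]; simp
  | succ t ih =>
    intro k hk f c hc h n
    obtain ⟨g, hg⟩ := exists_E (t + 1) k hk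
    set a := coeff 0 c with ha
    set c1 := c - PowerSeries.C a * e6 ^ (2 * (t + 1)) with hc1
    set f1 : ModularForm 𝒮ℒ k := f - (a : ℂ) • g with hf1
    have hq1 : qExpansion 1 f1 = mZ c1 := by
      rw [hf1, FunLike.coe_sub, ModularForm.qExpansion_sub one_pos one_mem_strictPeriods_SL,
        FunLike.coe_smul, ModularForm.qExpansion_smul one_pos one_mem_strictPeriods_SL,
        hc, hg, hc1, map_sub, map_mul, mZ_C, smul_eq_C_mul]
    have hc10 : constantCoeff c1 = 0 := by
      have : constantCoeff e6 = 1 := by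
        rw [← coeff_zero_eq_constantCoeff_apply]; exact e6_zero
      rw [hc1, map_sub, map_mul, map_pow, this]
      simp [ha]
    obtain ⟨c2, hc2⟩ := X_dvd_iff.mpr hc10
    have hcusp : (qExpansion 1 f1).coeff 0 = 0 := by
      rw [hq1, mZ_coeff, coeff_zero_eq_constantCoeff_apply, hc10]; simp
    have h3 := qExpansion_eq_qExpansion_discriminant_mul f1 hcusp
    obtain ⟨Q, hQ⟩ := exists_Q
    have hPQ : pentagonalSeries ℤ ^ 24 * Q ^ 24 = 1 := by rw [← mul_pow, hQ, one_pow]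
    generalize CuspForm.discriminantEquiv (toCuspForm f1 hcusp) = g2 at h3
    rw [hq1, qexp_disc, hc2, map_mul, map_mul, mZ_X, mul_assoc] at h3
    have h4 := mul_left_cancel₀ (X_ne_zero (R := ℂ)) h3
    have h5 : qExpansion 1 g2 = mZ (c2 * Q ^ 24) := by
      rw [map_mul, h4, mul_assoc, mul_comm (qExpansion 1 g2), ← mul_assoc, ← map_mul, hPQ, map_one,
        one_mul]
    have hdc : DV M (t + 1) c1 :=
      h.sub ((DV.const (h 0 (Nat.zero_le _)) _).mul _)
    rw [hc2] at hdc
    have h6 := ih (k - 12) (by rw [hk]; push_cast; ring) g2 _ h5 (hdc.xshift.mul _)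
    have h7 : c = (c2 * Q ^ 24) * (X * pentagonalSeries ℤ ^ 24) +
        PowerSeries.C a * e6 ^ (2 * (t + 1)) := by
      have : c = c1 + PowerSeries.C a * e6 ^ (2 * (t + 1)) := by rw [hc1]; ring
      rw [this, hc2]
      congr 1
      calc X * c2 = X * c2 * (pentagonalSeries ℤ ^ 24 * Q ^ 24) := by rw [hPQ, mul_one]
        _ = _ := by ring
    rw [h7]
    exact ((h6 n).mul _).add ((DV.const (h 0 (Nat.zero_le _)) _).mul _)

end

section
open ModularForm PowerSeries

def gZ (n : ℕ) : ℤ := if 7 ∣ 24 * n + 338 then -6 else 1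

lemma gg7 (n : ℕ) : gg 7 5 338 n = (gZ n : ℂ) := by
  have h := sum_ee (L := 7) (by norm_num) (24 * n + 338)
  have h2 : gg 7 5 338 n = - ∑ b ∈ (Finset.range 7).filter (fun b ↦ b ≠ 0),
      ee ((24 * n + 338 : ℕ) * (b / (7 : ℕ))) := by
    unfold gg
    rw [← Finset.sum_neg_distrib]
    refine Finset.sum_congr rfl fun b hb ↦ ?_
    rw [Finset.mem_filter, Finset.mem_range] at hb
    rw [ks7 b hb.1 hb.2]; simp
  have h3 : ∑ b ∈ Finset.range 7, ee ((24 * n + 338 : ℕ) * (b / (7 : ℕ))) =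
      1 + ∑ b ∈ (Finset.range 7).filter (fun b ↦ b ≠ 0),
      ee ((24 * n + 338 : ℕ) * (b / (7 : ℕ))) := by
    rw [Finset.sum_filter, ← Finset.sum_erase_add _ _ (Finset.mem_range.mpr (by norm_num : 0 < 7)),
      ← Finset.sum_erase_add (Finset.range 7) (fun b : ℕ ↦ if b ≠ 0 then _ else (0 : ℂ))
        (Finset.mem_range.mpr (by norm_num : 0 < 7))]
    have e : ∑ x ∈ (Finset.range 7).erase 0, ee ((24 * n + 338 : ℕ) * (x / (7 : ℕ))) =
        ∑ x ∈ (Finset.range 7).erase 0, if x ≠ 0 then ee ((24 * n + 338 : ℕ) * (x / (7 : ℕ)))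
          else 0 := by
      refine Finset.sum_congr rfl fun x hx ↦ ?_
      rw [if_pos (Finset.ne_of_mem_erase hx)]
    rw [e]
    have e0 : ee 0 = 1 := by simpa using ee_nat 0
    simp [e0, add_comm]
  rw [h3] at h
  rw [h2, gZ]
  split_ifs at h ⊢ with h7
  · push_cast at h ⊢
    linear_combination -h
  · push_cast at h ⊢
    linear_combination -h

noncomputable def kZ : PowerSeries ℤ := PowerSeries.mk fun m ↦
  aZ 338 (49 * m + 39) + 7 ^ 167 * (if 13 ≤ m then aZ 338 (m - 13) * gZ (m - 13) else 0)
    + 7 ^ 336 * (if 689 ≤ m ∧ 49 ∣ m - 689 then aZ 338 ((m - 689) / 49) else 0)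

set_option exponentiation.threshold 1000 in
lemma Kc7 (m : ℕ) : Kc 7 49 5 338 13 39 689 m = 49 * ((coeff m kZ : ℤ) : ℂ) := by
  have hs : sl 7 ^ 338 = (7 : ℂ) ^ 169 := by
    rw [show 338 = 2 * 169 by norm_num, pow_mul, sl_sq]; norm_num
  unfold Kc kZ
  rw [hs, coeff_mk, gg7]
  generalize (if 689 ≤ m ∧ 49 ∣ m - 689 then aZ 338 ((m - 689) / 49) else 0) = Y
  split_ifs with h
  · push_cast; ring
  · push_cast; ring

lemma e6_DV (n j : ℕ) : DV 7 n (e6 ^ j - 1) := by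
  have h : DV 7 n (e6 - 1) := by
    intro i _
    rw [map_sub, e6, coeff_mk, coeff_one]
    split_ifs
    · simp
    · rw [sub_zero]; exact ⟨-72 * (ArithmeticFunction.sigma 5 i : ℤ), by ring⟩
  have := sub_dvd_pow_sub_pow e6 1 j
  rw [one_pow] at this
  obtain ⟨d, hd⟩ := this
  rw [hd]; exact h.mul d

lemma kZ_DV (n : ℕ) : DV 49 n (kZ - PowerSeries.mk fun m ↦ aZ 338 (49 * m + 39)) := by
  intro i _
  rw [map_sub, kZ, coeff_mk, coeff_mk]
  have h1 : (49 : ℤ) ∣ 7 ^ 167 := by rw [show (49 : ℤ) = 7 ^ 2 by norm_num]; exact pow_dvd_pow _ (by norm_num)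
  have h2 : (49 : ℤ) ∣ 7 ^ 336 := by rw [show (49 : ℤ) = 7 ^ 2 by norm_num]; exact pow_dvd_pow _ (by norm_num)
  generalize (7 : ℤ) ^ 167 = A at *
  generalize (7 : ℤ) ^ 336 = B at *
  rw [add_assoc, add_sub_cancel_left]
  exact dvd_add (Dvd.dvd.mul_right h1 _) (Dvd.dvd.mul_right h2 _)

open UpperHalfPlane MatrixGroups EisensteinSeries in
lemma main7 (hfin : ∀ m ≤ 13, (49 : ℤ) ∣ aZ 338 (49 * m + 39) - 14 * aZ 26 m) (m : ℕ) :
    (49 : ℤ) ∣ aZ 338 (49 * m + 39) - 14 * aZ 26 m := by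
  obtain ⟨f, hf⟩ := exists_G (l := 7) (L := 49) (e := 5) (e1 := 41) (r := 338) (r0 := 26)
    (t := 13) (s := 39) (u := 689) (by norm_num) (by norm_num) okA7 okM7 (by norm_num)
    (by norm_num) (by norm_num) (by norm_num) (by norm_num)
  obtain ⟨Q, hQ⟩ := exists_Q
  have hPQ : pentagonalSeries ℤ ^ 26 * Q ^ 26 = 1 := by rw [← mul_pow, hQ, one_pow]
  obtain ⟨g, hg⟩ := exists_E 13 ((12 * 13 : ℕ) : ℤ) (by norm_num)
  set c : PowerSeries ℤ := kZ * Q ^ 26 - PowerSeries.C 14 * e6 ^ (2 * 13) with hc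
  have hK : PowerSeries.mk (Kc 7 49 5 338 13 39 689) = PowerSeries.C 49 * mZ kZ := by
    ext m
    rw [coeff_mk, coeff_C_mul, mZ_coeff, Kc7]
  have h1 : qExpansion 1 f = PowerSeries.C 49 * mZ (kZ * Q ^ 26) := by
    rw [map_mul, ← mul_assoc, ← hK, ← hf, ← mZ_pent, mul_assoc, ← map_pow, ← map_mul, hPQ,
      map_one, mul_one]
  have h2 : qExpansion 1 (((49 : ℂ)⁻¹ • f - (14 : ℂ) • g : ModularForm 𝒮ℒ ((12 * 13 : ℕ) : ℤ))) =
      mZ c := by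
    rw [FunLike.coe_sub, ModularForm.qExpansion_sub one_pos one_mem_strictPeriods_SL,
      FunLike.coe_smul, ModularForm.qExpansion_smul one_pos one_mem_strictPeriods_SL,
      FunLike.coe_smul, ModularForm.qExpansion_smul one_pos one_mem_strictPeriods_SL,
      h1, hg, hc, map_sub, map_mul (f := mZ) (PowerSeries.C 14), mZ_C, smul_eq_C_mul, smul_eq_C_mul,
      ← mul_assoc, ← map_mul]
    norm_num
  set A : PowerSeries ℤ := PowerSeries.mk fun m ↦ aZ 338 (49 * m + 39) with hA
  set B : PowerSeries ℤ := A - PowerSeries.C 14 * pentagonalSeries ℤ ^ 26 with hB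
  have hBc : ∀ m, coeff m B = aZ 338 (49 * m + 39) - 14 * aZ 26 m := by
    intro m; rw [hB, map_sub, coeff_C_mul, hA, coeff_mk]; rfl
  have h14 : ∀ n, DV 49 n (PowerSeries.C 14 * (e6 ^ (2 * 13) - 1)) := by
    intro n i hi
    rw [coeff_C_mul]
    obtain ⟨d, hd⟩ := e6_DV n (2 * 13) i hi
    rw [hd]; exact ⟨2 * d, by ring⟩
  have hrel : c * pentagonalSeries ℤ ^ 26 = (kZ - A) + B
      - PowerSeries.C 14 * (e6 ^ (2 * 13) - 1) * pentagonalSeries ℤ ^ 26 := by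
    calc c * pentagonalSeries ℤ ^ 26 = kZ * (pentagonalSeries ℤ ^ 26 * Q ^ 26)
        - PowerSeries.C 14 * e6 ^ (2 * 13) * pentagonalSeries ℤ ^ 26 := by rw [hc]; ring
      _ = _ := by rw [hPQ, hB]; ring
  have h3 : DV 49 13 (c * pentagonalSeries ℤ ^ 26) := by
    rw [hrel]
    exact ((kZ_DV _).add (fun i hi ↦ by rw [hBc]; exact hfin i hi)).sub ((h14 _).mul _)
  have h4 : DV 49 13 c := by
    have := h3.mul (Q ^ 26)
    rwa [mul_assoc, hPQ, mul_one] at this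
  have h5 := sturm 49 13 _ (by norm_num) _ c h2 h4 m
  have h6 : B = c * pentagonalSeries ℤ ^ 26 - (kZ - A)
      + PowerSeries.C 14 * (e6 ^ (2 * 13) - 1) * pentagonalSeries ℤ ^ 26 := by
    rw [hrel]; ring
  have h7 : DV 49 m B := by
    rw [h6]
    exact ((h5.mul _).sub (kZ_DV _)).add ((h14 _).mul _)
  rw [← hBc]; exact h7 m le_rfl

end

section
open ModularForm PowerSeries

noncomputable def PP : PowerSeries ℤ := PowerSeries.mk fun n ↦ (Fintype.card (Nat.Partition n) : ℤ)

open PowerSeries.WithPiTopology in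
lemma PP_mul : PP * pentagonalSeries ℤ = 1 := by
  have h1 := Nat.Partition.hasProd_powerSeriesMk_card_restricted ℤ (fun _ ↦ True)
  have h2 := hasProd_one_sub_X_pow ℤ
  have h3 := h1.mul h2
  have e : (fun i : ℕ ↦ (if True then ∑' j : ℕ, (X : PowerSeries ℤ) ^ ((i + 1) * j) else 1) *
      (1 - X ^ (i + 1))) = fun _ ↦ 1 := by
    funext i
    rw [if_pos trivial]
    simp_rw [pow_mul]
    rw [tsum_pow_mul_one_sub_of_constantCoeff_eq_zero (by simp)]
  rw [e] at h3
  have h4 := h3.unique hasProd_one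
  rw [← h4]
  congr 1
  ext n
  simp [PP, Nat.Partition.restricted]

lemma multi_coeff (r n : ℕ) : (multipartition r n : ℤ) = coeff n (PP ^ r) := by
  have : PP ^ r = ∏ _i : Fin r, PP := by simp
  rw [this, coeff_prod, multipartition]
  push_cast
  refine Finset.sum_nbij' (fun c ↦ Finsupp.equivFunOnFinite.symm c) (fun c ↦ ⇑c) ?_ ?_ ?_ ?_ ?_
  · intro c hc
    rw [Finset.Nat.mem_antidiagonalTuple] at hc
    simp [Finset.mem_finsuppAntidiag, hc]
  · intro c hc
    rw [Finset.mem_finsuppAntidiag] at hc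
    rw [Finset.Nat.mem_antidiagonalTuple]; exact hc.1
  · intro c _; rfl
  · intro c _; ext i; rfl
  · intro c _; simp [PP]

lemma frob7 (f : PowerSeries (ZMod 7)) : f ^ 7 = expand 7 (by norm_num) f := by
  have : Fact (Nat.Prime 7) := ⟨by norm_num⟩
  have h := MvPowerSeries.map_frobenius_expand (R := ZMod 7) (σ := Unit) 7 (by norm_num) (f := f)
  have hid : frobenius (ZMod 7) 7 = RingHom.id _ := by
    ext x
    exact ZMod.pow_card x
  rw [← h, hid]
  rw [MvPowerSeries.map_id]
  rfl

lemma C_dvd_iff (M : ℤ) (f : PowerSeries ℤ) : C M ∣ f ↔ ∀ n, M ∣ coeff n f := by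
  constructor
  · rintro ⟨g, rfl⟩ n
    rw [coeff_C_mul]; exact dvd_mul_right _ _
  · intro h
    choose g hg using h
    refine ⟨PowerSeries.mk g, ?_⟩
    ext n
    rw [coeff_C_mul, coeff_mk, hg]

lemma phi49 : (C (7 : ℤ)) ∣
    pentagonalSeries ℤ ^ 49 - expand 49 (by norm_num) (pentagonalSeries ℤ) := by
  rw [C_dvd_iff]
  intro n
  have h : PowerSeries.map (Int.castRingHom (ZMod 7))
      (pentagonalSeries ℤ ^ 49 - expand 49 (by norm_num) (pentagonalSeries ℤ)) = 0 := by
    rw [map_sub, map_pow, map_expand, map_pent, sub_eq_zero]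
    have e : pentagonalSeries (ZMod 7) ^ 49 = (pentagonalSeries (ZMod 7) ^ 7) ^ 7 := by
      rw [← pow_mul]
    rw [e, frob7, frob7]
    exact (expand_mul 7 (by norm_num) 7 (by norm_num) _).symm
  have h2 := congrArg (coeff n) h
  rw [coeff_map, map_zero] at h2
  exact (ZMod.intCast_zmod_eq_zero_iff_dvd _ 7).mp h2

lemma phi343 : (C (49 : ℤ)) ∣
    pentagonalSeries ℤ ^ 343 - (expand 49 (by norm_num) (pentagonalSeries ℤ)) ^ 7 := by
  have h := phi49
  have e7 : (C (7 : ℤ)) = ((7 : ℕ) : PowerSeries ℤ) := by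
    simp
  rw [e7] at h
  have h2 := dvd_sub_pow_of_dvd_sub h 1
  have e49 : (C (49 : ℤ)) = ((7 : ℕ) : PowerSeries ℤ) ^ (1 + 1) := by
    rw [← e7, ← map_pow]; norm_num
  rw [e49]
  rw [← pow_mul] at h2
  exact h2

lemma phi338 : (C (49 : ℤ)) ∣
    pentagonalSeries ℤ ^ 338 - (expand 49 (by norm_num) (pentagonalSeries ℤ ^ 7)) * PP ^ 5 := by
  have h := phi343.mul_left (PP ^ 5)
  have e : PP ^ 5 * (pentagonalSeries ℤ ^ 343 - (expand 49 (by norm_num) (pentagonalSeries ℤ)) ^ 7) =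
      pentagonalSeries ℤ ^ 338 - (expand 49 (by norm_num) (pentagonalSeries ℤ ^ 7)) * PP ^ 5 := by
    have : PP ^ 5 * pentagonalSeries ℤ ^ 343 = pentagonalSeries ℤ ^ 338 := by
      rw [show 343 = 5 + 338 from rfl, pow_add, ← mul_assoc, ← mul_pow, PP_mul, one_pow, one_mul]
    rw [mul_sub, this, map_pow, mul_comm (PP ^ 5)]
  rwa [e] at h

noncomputable def UU (c : PowerSeries ℤ) : PowerSeries ℤ := PowerSeries.mk fun m ↦ coeff (49 * m + 39) c

lemma UU_mul (a c : PowerSeries ℤ) : UU (expand 49 (by norm_num) a * c) = a * UU c := by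
  ext m
  rw [UU, coeff_mk, coeff_mul, coeff_mul]
  symm
  refine Finset.sum_of_injOn (fun p ↦ (49 * p.1, 49 * p.2 + 39)) ?_ ?_ ?_ ?_
  · intro p _ q _ h
    simp only [Prod.mk.injEq] at h
    ext <;> omega
  · intro p hp
    simp only [Finset.mem_coe, Finset.HasAntidiagonal.mem_antidiagonal] at hp ⊢
    omega
  · intro p hp hn
    rw [coeff_expand_of_not_dvd, zero_mul]
    rintro ⟨t, ht⟩
    apply hn
    rw [Finset.HasAntidiagonal.mem_antidiagonal] at hp
    refine ⟨(t, m - t), ?_, ?_⟩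
    · simp only [Finset.mem_coe, Finset.HasAntidiagonal.mem_antidiagonal]; omega
    · ext
      · exact ht.symm
      · simp only; omega
  · intro p _
    simp only [UU, coeff_mk]
    rw [coeff_expand_mul]

lemma claimA (hfin : ∀ m ≤ 13, (49:ℤ) ∣ aZ 338 (49*m+39) - 14 * aZ 26 m) (m : ℕ) :
    (49:ℤ) ∣ coeff (49 * m + 39) (PP ^ 5) - 14 * aZ 19 m := by
  have h1 : C (49 : ℤ) ∣ UU (pentagonalSeries ℤ ^ 338) - pentagonalSeries ℤ ^ 7 * UU (PP ^ 5) := by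
    rw [← UU_mul, C_dvd_iff]
    intro n
    have := (C_dvd_iff _ _).mp phi338 (49 * n + 39)
    simpa [UU] using this
  have h2 : C (49 : ℤ) ∣ UU (pentagonalSeries ℤ ^ 338) - C 14 * pentagonalSeries ℤ ^ 26 := by
    rw [C_dvd_iff]
    intro n
    have := main7 hfin n
    rw [map_sub, coeff_C_mul, UU, coeff_mk]
    exact this
  have h3 := (dvd_sub h2 h1).mul_left (PP ^ 7)
  have e7 : PP ^ 7 * pentagonalSeries ℤ ^ 7 = 1 := by rw [← mul_pow, PP_mul, one_pow]
  have e : PP ^ 7 * (UU (pentagonalSeries ℤ ^ 338) - C 14 * pentagonalSeries ℤ ^ 26 -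
      (UU (pentagonalSeries ℤ ^ 338) - pentagonalSeries ℤ ^ 7 * UU (PP ^ 5))) =
      UU (PP ^ 5) - C 14 * pentagonalSeries ℤ ^ 19 := by
    linear_combination (UU (PP ^ 5) - C 14 * pentagonalSeries ℤ ^ 19) * e7
  rw [e, C_dvd_iff] at h3
  have := h3 m
  rw [map_sub, coeff_C_mul, UU, coeff_mk] at this
  exact this

lemma final_of (hfin : ∀ m ≤ 13, (49:ℤ) ∣ aZ 338 (49*m+39) - 14 * aZ 26 m)
    (h7 : (aZ 19 7 : ZMod 7) = 2) (h2251 : (aZ 19 2251 : ZMod 7) = 0)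
    (n : ℕ) (hcop : n.Coprime 17) (hdvd : 24 ∣ 7 ^ 2 * 17 ^ 195 * n + 5) :
    7 ^ 2 ∣ multipartition 5 ((7 ^ 2 * 17 ^ 195 * n + 5) / 24) := by
  have hm := main17 h7 h2251 hcop 48
  rw [show 4 * 48 + 3 = 195 from rfl] at hm
  rw [mul_assoc] at hdvd ⊢
  generalize 17 ^ 195 * n = N at *
  obtain ⟨t, ht⟩ := hdvd
  have hk : ∃ k, 24 * k + 19 = N := ⟨(N - 19) / 24, by omega⟩
  obtain ⟨k, hk⟩ := hk
  have h1 := hm k hk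
  have h2 := claimA hfin k
  rw [show (7 ^ 2 * N + 5) / 24 = 49 * k + 39 by omega]
  rw [← multi_coeff] at h2
  have h3 : (49 : ℤ) ∣ 14 * aZ 19 k := by
    obtain ⟨c, hc⟩ := h1
    exact ⟨2 * c, by rw [hc]; ring⟩
  have h4 := dvd_add h2 h3
  rw [sub_add_cancel] at h4
  norm_num
  exact_mod_cast h4

end

section
open PowerSeries

def NRep (M N : ℕ) (P : Polynomial ℕ) (f : PowerSeries ℤ) : Prop :=
  (X : PowerSeries (ZMod M)) ^ N ∣ PowerSeries.map (Int.castRingHom (ZMod M)) f -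
    ((P.map (Nat.castRingHom (ZMod M)) : Polynomial (ZMod M)) : PowerSeries (ZMod M))

lemma NRep.pow {M N : ℕ} {P : Polynomial ℕ} {f : PowerSeries ℤ} (h : NRep M N P f) (r : ℕ) :
    NRep M N (P ^ r) (f ^ r) := by
  unfold NRep at *
  rw [map_pow, Polynomial.map_pow, Polynomial.coe_pow]
  exact h.trans (sub_dvd_pow_sub_pow _ _ r)

lemma NRep.coeff {M N : ℕ} {P : Polynomial ℕ} {f : PowerSeries ℤ} (h : NRep M N P f) (i : ℕ)
    (hi : i < N) : ((PowerSeries.coeff i f : ℤ) : ZMod M) = (P.coeff i : ZMod M) := by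
  have := (X_pow_dvd_iff.mp h) i hi
  rw [map_sub, coeff_map, Polynomial.coeff_coe, Polynomial.coeff_map, sub_eq_zero] at this
  simpa using this

lemma eval_split (P : Polynomial ℕ) (b : ℕ) (i : ℕ) (h : P.eval 1 < b) :
    P.coeff i = P.eval b / b ^ i % b := by
  induction i generalizing P with
  | zero =>
    have e := Polynomial.divX_mul_X_add P
    have e1 := congrArg (Polynomial.eval 1) e
    have eb := congrArg (Polynomial.eval b) e
    simp only [Polynomial.eval_add, Polynomial.eval_mul, Polynomial.eval_X, Polynomial.eval_C] at e1 eb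
    rw [← eb, pow_zero, Nat.div_one, Nat.mul_add_mod_self_right, Nat.mod_eq_of_lt (by omega)]
  | succ i ih =>
    have e := Polynomial.divX_mul_X_add P
    have e1 := congrArg (Polynomial.eval 1) e
    have eb := congrArg (Polynomial.eval b) e
    simp only [Polynomial.eval_add, Polynomial.eval_mul, Polynomial.eval_X, Polynomial.eval_C] at e1 eb
    have hb : 0 < b := by omega
    have hlt : P.coeff 0 < b := by omega
    rw [← Polynomial.coeff_divX, ih _ (by omega), ← eb, pow_succ', ← Nat.div_div_eq_div_mul]
    congr 2
    rw [Nat.add_comm, Nat.add_mul_div_right _ _ hb, Nat.div_eq_of_lt hlt, Nat.zero_add]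

def phc (M K k : ℕ) : ℕ := if (k + K) % 2 = 0 then 1 else M - 1

def phe (K k : ℕ) : ℕ := pentagonal ((k : ℤ) - K)

noncomputable def phP (M K : ℕ) : Polynomial ℕ :=
  ∑ k ∈ Finset.range (2 * K + 1), Polynomial.monomial (phe K k) (phc M K k)

def phE (M K b : ℕ) : ℕ := ((List.range (2 * K + 1)).map fun k ↦ phc M K k * b ^ phe K k).sum

lemma phP_eval (M K b : ℕ) : (phP M K).eval b = phE M K b := by
  rw [phP, Polynomial.eval_finsetSum, phE]
  simp only [Polynomial.eval_monomial]
  rfl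

lemma phP_rep (M K N : ℕ) (hM : 0 < M) (hN : 2 * N ≤ (K + 1) * (3 * K + 2)) :
    NRep M N (phP M K) (pentagonalSeries ℤ) := by
  rw [NRep, X_pow_dvd_iff]
  intro i hi
  rw [map_sub, sub_eq_zero, map_pent, Polynomial.coeff_coe, Polynomial.coeff_map, phP,
    Polynomial.finsetSum_coeff]
  simp only [Polynomial.coeff_monomial]
  by_cases h : i ∈ Set.range pentagonal
  · obtain ⟨k, rfl⟩ := h
    rw [coeff_pentagonalSeries_pentagonal]
    have h2 := two_mul_natCast_pentagonal k
    have hN' : 2 * (N : ℤ) ≤ (K + 1) * (3 * K + 2) := by exact_mod_cast hN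
    have hi' : (pentagonal k : ℤ) < N := by exact_mod_cast hi
    have b1 : k ≤ K := by
      by_contra hc
      have : (K : ℤ) + 1 ≤ k := by omega
      nlinarith
    have b2 : -(K : ℤ) ≤ k := by
      by_contra hc
      have : (K : ℤ) + 1 ≤ -k := by omega
      nlinarith
    obtain ⟨j, hj⟩ : ∃ j : ℕ, (j : ℤ) - K = k := ⟨(k + K).toNat, by omega⟩
    rw [Finset.sum_eq_single j]
    · have : phe K j = pentagonal k := by rw [phe, hj]
      rw [if_pos this, phc]
      rcases Int.even_or_odd k with he | ho
      · rw [Int.negOnePow_even _ he, if_pos (by obtain ⟨t, ht⟩ := he; omega)]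
        simp
      · rw [Int.negOnePow_odd _ ho, if_neg (by obtain ⟨t, ht⟩ := ho; omega)]
        simp [Nat.cast_sub (Nat.succ_le_of_lt hM)]
    · intro l _ hl
      rw [if_neg]
      intro hc
      rw [phe] at hc
      have := pentagonal_injective hc
      omega
    · intro hc
      rw [Finset.mem_range] at hc
      omega
  · rw [coeff_pentagonalSeries_eq_zero _ h, Finset.sum_eq_zero, map_zero]
    intro k _
    rw [if_neg]
    intro hc
    exact h ⟨_, hc⟩

lemma aZ_val {M K N : ℕ} (hM : 0 < M) (hN : 2 * N ≤ (K + 1) * (3 * K + 2)) (r i b : ℕ) (hi : i < N)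
    (hb : phE M K 1 ^ r < b) :
    ((aZ r i : ℤ) : ZMod M) = ((phE M K b ^ r / b ^ i % b : ℕ) : ZMod M) := by
  have h := ((phP_rep M K N hM hN).pow r).coeff i hi
  rw [aZ, h, eval_split _ b i (by rw [Polynomial.eval_pow, phP_eval]; exact hb), Polynomial.eval_pow,
    phP_eval]

def Dlit : ℕ := 44313343414249615027792177911551091435680700666071555088522465764948417744024124385013650539241774536081355931346745222642272060729022618281644220722110403811621852950529790294439842063030803290798326575256770811856027482003624398661824873105357932720956570256677170649764873018240034838914903921341698219286865720466574646265663725265555330163148483018414480748045305734303539693750486912582409661095810127473752536182038538661325023599893737261433399014891446940689248258467243086217285785493646644325796656797636705003193556844706067383100927471225881172820291218550805249500661882579953701622173416926121240575856811411401633724810836434949462279736115471844171719599115733562503983954037875304284663746001628187317687244792924403558641578246847907890804344243106257604016774847765079237875549516152989362108825064329968409097146464081952651465725924744409640060508736824269936730973933991675505716894718309462198669636292077479844340013119571879955360461810136817282782942212242389586481842251979300403467000489540451442052711854706588957093759011967733918968413004084773979466088334821864326203003727751602809789215432413944658914882399094452890633646403571683242379942364648356052078861411410917007338489603154518081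

noncomputable def rP : Polynomial ℕ :=
  ∑ k ∈ Finset.range 677, Polynomial.monomial k (Dlit / 64 ^ k % 64)

def rE (b : ℕ) : ℕ := ((List.range 677).map fun k ↦ Dlit / 64 ^ k % 64 * b ^ k).sum

lemma rP_eval (b : ℕ) : rP.eval b = rE b := by
  rw [rP, Polynomial.eval_finsetSum, rE]
  simp only [Polynomial.eval_monomial]
  rfl

lemma r_bd : rE 1 * phE 49 21 1 < 2 ^ 30 := by decide +kernel

lemma r_chk : ∀ i < 677, (rE (2 ^ 30) * phE 49 21 (2 ^ 30)) / (2 ^ 30) ^ i % (2 ^ 30) % 49 =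
    if i = 0 then 1 else 0 := by decide +kernel

lemma rP_rep : NRep 49 677 rP PP := by
  have hφ := phP_rep 49 21 677 (by norm_num) (by norm_num)
  have h1 : (X : PowerSeries (ZMod 49)) ^ 677 ∣
      (((rP * phP 49 21).map (Nat.castRingHom (ZMod 49)) : Polynomial (ZMod 49)) :
        PowerSeries (ZMod 49)) - 1 := by
    rw [X_pow_dvd_iff]
    intro i hi
    rw [map_sub, sub_eq_zero, Polynomial.coeff_coe, Polynomial.coeff_map,
      eval_split _ (2 ^ 30) i (by rw [Polynomial.eval_mul, rP_eval, phP_eval]; exact r_bd),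
      Polynomial.eval_mul, rP_eval, phP_eval, coeff_one]
    have := r_chk i hi
    rw [eq_natCast, ← ZMod.natCast_mod, this]
    split_ifs <;> simp
  unfold NRep at *
  rw [Polynomial.map_mul, Polynomial.coe_mul] at h1
  have h2 := congrArg (PowerSeries.map (Int.castRingHom (ZMod 49))) PP_mul
  rw [map_mul, map_one] at h2
  generalize PowerSeries.map (Int.castRingHom (ZMod 49)) PP = p at *
  generalize PowerSeries.map (Int.castRingHom (ZMod 49)) (pentagonalSeries ℤ) = f at *
  generalize (((rP.map (Nat.castRingHom (ZMod 49)) : Polynomial (ZMod 49))) :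
        PowerSeries (ZMod 49)) = u at *
  generalize ((((phP 49 21).map (Nat.castRingHom (ZMod 49)) : Polynomial (ZMod 49))) :
        PowerSeries (ZMod 49)) = v at *
  have e : p - u = - (p * (u * v - 1)) - p * u * (f - v) := by
    linear_combination u * h2
  rw [e]
  exact dvd_sub (h1.mul_left _).neg_right (hφ.mul_left _)

lemma PP5_val (i : ℕ) (hi : i < 677) (hb : rE 1 ^ 5 < 2 ^ 80) :
    ((PowerSeries.coeff i (PP ^ 5) : ℤ) : ZMod 49) =
      ((rE (2 ^ 80) ^ 5 / (2 ^ 80) ^ i % 2 ^ 80 : ℕ) : ZMod 49) := by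
  rw [(rP_rep.pow 5).coeff i hi,
    eval_split _ (2 ^ 80) i (by rw [Polynomial.eval_pow, rP_eval]; exact hb), Polynomial.eval_pow,
    rP_eval]

lemma r_bd5 : rE 1 ^ 5 < 2 ^ 80 := by decide +kernel
lemma ph_bd19 : phE 49 3 1 ^ 19 < 2 ^ 160 := by decide +kernel

lemma chk14 : ∀ m < 14, (rE (2 ^ 80) ^ 5 / (2 ^ 80) ^ (49 * m + 39) % 2 ^ 80) % 49 =
    (14 * (phE 49 3 (2 ^ 160) ^ 19 / (2 ^ 160) ^ m % 2 ^ 160)) % 49 := by decide +kernel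

lemma fin14 (m : ℕ) (hm : m ≤ 13) :
    (49 : ℤ) ∣ PowerSeries.coeff (49 * m + 39) (PP ^ 5) - 14 * aZ 19 m := by
  refine (ZMod.intCast_zmod_eq_zero_iff_dvd _ 49).mp ?_
  push_cast
  rw [PP5_val _ (by omega) r_bd5,
    aZ_val (M := 49) (K := 3) (N := 14) (by norm_num) (by norm_num) 19 m (2 ^ 160) (by omega) ph_bd19,
    sub_eq_zero]
  have h := chk14 m (by omega)
  have h2 := (ZMod.natCast_eq_natCast_iff' _ _ 49).mpr h
  rw [h2, Nat.cast_mul]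
  rfl

lemma hfin_all : ∀ m ≤ 13, (49:ℤ) ∣ aZ 338 (49*m+39) - 14 * aZ 26 m := by
  have h1 : C (49 : ℤ) ∣ UU (pentagonalSeries ℤ ^ 338) - pentagonalSeries ℤ ^ 7 * UU (PP ^ 5) := by
    rw [← UU_mul, C_dvd_iff]
    intro n
    have := (C_dvd_iff _ _).mp phi338 (49 * n + 39)
    simpa [UU] using this
  have h2 : DV 49 13 (UU (PP ^ 5) - C 14 * pentagonalSeries ℤ ^ 19) := by
    intro i hi
    rw [map_sub, coeff_C_mul, UU, coeff_mk]
    exact fin14 i hi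
  have h3 := h2.mul (pentagonalSeries ℤ ^ 7)
  intro m hm
  have a1 := (C_dvd_iff _ _).mp h1 m
  have a2 := h3 m hm
  have a3 := dvd_add a1 a2
  rw [← map_add] at a3
  have e : UU (pentagonalSeries ℤ ^ 338) - pentagonalSeries ℤ ^ 7 * UU (PP ^ 5) +
      (UU (PP ^ 5) - C 14 * pentagonalSeries ℤ ^ 19) * pentagonalSeries ℤ ^ 7 =
      UU (pentagonalSeries ℤ ^ 338) - C 14 * pentagonalSeries ℤ ^ 26 := by ring
  rw [e, map_sub, coeff_C_mul, UU, coeff_mk] at a3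
  exact a3

lemma ph_bd7 : phE 7 39 1 ^ 19 < 2 ^ 160 := by decide +kernel
lemma chk7 : (phE 7 39 (2 ^ 160) ^ 19 / (2 ^ 160) ^ 7 % 2 ^ 160) % 7 = 2 := by decide +kernel
lemma chk2251 : (phE 7 39 (2 ^ 160) ^ 19 / (2 ^ 160) ^ 2251 % 2 ^ 160) % 7 = 0 := by decide +kernel

lemma hval7 : (aZ 19 7 : ZMod 7) = 2 := by
  rw [aZ_val (M := 7) (K := 39) (N := 2252) (by norm_num) (by norm_num) 19 7 (2 ^ 160) (by norm_num)
    ph_bd7, ← ZMod.natCast_mod, chk7]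
  rfl

lemma hval2251 : (aZ 19 2251 : ZMod 7) = 0 := by
  rw [aZ_val (M := 7) (K := 39) (N := 2252) (by norm_num) (by norm_num) 19 2251 (2 ^ 160) (by norm_num)
    ph_bd7, ← ZMod.natCast_mod, chk2251]
  rfl

end

theorem multipartition_five_49_17 (n : ℕ) (hn : 0 < n) (hcop : n.Coprime 17)
    (hdvd : 24 ∣ 7 ^ 2 * 17 ^ 195 * n + 5) :
    7 ^ 2 ∣ multipartition 5 ((7 ^ 2 * 17 ^ 195 * n + 5) / 24) := by
  exact final_of hfin_all hval7 hval2251 n hcop hdvd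
end
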